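/- Inner–outer factorization: Let f ∈ H²(𝔹), f ≢ 0. Then f has a factorization f = φ * g where φ is inner and g is outer. Moreover, this factorization is unique up to a unitary constant: if f = φ * g = φ₁ * g₁ with φ, φ₁ inner and g, g₁ outer, then φ₁ = φ * λ and g₁ = conj(λ) * g for some λ ∈ ℍ with |λ| = 1. -/

import Mathlib

open MeasureTheory Filter Topology
open scoped ENNReal Classical

noncomputable section

/-! ### Basic quaternionic notions -/

instance : MeasurableSpace (Quaternion ℝ) := borel _
instance : BorelSpace (Quaternion ℝ) := ⟨rfl⟩

/-- The 2-sphere `𝕊` of quaternionic imaginary units. -/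
def USphere : Set (Quaternion ℝ) := {q | q ^ 2 = -1}

/-- The open quaternionic unit ball `𝔹`. -/
def QBall : Set (Quaternion ℝ) := {q | ‖q‖ < 1}

/-- The slice `L_I = ℝ + ℝI` through an imaginary unit `I`. -/
def sliceSet (I : Quaternion ℝ) : Set (Quaternion ℝ) :=
  {q | ∃ x y : ℝ, q = (x : Quaternion ℝ) + y • I}

/-- The point `e^{tI} = cos t + (sin t) I` of the boundary circle `∂𝔹_I`. -/
def ptOn (I : Quaternion ℝ) (t : ℝ) : Quaternion ℝ :=
  ((Real.cos t : ℝ) : Quaternion ℝ) + Real.sin t • I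

/-- Slice regularity on the unit ball: on every slice the restriction of `f` has partial
derivatives satisfying the Cauchy–Riemann equation `∂f/∂x + I ∂f/∂y = 0`. -/
def SliceRegular (f : Quaternion ℝ → Quaternion ℝ) : Prop :=
  ∀ I ∈ USphere, ∀ x y : ℝ, ((x : Quaternion ℝ) + y • I) ∈ QBall →
    ∃ fx fy : Quaternion ℝ,
      HasDerivAt (fun s : ℝ => f ((s : Quaternion ℝ) + y • I)) fx x ∧
      HasDerivAt (fun t : ℝ => f ((x : Quaternion ℝ) + t • I)) fy y ∧
      fx + I * fy = 0

/-! ### The Hardy space `H²(𝔹)` via power series coefficients.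
A slice regular function on `𝔹` is identified with its coefficient sequence
`a : ℕ → ℍ`, the function being `q ↦ ∑ qⁿ aₙ`. -/

/-- Membership in `H²(𝔹)`: square-summable coefficients. -/
def MemH2 (a : ℕ → Quaternion ℝ) : Prop := Summable (fun n => ‖a n‖ ^ 2)

/-- Evaluation of the power series `q ↦ ∑ qⁿ aₙ`. -/
def evalS (a : ℕ → Quaternion ℝ) (q : Quaternion ℝ) : Quaternion ℝ := ∑' n, q ^ n * a n

/-- The `*`-product (slice product) on coefficient sequences. -/
def sProd (a b : ℕ → Quaternion ℝ) : ℕ → Quaternion ℝ :=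
  fun n => ∑ k ∈ Finset.range (n + 1), a k * b (n - k)

/-- The regular conjugate `fᶜ`. -/
def conjS (a : ℕ → Quaternion ℝ) : ℕ → Quaternion ℝ := fun n => star (a n)

/-- The symmetrization `fˢ = f * fᶜ`. -/
def symmS (a : ℕ → Quaternion ℝ) : ℕ → Quaternion ℝ := sProd a (conjS a)

/-- The squared `H²` norm `∑ ‖aₙ‖²`. -/
def h2normSq (a : ℕ → Quaternion ℝ) : ℝ := ∑' n, ‖a n‖ ^ 2

/-- The `H²` norm. -/
def h2norm (a : ℕ → Quaternion ℝ) : ℝ := Real.sqrt (h2normSq a)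

/-- The (right) quaternionic inner product `⟨f,g⟩ = ∑ conj(bₙ) aₙ` of `H²(𝔹)`. -/
def h2inner (a b : ℕ → Quaternion ℝ) : Quaternion ℝ := ∑' n, star (b n) * a n

/-- Squared `H²`-distance of two coefficient sequences (valued in `ℝ≥0∞`). -/
def h2distSq (a b : ℕ → Quaternion ℝ) : ℝ≥0∞ := ∑' n, (‖a n - b n‖₊ : ℝ≥0∞) ^ 2

/-- The boundary value function of `f ∈ H²(𝔹)`, given by the radial limit where it exists. -/
def bdval (a : ℕ → Quaternion ℝ) (q : Quaternion ℝ) : Quaternion ℝ :=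
  if h : ∃ L, Tendsto (fun r : ℝ => evalS a ((r : Quaternion ℝ) * q)) (𝓝[<] (1 : ℝ)) (𝓝 L)
  then h.choose else 0

/-! ### The measure `Σ` on `∂𝔹` with `dΣ(e^{tI}) = dσ(I) dt`. -/

/-- The normalized area measure `σ` on the sphere `𝕊` of imaginary units
(2-dimensional Hausdorff measure, normalized so that `σ(𝕊) = 1`). -/
def sphMeasure : Measure (Quaternion ℝ) := (μH[2] USphere)⁻¹ • (μH[2]).restrict USphere

/-- The measure `Σ` on `∂𝔹`, `dΣ(e^{tI}) = dσ(I) dt`, normalized so `Σ(∂𝔹) = 1`. -/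
def SigmaBd : Measure (Quaternion ℝ) :=
  (ENNReal.ofReal (2 * Real.pi))⁻¹ •
    Measure.map (fun p : ℝ × Quaternion ℝ => ptOn p.2 p.1)
      ((volume.restrict (Set.Ico 0 (2 * Real.pi))).prod sphMeasure)

/-! ### Inner, outer, cyclic -/

/-- `f ∈ H^∞(𝔹)`: a bounded function of `H²(𝔹)`. -/
def MemHinf (a : ℕ → Quaternion ℝ) : Prop :=
  MemH2 a ∧ ∃ C : ℝ, ∀ q ∈ QBall, ‖evalS a q‖ ≤ C

/-- The `H^∞` norm: the sup of `‖f‖` on the ball. -/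
def hInfNorm (a : ℕ → Quaternion ℝ) : ℝ := sSup ((fun q => ‖evalS a q‖) '' QBall)

/-- `f` is inner: `f ∈ H^∞(𝔹)`, `‖f‖ ≤ 1` on `𝔹` and `‖f‖ = 1` `Σ`-a.e. on `∂𝔹`. -/
def IsInnerQ (a : ℕ → Quaternion ℝ) : Prop :=
  MemH2 a ∧ (∀ q ∈ QBall, ‖evalS a q‖ ≤ 1) ∧ (∀ᵐ q ∂SigmaBd, ‖bdval a q‖ = 1)

/-- `g` is outer: whenever `f ∈ H²(𝔹)` has the same boundary modulus `Σ`-a.e.,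
then `‖g‖ ≥ ‖f‖` throughout `𝔹`. -/
def IsOuterQ (g : ℕ → Quaternion ℝ) : Prop :=
  MemH2 g ∧ ∀ f, MemH2 f → (∀ᵐ q ∂SigmaBd, ‖bdval g q‖ = ‖bdval f q‖) →
    ∀ q ∈ QBall, ‖evalS f q‖ ≤ ‖evalS g q‖

/-- Quaternionic polynomials (finitely supported coefficient sequences). -/
def IsPolyQ (p : ℕ → Quaternion ℝ) : Prop := ∃ N, ∀ n > N, p n = 0

/-- Quaternionic polynomials of degree at most `n` (the space `𝒫_n`). -/
def IsPolyDeg (p : ℕ → Quaternion ℝ) (n : ℕ) : Prop := ∀ m > n, p m = 0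

/-- The coefficient sequence of the monomial `qᵏ`. -/
def qpow (k : ℕ) : ℕ → Quaternion ℝ := fun n => if n = k then 1 else 0

/-- The coefficient sequence of a constant function. -/
def constS (c : Quaternion ℝ) : ℕ → Quaternion ℝ := fun n => if n = 0 then c else 0

/-- The coefficient sequence of the constant function `1`. -/
def oneS : ℕ → Quaternion ℝ := constS 1

/-- The invariant subspace `[g]`: the `H²`-closure of `{g * p : p polynomial}`,
i.e. of the right span of `{qⁿ * g : n ≥ 0}`. -/
def InvSub (g : ℕ → Quaternion ℝ) : Set (ℕ → Quaternion ℝ) :=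
  {h | MemH2 h ∧ ∀ ε : ℝ≥0∞, 0 < ε → ∃ p, IsPolyQ p ∧ h2distSq (sProd g p) h < ε}

/-- `g` is cyclic: `[g] = H²(𝔹)`. -/
def IsCyclicQ (g : ℕ → Quaternion ℝ) : Prop :=
  MemH2 g ∧ ∀ h, MemH2 h → h ∈ InvSub g

/-! ### Bilateral (slice `L²`) series, used for boundary products -/

/-- Bilateral coefficients of `f̃(q) = f(q̄)` on `∂𝔹`: `Σ_{n ≤ 0} qⁿ a_{-n}`. -/
def tildeZ (a : ℕ → Quaternion ℝ) : ℤ → Quaternion ℝ :=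
  fun k => if k ≤ 0 then a (-k).toNat else 0

/-- Bilateral coefficients of `fᶜ` on `∂𝔹`. -/
def conjZ (a : ℕ → Quaternion ℝ) : ℤ → Quaternion ℝ :=
  fun k => if 0 ≤ k then star (a k.toNat) else 0

/-- The `*`-product of two slice `L²` functions on the boundary, on coefficients. -/
def convZ (c b : ℤ → Quaternion ℝ) : ℤ → Quaternion ℝ := fun n => ∑' k : ℤ, c k * b (n - k)

/-- Evaluation of a bilateral series `q ↦ ∑_{n ∈ ℤ} qⁿ dₙ`. -/
def evalZ (d : ℤ → Quaternion ℝ) (q : Quaternion ℝ) : Quaternion ℝ := ∑' n : ℤ, q ^ n * d n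

/-- The slice inner product `⟨qᵏ * f, f⟩_I = (1/2π)∫₀^{2π} conj(f(e^{θI})) (e^{θI})ᵏ f(e^{θI}) dθ`,
computed with boundary values; note `(qᵏ * f)(q) = qᵏ f(q)` pointwise. -/
def sliceInnerPow (a : ℕ → Quaternion ℝ) (I : Quaternion ℝ) (k : ℕ) : Quaternion ℝ :=
  (2 * Real.pi)⁻¹ •
    ∫ t in Set.Ico 0 (2 * Real.pi), star (bdval a (ptOn I t)) * ((ptOn I t) ^ k * bdval a (ptOn I t))

/-! ### Complex Hardy space `H²(𝔻)` notions (for slice restrictions) -/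

/-- Membership in the complex Hardy space `H²(𝔻)` via coefficients. -/
def CMemH2 (c : ℕ → ℂ) : Prop := Summable (fun n => ‖c n‖ ^ 2)

/-- Evaluation of a complex power series. -/
def cEval (c : ℕ → ℂ) (z : ℂ) : ℂ := ∑' n, z ^ n * c n

/-- Cauchy product of complex coefficient sequences. -/
def cConv (c d : ℕ → ℂ) : ℕ → ℂ := fun n => ∑ k ∈ Finset.range (n + 1), c k * d (n - k)

/-- Squared `H²(𝔻)` distance. -/
def cDistSq (c d : ℕ → ℂ) : ℝ≥0∞ := ∑' n, (‖c n - d n‖₊ : ℝ≥0∞) ^ 2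

/-- Radial boundary values of a complex `H²` function. -/
def cBdval (c : ℕ → ℂ) (z : ℂ) : ℂ :=
  if h : ∃ L, Tendsto (fun r : ℝ => cEval c ((r : ℂ) * z)) (𝓝[<] (1 : ℝ)) (𝓝 L)
  then h.choose else 0

/-- Lebesgue measure on the unit circle `∂𝔻` (parametrized by `θ ∈ [0, 2π)`). -/
def circleM : Measure ℂ :=
  Measure.map (fun t : ℝ => Complex.exp (t * Complex.I)) (volume.restrict (Set.Ico 0 (2 * Real.pi)))

/-- Cyclicity in `H²(𝔻)`: polynomial multiples of `c` are dense. -/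
def CIsCyclic (c : ℕ → ℂ) : Prop :=
  CMemH2 c ∧ ∀ h, CMemH2 h → ∀ ε : ℝ≥0∞, 0 < ε →
    ∃ p : ℕ → ℂ, (∃ N, ∀ n > N, p n = 0) ∧ cDistSq (cConv c p) h < ε

/-- Outerness in `H²(𝔻)` (in the sense matching Definition 2.10 of the paper). -/
def CIsOuter (c : ℕ → ℂ) : Prop :=
  CMemH2 c ∧ ∀ h, CMemH2 h →
    (∀ᵐ z ∂circleM, ‖cBdval c z‖ = ‖cBdval h z‖) →
    ∀ z ∈ Metric.ball (0 : ℂ) 1, ‖cEval h z‖ ≤ ‖cEval c z‖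

/-- Complex coordinates of a point of the slice `L_I`: if `p = x + yI` then
`sliceToC I p = x + iy`. -/
def sliceToC (I : Quaternion ℝ) (p : Quaternion ℝ) : ℂ := ⟨p.re, -(p * I).re⟩

/-- The quaternion `i`. -/
def qI : Quaternion ℝ := ⟨0, 1, 0, 0⟩

/-- The embedding of `ℂ = L_i` into the quaternions. -/
def cToQ (z : ℂ) : Quaternion ℝ := (z.re : Quaternion ℝ) + z.im • qI

/-- The imaginary unit `I_ω` identified by `ω` (any imaginary unit if `ω` is real). -/
def Iu (ω : Quaternion ℝ) : Quaternion ℝ := if ω.im = 0 then qI else ‖ω.im‖⁻¹ • ω.im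

/-! ### Optimal approximants -/

/-- `p` is an optimal approximant of degree `n` of `f^{-*}`: `p ∈ 𝒫_n` minimizes
`‖f * p - 1‖_{H²}` among all `p ∈ 𝒫_n`. -/
def IsOptApprox (a : ℕ → Quaternion ℝ) (n : ℕ) (p : ℕ → Quaternion ℝ) : Prop :=
  IsPolyDeg p n ∧ ∀ r, IsPolyDeg r n → h2distSq (sProd a p) oneS ≤ h2distSq (sProd a r) oneS

end

section
open MeasureTheory Filter Topology
open scoped ENNReal Classical

namespace HFact
open Metric

theorem cauchy_deriv {E : ℂ → ℂ} (hE : DiffContOnCl ℂ E (ball 0 1)) {w : ℂ} (hw : w ∈ ball (0:ℂ) 1) :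
    ((2 * Real.pi * Complex.I : ℂ)⁻¹ • ∮ z in C(0, 1), ((z - w) ^ 2)⁻¹ • E z) = deriv E w := by
  have hcl : closure (ball (0:ℂ) 1) = closedBall 0 1 := closure_ball _ one_ne_zero
  have hcont : ContinuousOn E (closedBall 0 1) := hcl ▸ hE.continuousOn
  have hf' : DiffContOnCl ℂ (dslope E w) (ball 0 1) := by
    refine ⟨(Complex.differentiableOn_dslope (isOpen_ball.mem_nhds hw)).mpr hE.differentiableOn, ?_⟩
    rw [hcl]
    exact (continuousOn_dslope (closedBall_mem_nhds_of_mem hw)).2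
      ⟨hcont, hE.differentiableAt isOpen_ball hw⟩
  have h0 := hf'.two_pi_i_inv_smul_circleIntegral_sub_inv_smul hw
  rw [← dslope_same, ← h0]
  congr 1
  trans ∮ z in C(0, 1), ((z - w) ^ 2)⁻¹ • (E z - E w)
  · have h1 : ContinuousOn (fun z : ℂ => ((z - w) ^ 2)⁻¹) (sphere 0 1) := by
      refine ((continuous_id'.sub continuous_const).pow 2).continuousOn.inv₀ fun v hv h => ?_
      exact sphere_disjoint_ball.ne_of_mem hv hw (sub_eq_zero.mp (sq_eq_zero_iff.mp h))
    have h2 : CircleIntegrable (fun z : ℂ => ((z - w) ^ 2)⁻¹ • E z) 0 1 := by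
      refine ContinuousOn.circleIntegrable zero_le_one ?_
      exact h1.smul (hcont.mono sphere_subset_closedBall)
    have h3 : CircleIntegrable (fun z : ℂ => ((z - w) ^ 2)⁻¹ • E w) 0 1 :=
      ContinuousOn.circleIntegrable zero_le_one (h1.smul continuousOn_const)
    have h4 : (∮ z : ℂ in C(0, 1), ((z - w) ^ 2)⁻¹) = 0 := by
      simpa using! circleIntegral.integral_sub_zpow_of_ne (by decide : (-2 : ℤ) ≠ -1) 0 w 1
    simp only [smul_sub, circleIntegral.integral_sub h2 h3, h4, circleIntegral.integral_smul_const,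
      zero_smul, sub_zero]
  · refine circleIntegral.integral_congr zero_le_one fun z hz => ?_
    simp only [dslope_of_ne, slope_def_module, sphere_disjoint_ball.ne_of_mem hz hw, smul_smul, Ne,
      not_false_eq_true, sq, mul_inv]
    
theorem cauchy_zero {E : ℂ → ℂ} (hE : DiffContOnCl ℂ E (ball 0 1)) {w : ℂ} (hw : 1 < ‖w‖) :
    (∮ z in C(0, 1), ((z - w) ^ 2)⁻¹ • E z) = 0 := by
  apply DiffContOnCl.circleIntegral_eq_zero zero_le_one
  refine DiffContOnCl.smul ?_ hE
  apply DifferentiableOn.diffContOnCl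
  rw [closure_ball _ one_ne_zero]
  intro z hz
  have : z - w ≠ 0 := by
    intro h
    rw [sub_eq_zero] at h
    subst h
    simp at hz
    linarith
  apply DifferentiableAt.differentiableWithinAt
  fun_prop (disch := simpa using this)

theorem norm_refl {z ζ : ℂ} (hz : ‖z‖ = 1) (hζ : ‖ζ‖ = 1) (r : ℝ) :
    ‖r * z - ζ‖ = ‖z - r * ζ‖ := by
  have h1 : z.re ^ 2 + z.im ^ 2 = 1 := by
    have := Complex.sq_norm z; rw [hz, Complex.normSq_apply] at this; linarith
  have h2 : ζ.re ^ 2 + ζ.im ^ 2 = 1 := by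
    have := Complex.sq_norm ζ; rw [hζ, Complex.normSq_apply] at this; linarith
  rw [← sq_eq_sq₀ (norm_nonneg _) (norm_nonneg _), Complex.sq_norm, Complex.sq_norm,
    Complex.normSq_apply, Complex.normSq_apply]
  simp
  linear_combination (r^2-1) * h1 + (1-r^2) * h2

theorem kernel_bound {z ζ : ℂ} (hz : ‖z‖ = 1) (hζ : ‖ζ‖ = 1) {r : ℝ} (h0 : 0 < r) (h1 : r < 1) :
    ‖((z - r * ζ) ^ 2)⁻¹ - ((z - ζ / r) ^ 2)⁻¹‖ ≤ 2 * (1 - r ^ 2) / ‖z - r * ζ‖ ^ 3 := by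
  have hr : (r : ℂ) ≠ 0 := by exact_mod_cast h0.ne'
  set a := z - r * ζ with ha
  set b := z - ζ / r with hb
  have hab : ‖b‖ = ‖a‖ / r := by
    rw [ha, ← norm_refl hz hζ r]
    have : b = (r * z - ζ) / r := by rw [hb]; field_simp
    rw [this, norm_div]; simp [abs_of_pos h0]
  have hapos : 0 < ‖a‖ := by
    rw [norm_pos_iff, ha]; intro h
    rw [sub_eq_zero] at h
    have := congrArg norm h
    rw [hz, norm_mul, hζ] at this
    simp [abs_of_pos h0] at this; linarith
  have hbpos : 0 < ‖b‖ := by rw [hab]; positivity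
  have ha0 : a ≠ 0 := norm_pos_iff.1 hapos
  have hb0 : b ≠ 0 := norm_pos_iff.1 hbpos
  have e1 : (a ^ 2)⁻¹ - (b ^ 2)⁻¹ = (b - a) * (b + a) / (a ^ 2 * b ^ 2) := by field_simp; ring
  have e2 : ‖b - a‖ = (1 - r ^ 2) / r := by
    have : b - a = -(((1 - r ^ 2) / r : ℝ) : ℂ) * ζ := by
      rw [ha, hb]; push_cast; field_simp; ring
    rw [this, norm_mul, hζ, norm_neg, Complex.norm_real, Real.norm_eq_abs, abs_of_nonneg]
    · ring
    · have : r ^ 2 ≤ 1 := by nlinarith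
      apply div_nonneg <;> linarith
  have e3 : ‖b + a‖ ≤ ‖a‖ * (1 + 1 / r) := by
    refine (norm_add_le _ _).trans ?_
    rw [hab]; apply le_of_eq; ring
  have h1r : 0 ≤ 1 - r ^ 2 := by nlinarith
  rw [e1, norm_div, norm_mul, norm_mul, norm_pow, norm_pow, e2, hab]
  calc (1 - r ^ 2) / r * ‖b + a‖ / (‖a‖ ^ 2 * (‖a‖ / r) ^ 2)
      ≤ (1 - r ^ 2) / r * (‖a‖ * (1 + 1 / r)) / (‖a‖ ^ 2 * (‖a‖ / r) ^ 2) := by gcongr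
    _ = (1 - r ^ 2) * (r + 1) / ‖a‖ ^ 3 := by field_simp
    _ ≤ 2 * (1 - r ^ 2) / ‖a‖ ^ 3 := by
        apply div_le_div_of_nonneg_right _ (by positivity)
        nlinarith

theorem deriv_bound {E : ℂ → ℂ} (hE : DiffContOnCl ℂ E (ball 0 1)) {ζ : ℂ} (hζ : ‖ζ‖ = 1)
    {ε B : ℝ} (hε : 0 ≤ ε) (hB : 0 ≤ B)
    (hb : ∀ z, ‖z‖ = 1 → ‖E z‖ ≤ ε * ‖z - ζ‖ + B * ‖z - ζ‖ ^ 3) {r : ℝ} (h0 : 0 < r) (h1 : r < 1) :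
    ‖deriv E (r * ζ)‖ ≤ 4 * ε + 16 * B * (1 - r ^ 2) := by
  have hw : (r * ζ : ℂ) ∈ ball (0:ℂ) 1 := by simp [hζ, abs_of_pos h0, h1]
  have hw' : 1 < ‖ζ / r‖ := by
    rw [norm_div, hζ]; simp [abs_of_pos h0]; exact (one_lt_inv₀ h0).2 h1
  have hcl : closure (ball (0:ℂ) 1) = closedBall 0 1 := closure_ball _ one_ne_zero
  have hcont : ContinuousOn E (sphere 0 1) := (hcl ▸ hE.continuousOn).mono sphere_subset_closedBall
  have hsub : ∀ v : ℂ, ‖v‖ ≠ 1 → ContinuousOn (fun z : ℂ => ((z - v) ^ 2)⁻¹) (sphere 0 1) := by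
    intro v hv
    refine ((continuous_id'.sub continuous_const).pow 2).continuousOn.inv₀ fun u hu h => ?_
    have h' : (u - v) ^ 2 = 0 := h
    have h := sub_eq_zero.mp (sq_eq_zero_iff.mp h')
    subst h; simp at hu; exact hv hu
  have hwn : ‖(r * ζ : ℂ)‖ ≠ 1 := by
    simp at hw; simp; linarith
  have i1 : CircleIntegrable (fun z : ℂ => ((z - r * ζ) ^ 2)⁻¹ • E z) 0 1 :=
    ContinuousOn.circleIntegrable zero_le_one ((hsub _ hwn).smul hcont)
  have i2 : CircleIntegrable (fun z : ℂ => ((z - ζ / r) ^ 2)⁻¹ • E z) 0 1 :=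
    ContinuousOn.circleIntegrable zero_le_one ((hsub _ hw'.ne').smul hcont)
  have key : deriv E (r * ζ) = (2 * Real.pi * Complex.I : ℂ)⁻¹ •
      ∮ z in C(0, 1), (((z - r * ζ) ^ 2)⁻¹ - ((z - ζ / r) ^ 2)⁻¹) • E z := by
    simp_rw [sub_smul]
    rw [circleIntegral.integral_sub i1 i2, cauchy_zero hE hw', sub_zero, cauchy_deriv hE hw]
  have havg := DiffContOnCl.circleAverage_poissonKernel_smul (f := fun _ : ℂ => (1:ℝ) • (1:ℂ)) (c := 0) (R := 1)
    diffContOnCl_const hw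
  have hPcont : ContinuousOn (poissonKernel 0 (r * ζ)) (sphere (0:ℂ) 1) := by
    unfold poissonKernel
    refine ContinuousOn.div (by fun_prop) (by fun_prop) ?_
    intro z hz h
    simp [sub_eq_zero] at h hz
    rw [h] at hz
    exact hwn hz
  have havg1 : Real.circleAverage (poissonKernel 0 (r * ζ)) 0 1 = 1 := by
    have : ((Real.circleAverage (poissonKernel 0 (r * ζ)) 0 1 : ℝ) : ℂ) = 1 := by
      rw [← havg.trans (one_smul _ _)]
      simp only [Real.circleAverage_def, Complex.real_smul]
      rw [smul_eq_mul]
      push_cast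
      rw [← intervalIntegral.integral_ofReal]
      simp
    exact_mod_cast this
  have hPci : CircleIntegrable (poissonKernel 0 (r * ζ)) 0 1 := hPcont.circleIntegrable zero_le_one
  have hsum : Real.circleAverage (fun z => 4 * ε * poissonKernel 0 (r * ζ) z + 16 * B * (1 - r ^ 2)) 0 1
      = 4 * ε + 16 * B * (1 - r ^ 2) := by
    have h1 : CircleIntegrable (fun z => 4 * ε * poissonKernel 0 (r * ζ) z) 0 1 := by
      simpa using! hPci.const_smul (a := 4 * ε)
    rw [Real.circleAverage_fun_add h1 (circleIntegrable_const _ _ _), Real.circleAverage_const]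
    have := Real.circleAverage_fun_smul (f := poissonKernel 0 (r * ζ)) (a := 4 * ε) (c := 0) (R := 1)
    simp only [smul_eq_mul] at this
    rw [this, havg1, mul_one]
  rw [← hsum, key, circleIntegral, norm_smul]
  have hn : ‖(2 * Real.pi * Complex.I : ℂ)⁻¹‖ = (2 * Real.pi)⁻¹ := by
    simp [abs_of_pos Real.pi_pos]
  rw [hn, Real.circleAverage_def, smul_eq_mul]
  gcongr
  have hrhs : IntervalIntegrable (fun θ => 4 * ε * poissonKernel 0 (r * ζ) (circleMap 0 1 θ) + 16 * B * (1 - r ^ 2)) volume 0 (2 * Real.pi) := by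
    have := hPci
    unfold CircleIntegrable at this
    exact (this.const_mul _).add (by simp)
  refine intervalIntegral.norm_integral_le_of_norm_le (by positivity) (ae_of_all _ fun θ _ => ?_) hrhs
  set z := circleMap 0 1 θ with hz
  have hz1 : ‖z‖ = 1 := by simp [hz]
  have hd : ‖deriv (circleMap 0 1) θ‖ = 1 := by simp
  rw [norm_smul, norm_smul, hd, one_mul]
  set d := ‖z - r * ζ‖ with hdd
  have hdpos : 0 < d := by
    rw [hdd, norm_pos_iff, sub_ne_zero]; intro h; rw [← h] at hwn; exact hwn hz1
  have hrz : ‖(r * ζ : ℂ)‖ = r := by simp [hζ, abs_of_pos h0]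
  have h2d : ‖z - ζ‖ ≤ 2 * d := by
    have e1 : ‖z - ζ‖ ≤ d + ‖r * ζ - ζ‖ := by
      have : z - ζ = (z - r * ζ) + (r * ζ - ζ) := by ring
      rw [this]; exact norm_add_le _ _
    have e2 : ‖r * ζ - ζ‖ = 1 - r := by
      have : (r * ζ - ζ : ℂ) = -(((1 - r : ℝ) : ℂ) * ζ) := by push_cast; ring
      rw [this, norm_neg, norm_mul, hζ, Complex.norm_real, Real.norm_eq_abs, abs_of_pos (by linarith)]; ring
    have e3 : 1 - r ≤ d := by
      have := norm_sub_norm_le z (r * ζ); rw [hz1, hrz] at this; exact this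
    linarith
  have h1r : 0 ≤ 1 - r ^ 2 := by nlinarith
  calc _ ≤ (2 * (1 - r ^ 2) / d ^ 3) * (ε * (2 * d) + B * (2 * d) ^ 3) := by
        apply mul_le_mul (kernel_bound hz1 hζ h0 h1) _ (norm_nonneg _) (by positivity)
        refine (hb z hz1).trans ?_
        gcongr
    _ = 4 * ε * ((1 - r ^ 2) / d ^ 2) + 16 * B * (1 - r ^ 2) := by field_simp; ring
    _ = _ := by
        rw [poissonKernel_def]; simp only [sub_zero]; rw [hz1, hrz, ← hdd, one_pow]
        
theorem arg_bound {z ζ : ℂ} (hz : ‖z‖ = 1) (hζ : ‖ζ‖ = 1) :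
    |Complex.arg (z / ζ)| ≤ Real.pi / 2 * ‖z - ζ‖ := by
  have hz0 : z ≠ 0 := by intro h; simp [h] at hz
  have hζ0 : ζ ≠ 0 := by intro h; simp [h] at hζ
  rw [← Complex.angle_eq_abs_arg hz0 hζ0]
  have := Complex.mul_angle_le_norm_sub hz hζ
  have hp := Real.pi_pos
  calc _ = Real.pi / 2 * (2 / Real.pi * InnerProductGeometry.angle z ζ) := by field_simp
    _ ≤ _ := by gcongr

theorem fatou_local {F : ℂ → ℂ} (hF : DiffContOnCl ℂ F (ball 0 1)) {t₀ : ℝ} {D : ℂ}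
    (hD : HasDerivAt (fun t : ℝ => F (Complex.exp (t * Complex.I))) D t₀) :
    Tendsto (fun r : ℝ => (r * Complex.exp (t₀ * Complex.I)) * deriv F (r * Complex.exp (t₀ * Complex.I)))
      (𝓝[<] (1:ℝ)) (𝓝 (D / Complex.I)) := by
  set ζ := Complex.exp (t₀ * Complex.I) with hζdef
  have hζ : ‖ζ‖ = 1 := Complex.norm_exp_ofReal_mul_I t₀
  have hζ0 : ζ ≠ 0 := Complex.exp_ne_zero _
  set A := D / (Complex.I * ζ) with hA
  set E : ℂ → ℂ := fun z => F z - (F ζ + A * (z - ζ)) with hEdef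
  have hE : DiffContOnCl ℂ E (ball 0 1) :=
    hF.sub (Differentiable.diffContOnCl (by fun_prop))
  have hcl : closure (ball (0:ℂ) 1) = closedBall 0 1 := closure_ball _ one_ne_zero
  have hexp : HasDerivAt (fun t : ℝ => Complex.exp (t * Complex.I)) (ζ * Complex.I) t₀ := by
    have h1 : HasDerivAt (fun t : ℝ => (t : ℂ) * Complex.I) Complex.I t₀ := by
      simpa using (Complex.ofRealCLM.hasDerivAt (x := t₀)).mul_const Complex.I
    exact h1.cexp
  have hE' : HasDerivAt (fun t : ℝ => E (Complex.exp (t * Complex.I))) 0 t₀ := by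
    have h3 := hD.sub (((hexp.sub_const ζ).const_mul A).const_add (F ζ))
    have : D - A * (ζ * Complex.I) = 0 := by
      rw [hA]; field_simp; ring
    rw [this] at h3
    exact h3
  have hE0 : E ζ = 0 := by simp [hEdef]
  have hbd : ∀ ε > 0, ∃ B ≥ 0, ∀ z, ‖z‖ = 1 → ‖E z‖ ≤ ε * ‖z - ζ‖ + B * ‖z - ζ‖ ^ 3 := by
    intro ε hε
    obtain ⟨M, hM⟩ := (isCompact_closedBall (0:ℂ) 1).exists_bound_of_continuousOn (hcl ▸ hE.continuousOn)
    have hM0 : 0 ≤ M := (norm_nonneg _).trans (hM 0 (by simp))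
    rw [hasDerivAt_iff_isLittleO] at hE'
    have h2 := hE'.def (c := ε * (2 / Real.pi)) (by positivity)
    rw [Metric.eventually_nhds_iff] at h2
    obtain ⟨δ, hδ, h2⟩ := h2
    refine ⟨M * (Real.pi / (2 * δ)) ^ 3, by positivity, fun z hz => ?_⟩
    set s := Complex.arg (z / ζ) with hs
    have hsb := arg_bound hz hζ
    rw [← hs] at hsb
    have hzs : Complex.exp (((t₀ + s : ℝ) : ℂ) * Complex.I) = z := by
      push_cast
      rw [add_mul, Complex.exp_add, ← hζdef]
      have := Complex.norm_mul_exp_arg_mul_I (z / ζ)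
      rw [norm_div, hz, hζ] at this
      simp only [div_one, Complex.ofReal_one, one_mul] at this
      rw [← hs] at this
      rw [this]; field_simp
    rcases lt_or_ge |s| δ with h | h
    · have := @h2 (t₀ + s) (by simpa [Real.dist_eq] using h)
      rw [hzs, ← hζdef, hE0] at this
      simp only [sub_zero, smul_zero, add_sub_cancel_left] at this
      rw [Real.norm_eq_abs] at this
      calc ‖E z‖ ≤ ε * (2 / Real.pi) * |s| := this
        _ ≤ ε * (2 / Real.pi) * (Real.pi / 2 * ‖z - ζ‖) := by gcongr
        _ = ε * ‖z - ζ‖ := by have := Real.pi_pos; field_simp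
        _ ≤ _ := by
          have : 0 ≤ M * (Real.pi / (2 * δ)) ^ 3 * ‖z - ζ‖ ^ 3 := by positivity
          linarith
    · have h3 : 1 ≤ Real.pi / (2 * δ) * ‖z - ζ‖ := by
        have : δ ≤ Real.pi / 2 * ‖z - ζ‖ := h.trans hsb
        calc (1:ℝ) = δ / δ := by field_simp
          _ ≤ (Real.pi / 2 * ‖z - ζ‖) / δ := by gcongr
          _ = _ := by field_simp
      calc ‖E z‖ ≤ M * 1 := by rw [mul_one]; exact hM z (by simp [hz])
        _ ≤ M * (Real.pi / (2 * δ) * ‖z - ζ‖) ^ 3 := by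
            gcongr; exact one_le_pow₀ h3
        _ = M * (Real.pi / (2 * δ)) ^ 3 * ‖z - ζ‖ ^ 3 := by ring
        _ ≤ _ := by
          have : 0 ≤ ε * ‖z - ζ‖ := by positivity
          linarith
  have hmain : Tendsto (fun r : ℝ => deriv E (r * ζ)) (𝓝[<] (1:ℝ)) (𝓝 0) := by
    rw [Metric.tendsto_nhds]
    intro ε hε
    obtain ⟨B, hB, hb⟩ := hbd (ε / 8) (by positivity)
    have hlim : Tendsto (fun r : ℝ => 4 * (ε / 8) + 16 * B * (1 - r ^ 2)) (𝓝[<] (1:ℝ)) (𝓝 (4 * (ε/8) + 16 * B * (1 - 1 ^ 2))) := by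
      apply Tendsto.mono_left _ nhdsWithin_le_nhds
      apply Continuous.tendsto (by fun_prop)
    have hl : ∀ᶠ r : ℝ in 𝓝[<] 1, 4 * (ε / 8) + 16 * B * (1 - r ^ 2) < ε :=
      hlim.eventually_lt_const (by linarith)
    have hpos : ∀ᶠ r : ℝ in 𝓝[<] 1, 0 < r :=
      nhdsWithin_le_nhds (lt_mem_nhds one_pos)
    filter_upwards [hl, hpos, self_mem_nhdsWithin] with r h1 h2 h3
    rw [dist_zero_right]
    exact (deriv_bound hE hζ (by positivity) hB hb h2 h3).trans_lt h1
  have hpos : ∀ᶠ r : ℝ in 𝓝[<] 1, 0 < r :=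
      nhdsWithin_le_nhds (lt_mem_nhds one_pos)
  have hrζ : Tendsto (fun r : ℝ => (r * ζ : ℂ)) (𝓝[<] (1:ℝ)) (𝓝 ((1:ℝ) * ζ)) := by
    apply Tendsto.mono_left _ nhdsWithin_le_nhds
    apply Continuous.tendsto (f := fun r : ℝ => (r * ζ : ℂ)) (by fun_prop)
  have := hrζ.mul (hmain.add_const A)
  have e : ((1:ℝ) * ζ) * (0 + A) = D / Complex.I := by rw [hA]; push_cast; field_simp; ring
  rw [e] at this
  refine this.congr' ?_
  filter_upwards [hpos, self_mem_nhdsWithin] with r h2 h3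
  congr 1
  have hw : (r * ζ : ℂ) ∈ ball (0:ℂ) 1 := by simp [hζ, abs_of_pos h2]; exact h3
  have hd := hF.differentiableAt isOpen_ball hw
  have : HasDerivAt E (deriv F (r * ζ) - A) (r * ζ) := by
    have h1 := (((hasDerivAt_id (r * ζ : ℂ)).sub_const ζ).const_mul A).const_add (F ζ)
    have := hd.hasDerivAt.sub h1
    simpa using! this
  rw [this.deriv]; ring

end HFact

end

section
open MeasureTheory Filter Topology
open scoped ENNReal Classical
noncomputable section
namespace HFact

instance instTwoPi : Fact (0 < 2 * Real.pi) := ⟨Real.two_pi_pos⟩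
abbrev Tor := AddCircle (2 * Real.pi)
abbrev muT : Measure Tor := AddCircle.haarAddCircle

def ext (c : ℕ → ℂ) : ℤ → ℂ := fun n => if 0 ≤ n then c n.toNat else 0

theorem ext_nat (c : ℕ → ℂ) (n : ℕ) : ext c n = c n := by simp [ext]
theorem ext_neg (c : ℕ → ℂ) {n : ℤ} (h : n < 0) : ext c n = 0 := by simp [ext, not_le.2 h]

theorem summable_ext {c : ℕ → ℂ} (h : CMemH2 c) : Summable (fun n => ‖ext c n‖ ^ 2) := by
  have : Summable (fun n : ℤ => if 0 ≤ n then ‖c n.toNat‖ ^ 2 else 0) := by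
    have hinj : Function.Injective (fun n : ℕ => (n : ℤ)) := Nat.cast_injective
    refine (Function.Injective.summable_iff hinj ?_).1 ?_
    · intro x hx
      simp only [Set.mem_range, not_exists] at hx
      rw [if_neg]
      intro h
      exact hx x.toNat (by omega)
    · refine Summable.congr h fun n => ?_
      simp
  refine this.congr fun n => ?_
  unfold ext; split_ifs <;> simp

theorem memlp_ext {c : ℕ → ℂ} (h : CMemH2 c) : Memℓp (ext c) 2 := by
  apply memℓp_gen
  simpa using summable_ext h

def bd (c : ℕ → ℂ) : Tor → ℂ :=
  if h : CMemH2 c then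
    ((fourierBasis.repr.symm ⟨ext c, memlp_ext h⟩ : Lp ℂ 2 muT) : Tor → ℂ) else 0

theorem memLp_bd (c : ℕ → ℂ) : MemLp (bd c) 2 muT := by
  unfold bd; split_ifs with h
  · exact Lp.memLp _
  · exact MemLp.zero

theorem meas_bd (c : ℕ → ℂ) : StronglyMeasurable (bd c) := by
  unfold bd; split_ifs with h
  · exact Lp.stronglyMeasurable _
  · exact stronglyMeasurable_zero

theorem coeff_bd {c : ℕ → ℂ} (h : CMemH2 c) (n : ℤ) : fourierCoeff (bd c) n = ext c n := by
  unfold bd; rw [dif_pos h, ← fourierBasis_repr]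
  simp

theorem coeff_toLp {F : Tor → ℂ} (hF : MemLp F 2 muT) (n : ℤ) :
    fourierBasis.repr (hF.toLp F) n = fourierCoeff F n := by
  rw [fourierBasis_repr]
  exact congrFun (fourierCoeff_congr_ae hF.coeFn_toLp) n

theorem l2_unique {F G : Tor → ℂ} (hF : MemLp F 2 muT) (hG : MemLp G 2 muT)
    (h : ∀ n, fourierCoeff F n = fourierCoeff G n) : F =ᵐ[muT] G := by
  rw [← MemLp.toLp_eq_toLp_iff hF hG]
  apply fourierBasis.repr.injective
  ext n
  rw [coeff_toLp, coeff_toLp, h]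

theorem l2_summable {F : Tor → ℂ} (hF : MemLp F 2 muT) :
    Summable (fun n => ‖fourierCoeff F n‖ ^ 2) := by
  have := (lp.memℓp (fourierBasis.repr (hF.toLp F))).summable (by norm_num)
  simp_rw [coeff_toLp] at this
  simpa using this

theorem s1 {F : Tor → ℂ} (hF : MemLp F 2 muT) {c : ℕ → ℂ}
    (h : ∀ n, fourierCoeff F n = ext c n) : CMemH2 c ∧ F =ᵐ[muT] bd c := by
  have h1 : CMemH2 c := by
    have := l2_summable hF
    have := this.comp_injective (Nat.cast_injective (R := ℤ))
    refine this.congr fun n => ?_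
    simp [h, ext]
  exact ⟨h1, l2_unique hF (memLp_bd c) fun n => by rw [h, coeff_bd h1]⟩

theorem parseval {F : Tor → ℂ} (hF : MemLp F 2 muT) :
    HasSum (fun n => ‖fourierCoeff F n‖ ^ 2) (∫ t, ‖F t‖ ^ 2 ∂muT) := by
  have h := tsum_sq_fourierCoeff (hF.toLp F)
  have e : ∀ n, fourierCoeff (hF.toLp F) n = fourierCoeff F n := fun n =>
    congrFun (fourierCoeff_congr_ae hF.coeFn_toLp) n
  simp_rw [e] at h
  have : ∫ t, ‖F t‖ ^ 2 ∂muT = ∫ t, ‖hF.toLp F t‖ ^ 2 ∂muT := by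
    apply integral_congr_ae
    filter_upwards [hF.coeFn_toLp] with t ht
    rw [ht]
  rw [this, ← h]
  exact (l2_summable hF).hasSum

theorem conv_hasSum {F G : Tor → ℂ} (hF : MemLp F 2 muT) (hG : MemLp G 2 muT) (n : ℤ) :
    HasSum (fun k => fourierCoeff F k * fourierCoeff G (n - k)) (fourierCoeff (fun t => F t * G t) n) := by
  have hX : MemLp (fun t => fourier n t * star (G t)) 2 muT := by
    refine hG.star.of_le (f := fun t => fourier n t * star (G t)) ?_ ?_
    · exact ((map_continuous (fourier n)).aestronglyMeasurable).mul hG.star.1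
    · refine ae_of_all _ fun t => ?_
      simp [fourier_apply, Circle.norm_coe]
  have h := HilbertBasis.hasSum_inner_mul_inner (fourierBasis (T := 2 * Real.pi)) (hX.toLp _) (hF.toLp F)
  have e1 : ∀ i, inner ℂ (fourierBasis i) (hF.toLp F) = fourierCoeff F i := by
    intro i; rw [← coeff_toLp hF, HilbertBasis.repr_apply_apply]
  have e2 : ∀ i, inner ℂ (hX.toLp _) (fourierBasis i) = fourierCoeff G (n - i) := by
    intro i
    rw [MeasureTheory.L2.inner_def, coe_fourierBasis, fourierCoeff]
    apply integral_congr_ae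
    filter_upwards [coeFn_fourierLp 2 i, hX.coeFn_toLp] with t ht ht2
    rw [ht, ht2]
    simp only [RCLike.inner_apply', map_mul, starRingEnd_apply, star_star]
    rw [show -(n - i) = -n + i by ring, fourier_add, fourier_neg, smul_eq_mul, starRingEnd_apply]
    ring
  have e3 : inner ℂ (hX.toLp _) (hF.toLp F) = fourierCoeff (fun t => F t * G t) n := by
    rw [MeasureTheory.L2.inner_def, fourierCoeff]
    apply integral_congr_ae
    filter_upwards [hF.coeFn_toLp, hX.coeFn_toLp] with t ht ht2
    rw [ht, ht2]
    simp only [RCLike.inner_apply', map_mul, starRingEnd_apply, star_star]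
    rw [fourier_neg, smul_eq_mul, starRingEnd_apply]
    ring
  rw [e3] at h
  refine h.congr_fun ?_ |> fun h => h
  intro i
  rw [e1, e2, mul_comm]

theorem coeff_star (F : Tor → ℂ) (n : ℤ) :
    fourierCoeff (fun t => star (F t)) n = star (fourierCoeff F (-n)) := by
  unfold fourierCoeff
  rw [← starRingEnd_apply, ← integral_conj]
  congr 1; ext t
  simp

theorem l1_unique {F : Tor → ℂ} (hF : Integrable F muT) (h : ∀ n, fourierCoeff F n = 0) :
    F =ᵐ[muT] 0 := by
  have hc : ∀ g : C(Tor, ℂ), ∫ t, g t * F t ∂muT = 0 := by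
    have hIntg : ∀ g : C(Tor, ℂ), Integrable (fun t => g t * F t) muT := fun g => by
      refine hF.bdd_mul (c := ‖g‖) g.continuous.aestronglyMeasurable (ae_of_all _ fun t => ?_)
      exact g.norm_coe_le_norm t
    let L : C(Tor, ℂ) →ₗ[ℂ] ℂ :=
      { toFun := fun g => ∫ t, g t * F t ∂muT
        map_add' := fun g k => by
          rw [← integral_add (hIntg g) (hIntg k)]; congr 1; ext t; simp [add_mul]
        map_smul' := fun c g => by
          simp only [RingHom.id_apply, smul_eq_mul]
          rw [← integral_const_mul]; congr 1; ext t; simp [mul_assoc] }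
    have hL : ∀ g, ‖L g‖ ≤ (∫ t, ‖F t‖ ∂muT) * ‖g‖ := by
      intro g
      rw [mul_comm (∫ t, ‖F t‖ ∂muT), ← integral_const_mul]
      refine norm_integral_le_of_norm_le (hF.norm.const_mul _) (ae_of_all _ fun t => ?_)
      rw [norm_mul]; gcongr; exact g.norm_coe_le_norm t
    let L' := L.mkContinuous _ hL
    have hz : L' = 0 := by
      apply ContinuousLinearMap.ext_on (s := Set.range (@fourier (2 * Real.pi)))
      · have := span_fourier_closure_eq_top (T := 2 * Real.pi)
        rw [dense_iff_closure_eq]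
        have h2 := congrArg (fun S : Submodule ℂ C(Tor, ℂ) => (S : Set C(Tor, ℂ))) this
        simpa using h2
      · rintro _ ⟨n, rfl⟩
        have := h (-n)
        simp only [fourierCoeff, neg_neg, smul_eq_mul] at this
        simpa using! this
    intro g
    exact DFunLike.congr_fun hz g
  apply ae_eq_zero_of_forall_setIntegral_isClosed_eq_zero hF
  intro s hs
  have hpos : ∀ n : ℕ, (0:ℝ) < 1 / ((n:ℝ) + 1) := fun n => by positivity
  have ht := thickenedIndicator_tendsto_indicator_closure hpos tendsto_one_div_add_atTop_nhds_zero_nat s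
  rw [tendsto_pi_nhds, hs.closure_eq] at ht
  have lim : Tendsto (fun n : ℕ => ∫ t, ((thickenedIndicator (hpos n) s t : NNReal) : ℂ) * F t ∂muT) atTop
      (𝓝 (∫ t, s.indicator F t ∂muT)) := by
    apply tendsto_integral_of_dominated_convergence (fun t => ‖F t‖)
    · intro n
      refine AEStronglyMeasurable.mul ?_ hF.1
      apply Continuous.aestronglyMeasurable
      have := (thickenedIndicator (hpos n) s).continuous
      fun_prop
    · exact hF.norm
    · intro n; refine ae_of_all _ fun t => ?_
      rw [norm_mul]
      have h1 : ‖((thickenedIndicator (hpos n) s t : NNReal) : ℂ)‖ ≤ 1 := by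
        have := thickenedIndicator_le_one (hpos n) s t
        simpa using this
      exact mul_le_of_le_one_left (norm_nonneg _) h1
    · refine ae_of_all _ fun t => ?_
      have h1 := ht t
      have h2 : Tendsto (fun n => ((thickenedIndicator (hpos n) s t : NNReal) : ℂ) * F t) atTop
        (𝓝 (((s.indicator (fun _ => (1:NNReal)) t : NNReal) : ℂ) * F t)) := by
        refine Tendsto.mul_const _ ?_
        have hcont : Continuous (fun x : NNReal => ((x : ℝ) : ℂ)) := by fun_prop
        exact (hcont.tendsto _).comp h1
      convert h2 using 2
      by_cases hts : t ∈ s <;> simp [hts]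
  rw [← integral_indicator hs.measurableSet]
  refine tendsto_nhds_unique lim ?_
  have : ∀ n : ℕ, ∫ t, ((thickenedIndicator (hpos n) s t : NNReal) : ℂ) * F t ∂muT = 0 := by
    intro n
    have hcont : Continuous (fun t => (((thickenedIndicator (hpos n) s t : NNReal) : ℝ) : ℂ)) := by
      have := (thickenedIndicator (hpos n) s).continuous
      fun_prop
    exact hc ⟨_, hcont⟩
  simp_rw [this]; exact tendsto_const_nhds

end HFact

end

end

section
open MeasureTheory Filter Topology
open scoped ENNReal Classical
noncomputable section
namespace HFact

abbrev volI : Measure ℝ := volume.restrict (Set.Ioc 0 (2 * Real.pi))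

theorem mp_mk : MeasurePreserving (fun t : ℝ => (t : Tor)) volI (volume : Measure Tor) := by
  have := AddCircle.measurePreserving_mk (2 * Real.pi) 0
  simpa using! this

theorem ac1 : (volume : Measure Tor) ≪ muT := by
  rw [AddCircle.volume_eq_smul_haarAddCircle]
  exact Measure.smul_absolutelyContinuous

theorem ac2 : muT ≪ (volume : Measure Tor) := by
  rw [AddCircle.volume_eq_smul_haarAddCircle]
  refine Measure.absolutelyContinuous_smul ?_
  simp [Real.pi_pos]

theorem ae_real_of_tor {P : Tor → Prop} (h : ∀ᵐ θ ∂muT, P θ) : ∀ᵐ t : ℝ ∂volI, P (t : Tor) :=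
  mp_mk.quasiMeasurePreserving.ae (ac1.ae_le h)

theorem ae_tor_of_real {P : Tor → Prop} (hP : MeasurableSet {θ | P θ})
    (h : ∀ᵐ t : ℝ ∂volI, P (t : Tor)) : ∀ᵐ θ ∂muT, P θ := by
  apply ac2.ae_le
  have := mp_mk.map_eq
  rw [← this]
  exact (ae_map_iff mp_mk.measurable.aemeasurable hP).2 h

/-- antiderivative -/
def anti (c : ℕ → ℂ) (z : ℂ) : ℂ := ∑' n : ℕ, c (n + 1) / ((n : ℂ) + 1) * z ^ (n + 1)

theorem summable_anti {c : ℕ → ℂ} (h : CMemH2 c) : Summable (fun n : ℕ => ‖c (n + 1) / ((n : ℂ) + 1)‖) := by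
  have h1 : Summable (fun n : ℕ => ‖c (n + 1)‖ ^ 2) := (summable_nat_add_iff 1).2 h
  have h2 : Summable (fun n : ℕ => (1 / ((n : ℝ) + 1)) ^ 2) := by
    have := (summable_nat_add_iff 1).2 (Real.summable_one_div_nat_pow.2 (le_refl 2) : Summable (fun n : ℕ => 1 / (n : ℝ) ^ 2))
    refine this.congr fun n => ?_
    push_cast; rw [div_pow]; simp
  refine (h1.add h2).of_nonneg_of_le (fun n => norm_nonneg _) fun n => ?_
  have e : ‖c (n + 1) / ((n : ℂ) + 1)‖ = ‖c (n + 1)‖ * (1 / ((n : ℝ) + 1)) := by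
    rw [norm_div]
    have : ((n : ℂ) + 1) = (((n : ℝ) + 1 : ℝ) : ℂ) := by push_cast; ring
    rw [this, Complex.norm_real, Real.norm_eq_abs, abs_of_pos (by positivity)]; ring
  rw [e]
  nlinarith [sq_nonneg (‖c (n + 1)‖ - 1 / ((n : ℝ) + 1)), sq_nonneg (‖c (n + 1)‖ + 1 / ((n : ℝ) + 1))]

theorem anti_bound (c : ℕ → ℂ) (n : ℕ) {z : ℂ} (hz : ‖z‖ ≤ 1) :
    ‖c (n + 1) / ((n : ℂ) + 1) * z ^ (n + 1)‖ ≤ ‖c (n + 1) / ((n : ℂ) + 1)‖ := by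
  rw [norm_mul, norm_pow]
  exact mul_le_of_le_one_right (norm_nonneg _) (pow_le_one₀ (norm_nonneg _) hz)

theorem anti_diff {c : ℕ → ℂ} (h : CMemH2 c) : DiffContOnCl ℂ (anti c) (Metric.ball 0 1) := by
  refine ⟨?_, ?_⟩
  · refine Complex.differentiableOn_tsum_of_summable_norm (summable_anti h) (fun i => by fun_prop) Metric.isOpen_ball
      fun i w hw => anti_bound c i ?_
    simp at hw; exact hw.le
  · rw [closure_ball _ one_ne_zero]
    refine continuousOn_tsum (fun i => by fun_prop) (summable_anti h) fun i w hw => anti_bound c i ?_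
    simpa using hw

theorem anti_deriv {c : ℕ → ℂ} (h : CMemH2 c) {z : ℂ} (hz : ‖z‖ < 1) :
    z * deriv (anti c) z = cEval c z - c 0 := by
  have h1 := Complex.hasSum_deriv_of_summable_norm (F := fun n z => c (n + 1) / ((n : ℂ) + 1) * z ^ (n + 1))
    (summable_anti h) (fun i => by fun_prop) Metric.isOpen_ball
    (U := Metric.ball 0 1) (fun i w hw => anti_bound c i (by simpa using (Metric.mem_ball.1 hw).le)) (z := z) (by simpa using hz)
  have h2 : ∀ n : ℕ, deriv (fun z : ℂ => c (n + 1) / ((n : ℂ) + 1) * z ^ (n + 1)) z = c (n + 1) * z ^ n := by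
    intro n
    have hn : (n : ℂ) + 1 ≠ 0 := by exact_mod_cast n.succ_ne_zero
    have := ((hasDerivAt_pow (n + 1) z).const_mul (c (n + 1) / ((n : ℂ) + 1))).deriv
    rw [this]; push_cast; field_simp
    try simp
  simp_rw [h2] at h1
  have h3 := h1.mul_left z
  have h4 : HasSum (fun n => z ^ n * c n) (z * deriv (anti c) z + c 0) := by
    rw [← hasSum_nat_add_iff' 1]
    simp only [Finset.range_one, Finset.sum_singleton, pow_zero, one_mul, add_sub_cancel_right]
    refine h3.congr_fun fun n => ?_
    ring
  rw [cEval, h4.tsum_eq]; ring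

def indA (t : ℝ) : Set Tor := {θ | ((AddCircle.measurableEquivIoc (2 * Real.pi) 0 θ : Set.Ioc (0:ℝ) (0 + 2 * Real.pi)) : ℝ) ≤ t}

theorem meas_indA (t : ℝ) : MeasurableSet (indA t) := by
  have : Measurable (fun θ : Tor => ((AddCircle.measurableEquivIoc (2 * Real.pi) 0 θ : Set.Ioc (0:ℝ) (0 + 2 * Real.pi)) : ℝ)) :=
    measurable_subtype_coe.comp (AddCircle.measurableEquivIoc (2 * Real.pi) 0).measurable
  exact measurableSet_le this measurable_const

theorem mem_indA {t s : ℝ} (hs : s ∈ Set.Ioc 0 (2 * Real.pi)) : ((s : Tor) ∈ indA t) ↔ s ≤ t := by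
  have : s ∈ Set.Ioc 0 (0 + 2 * Real.pi) := by simpa using hs
  have e := AddCircle.equivIoc_coe_of_mem (p := 2 * Real.pi) (a := 0) this
  have e' : AddCircle.measurableEquivIoc (2 * Real.pi) 0 (s : Tor) = ⟨s, this⟩ := Subtype.ext e
  simp only [indA, Set.mem_ofPred_eq, e']

theorem coeff_indA (f : Tor → ℂ) {t : ℝ} (ht : t ∈ Set.Icc 0 (2 * Real.pi)) (n : ℤ) :
    fourierCoeff (fun θ => f θ * (indA t).indicator (fun _ => (1:ℂ)) θ) n =
     (1 / (2 * Real.pi)) • ∫ s in (0:ℝ)..t, fourier (-n) (s : Tor) * f s := by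
  rw [fourierCoeff_eq_intervalIntegral _ n 0, zero_add]
  congr 1
  rw [intervalIntegral.integral_of_le (by positivity), intervalIntegral.integral_of_le ht.1]
  have : ∀ s ∈ Set.Ioc 0 (2 * Real.pi), fourier (-n) (s : Tor) • (f s * (indA t).indicator (fun _ => (1:ℂ)) (s : Tor))
     = (Set.Iic t).indicator (fun s : ℝ => fourier (-n) (s : Tor) * f s) s := by
    intro s hs
    by_cases h : s ≤ t
    · rw [Set.indicator_of_mem ((mem_indA hs).2 h), Set.indicator_of_mem (by exact h)]; simp
    · rw [Set.indicator_of_notMem (fun h' => h ((mem_indA hs).1 h')), Set.indicator_of_notMem (by exact h)]; simp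
  rw [setIntegral_congr_fun measurableSet_Ioc this, setIntegral_indicator measurableSet_Iic]
  congr 2
  ext s; simp only [Set.mem_inter_iff, Set.mem_Ioc, Set.mem_Iic]
  constructor
  · rintro ⟨⟨a, b⟩, c⟩; exact ⟨a, c⟩
  · rintro ⟨a, b⟩; exact ⟨⟨a, b.trans ht.2⟩, b⟩

theorem memLp_ind (t : ℝ) : MemLp (fun θ => (indA t).indicator (fun _ => (1:ℂ)) θ) 2 muT :=
  (memLp_const (1:ℂ)).indicator (meas_indA t)

theorem anti_bdry {c : ℕ → ℂ} (h : CMemH2 c) {t : ℝ} (ht : t ∈ Set.Icc 0 (2 * Real.pi)) :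
    anti c (Complex.exp (t * Complex.I)) = anti c 1 + Complex.I * ((∫ s in (0:ℝ)..t, bd c (s : Tor)) - t * c 0) := by
  have hs := conv_hasSum (memLp_bd c) (memLp_ind t) 0
  rw [coeff_indA _ ht] at hs
  have e1 : ∀ k : ℤ, fourierCoeff (fun θ => (indA t).indicator (fun _ => (1:ℂ)) θ) k =
     (1 / (2 * Real.pi)) • ∫ s in (0:ℝ)..t, fourier (-k) (s : Tor) := by
    intro k
    have := coeff_indA (fun _ => 1) ht k
    simpa using this
  simp only [neg_zero, fourier_zero, one_mul, zero_sub, e1, coeff_bd h, neg_neg] at hs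
  have hinj : Function.Injective (fun n : ℕ => (n : ℤ)) := Nat.cast_injective
  have hs2 : HasSum (fun n : ℕ => c n * ((1 / (2 * Real.pi)) • ∫ s in (0:ℝ)..t, fourier (n : ℤ) (s : Tor)))
     ((1 / (2 * Real.pi)) • ∫ s in (0:ℝ)..t, bd c (s : Tor)) := by
    have := (Function.Injective.hasSum_iff hinj (f := fun k : ℤ => ext c k * ((1 / (2 * Real.pi)) • ∫ s in (0:ℝ)..t, fourier k (s : Tor))) ?_).2 hs
    · refine this.congr_fun ?_ |> fun h => h
      intro n; simp only [Function.comp_apply, ext_nat]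
    · intro x hx
      simp only [Set.mem_range, not_exists] at hx
      have : x < 0 := by
        by_contra h; exact hx x.toNat (by omega)
      rw [ext_neg c this, zero_mul]
  have hp : (Real.pi : ℂ) ≠ 0 := by exact_mod_cast Real.pi_ne_zero
  have hs3 := hs2.mul_left (2 * Real.pi : ℂ)
  have hs4 : HasSum (fun n : ℕ => c n * ∫ s in (0:ℝ)..t, fourier (n : ℤ) (s : Tor)) (∫ s in (0:ℝ)..t, bd c (s : Tor)) := by
    have e : ∀ x : ℂ, 2 * (Real.pi : ℂ) * ((1 / (2 * Real.pi)) • x) = x := by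
      intro x; simp only [Complex.real_smul]; push_cast; field_simp
    rw [e] at hs3
    refine hs3.congr_fun fun n => ?_
    rw [mul_left_comm, e]
  have hIntg : ∀ n : ℕ, ∫ s in (0:ℝ)..t, fourier ((n + 1 : ℕ) : ℤ) (s : Tor) =
     (Complex.exp (t * Complex.I) ^ (n + 1) - 1) / (Complex.I * (n + 1)) := by
    intro n
    have hn : (n : ℂ) + 1 ≠ 0 := by exact_mod_cast n.succ_ne_zero
    have := integral_exp_mul_complex (a := 0) (b := t) (c := Complex.I * ((n : ℂ) + 1)) (mul_ne_zero Complex.I_ne_zero hn)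
    rw [← Complex.exp_nat_mul]
    convert this using 1
    · congr 1; ext s; rw [fourier_coe_apply]; congr 1; push_cast; field_simp
    · congr 2
      · congr 1; push_cast; ring
      · simp
  rw [← hasSum_nat_add_iff' 1] at hs4
  simp only [hIntg] at hs4
  have h0 : ∫ s in (0:ℝ)..t, fourier ((0 : ℕ) : ℤ) (s : Tor) = (t : ℂ) := by simp
  simp only [Finset.range_one, Finset.sum_singleton, h0] at hs4
  have hs5 := hs4.mul_left Complex.I
  have ha : Summable (fun n : ℕ => c (n + 1) / ((n : ℂ) + 1) * Complex.exp (t * Complex.I) ^ (n + 1)) :=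
    (summable_anti h).of_norm_bounded fun n => anti_bound c n (by simp)
  have hb : Summable (fun n : ℕ => c (n + 1) / ((n : ℂ) + 1) * (1 : ℂ) ^ (n + 1)) :=
    (summable_anti h).of_norm_bounded fun n => anti_bound c n (by simp)
  have hs6 := ha.hasSum.sub hb.hasSum
  have := hs6.unique (hs5.congr_fun fun n => by
    have hn : (n : ℂ) + 1 ≠ 0 := by exact_mod_cast n.succ_ne_zero
    have := Complex.I_ne_zero
    field_simp
    simp)
  rw [anti, anti, ← mul_comm (c 0), ← this]; ring

theorem fatou {c : ℕ → ℂ} (h : CMemH2 c) : ∀ᵐ t : ℝ ∂volI,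
    Tendsto (fun r : ℝ => cEval c (r * Complex.exp (t * Complex.I))) (𝓝[<] (1:ℝ)) (𝓝 (bd c (t : Tor))) := by
  have hIntg : Integrable (fun t : ℝ => bd c (t : Tor)) volI := by
    have h1 : MemLp (bd c) 2 (volume : Measure Tor) := memLp_haarAddCircle_iff.1 (memLp_bd c)
    exact mp_mk.integrable_comp_of_integrable (h1.integrable (by norm_num))
  set G : ℝ → ℂ := (Set.Ioc 0 (2 * Real.pi)).indicator (fun t : ℝ => bd c (t : Tor)) with hG
  have hGi : Integrable G := (integrable_indicator_iff measurableSet_Ioc).2 hIntg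
  have hae := LocallyIntegrable.ae_hasDerivAt_integral hGi.locallyIntegrable
  have hne : ∀ᵐ t ∂volI, t ≠ 2 * Real.pi := by
    refine ae_restrict_of_ae ?_
    exact Measure.ae_ne volume (2 * Real.pi)
  filter_upwards [ae_restrict_of_ae hae, hne, ae_restrict_mem measurableSet_Ioc] with t h1 h2 h3
  have ht : t ∈ Set.Ioo 0 (2 * Real.pi) := ⟨h3.1, lt_of_le_of_ne h3.2 h2⟩
  have hd := h1 0
  have hGt : G t = bd c (t : Tor) := Set.indicator_of_mem h3 _
  rw [hGt] at hd
  have hd2 : HasDerivAt (fun x : ℝ => anti c 1 + Complex.I * ((∫ s in (0:ℝ)..x, G s) - x * c 0))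
      (Complex.I * (bd c (t : Tor) - c 0)) t := by
    have e : HasDerivAt (fun x : ℝ => (x : ℂ) * c 0) (c 0) t := by
      simpa using (Complex.ofRealCLM.hasDerivAt (x := t)).mul_const (c 0)
    exact ((hd.sub e).const_mul Complex.I).const_add _
  have hd3 : HasDerivAt (fun x : ℝ => anti c (Complex.exp (x * Complex.I))) (Complex.I * (bd c (t : Tor) - c 0)) t := by
    refine hd2.congr_of_eventuallyEq ?_
    filter_upwards [Ioo_mem_nhds ht.1 ht.2] with x hx
    rw [anti_bdry h ⟨hx.1.le, hx.2.le⟩]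
    congr 3
    apply intervalIntegral.integral_congr_ae
    refine ae_of_all _ fun s hs => ?_
    rw [Set.uIoc_of_le hx.1.le] at hs
    have hm : s ∈ Set.Ioc 0 (2 * Real.pi) := ⟨hs.1, hs.2.trans hx.2.le⟩
    rw [hG, Set.indicator_of_mem hm]
  have key := fatou_local (anti_diff h) hd3
  rw [mul_div_cancel_left₀ _ Complex.I_ne_zero] at key
  have key2 := key.add_const (c 0)
  rw [sub_add_cancel] at key2
  refine key2.congr' ?_
  have : Set.Ioo (-1:ℝ) 1 ∈ 𝓝[<] (1:ℝ) := Ioo_mem_nhdsLT (by norm_num)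
  filter_upwards [this] with r hr
  rw [anti_deriv h]
  · ring
  · rw [norm_mul, Complex.norm_exp_ofReal_mul_I, Complex.norm_real, mul_one, Real.norm_eq_abs]
    exact abs_lt.2 hr

end HFact

end

end

section
open MeasureTheory Filter Topology
open scoped ENNReal Classical
noncomputable section
namespace HFact

abbrev HQ := Quaternion ℝ

theorem mem_USphere {q : HQ} : q ∈ USphere ↔ q.re = 0 ∧ q.imI ^ 2 + q.imJ ^ 2 + q.imK ^ 2 = 1 := by
  unfold USphere
  rw [Set.mem_ofPred_eq, Quaternion.ext_iff, sq]
  simp only [Quaternion.re_mul, Quaternion.imI_mul, Quaternion.imJ_mul, Quaternion.imK_mul, Quaternion.re_neg,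
    Quaternion.imI_neg, Quaternion.imJ_neg, Quaternion.imK_neg, Quaternion.re_one, Quaternion.imI_one, Quaternion.imJ_one, Quaternion.imK_one, neg_zero]
  constructor
  · rintro ⟨h1, h2, h3, h4⟩
    have : q.re = 0 := by
      by_contra hne
      have e2 : q.imI = 0 := by
        have : q.re * q.imI = 0 := by linarith
        exact (mul_eq_zero.1 this).resolve_left hne
      have e3 : q.imJ = 0 := by
        have : q.re * q.imJ = 0 := by linarith
        exact (mul_eq_zero.1 this).resolve_left hne
      have e4 : q.imK = 0 := by
        have : q.re * q.imK = 0 := by linarith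
        exact (mul_eq_zero.1 this).resolve_left hne
      rw [e2, e3, e4] at h1
      nlinarith [sq_nonneg q.re]
    refine ⟨this, ?_⟩
    rw [this] at h1; linarith
  · rintro ⟨h1, h2⟩
    rw [h1]
    refine ⟨by linarith, by ring, by ring, by ring⟩

def sphMap (p : ℝ × ℝ) : HQ :=
  (Real.sin p.1 * Real.cos p.2) • (⟨0, 1, 0, 0⟩ : HQ) + (Real.sin p.1 * Real.sin p.2) • (⟨0, 0, 1, 0⟩ : HQ)
    + Real.cos p.1 • (⟨0, 0, 0, 1⟩ : HQ)

theorem sphere_sub : USphere ⊆ sphMap '' (Set.Icc 0 Real.pi ×ˢ Set.Icc (-Real.pi) Real.pi) := by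
  intro q hq
  obtain ⟨h0, h1⟩ := mem_USphere.1 hq
  have hk : -1 ≤ q.imK ∧ q.imK ≤ 1 := by
    rw [← abs_le, ← sq_le_one_iff_abs_le_one]; nlinarith [sq_nonneg q.imI, sq_nonneg q.imJ]
  set w : ℂ := ⟨q.imI, q.imJ⟩ with hw
  have hn : ‖w‖ = Real.sin (Real.arccos q.imK) := by
    rw [Real.sin_arccos, Complex.norm_def, Complex.normSq_apply]; congr 1; simp [hw]; linarith
  refine ⟨(Real.arccos q.imK, Complex.arg w), ⟨⟨Real.arccos_nonneg _, Real.arccos_le_pi _⟩, (Complex.neg_pi_lt_arg _).le, Complex.arg_le_pi _⟩, ?_⟩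
  have e1 := Complex.norm_mul_cos_arg w
  have e2 := Complex.norm_mul_sin_arg w
  rw [hn] at e1 e2
  unfold sphMap
  simp only [e1, e2, Real.cos_arccos hk.1 hk.2]
  ext <;> simp [h0, hw]

theorem sphere_finite : μH[2] USphere < ∞ := by
  have hc : ContDiff ℝ 1 sphMap := by unfold sphMap; fun_prop
  have hcomp : IsCompact (Set.Icc 0 Real.pi ×ˢ Set.Icc (-Real.pi) Real.pi) := isCompact_Icc.prod isCompact_Icc
  obtain ⟨K, hK⟩ := LocallyLipschitzOn.exists_lipschitzOnWith_of_compact hcomp hc.locallyLipschitz.locallyLipschitzOn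
  refine (measure_mono sphere_sub).trans_lt ((hK.hausdorffMeasure_image_le (by norm_num)).trans_lt ?_)
  rw [hausdorffMeasure_prod_real]
  exact ENNReal.mul_lt_top (ENNReal.rpow_lt_top_of_nonneg (by norm_num) (by simp)) hcomp.measure_lt_top

instance sph_sfinite : SFinite sphMeasure := by
  unfold sphMeasure
  have : IsFiniteMeasure ((μH[2]).restrict USphere) := ⟨by simpa using sphere_finite⟩
  infer_instance

theorem ae_sph {P : HQ → Prop} : (∀ᵐ I ∂sphMeasure, P I) → (μH[2]) {I | I ∈ USphere ∧ ¬ P I} = 0 := by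
  intro h
  have hm : MeasurableSet USphere := by
    have : IsClosed USphere := by
      have : USphere = {q : HQ | q ^ 2 = -1} := rfl
      rw [this]; exact isClosed_eq (by fun_prop) (by fun_prop)
    exact this.measurableSet
  unfold sphMeasure at h
  rw [ae_iff, Measure.smul_apply, smul_eq_mul, mul_eq_zero, ENNReal.inv_eq_zero] at h
  have h := h.resolve_left sphere_finite.ne
  rw [Measure.restrict_apply' hm] at h
  convert h using 2
  ext I; simp [and_comm]

theorem lip_proj : LipschitzWith 1 (fun q : HQ => (q.imI, q.imJ)) := by
  apply LipschitzWith.of_dist_le_mul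
  intro x y
  have hn : ∀ q : HQ, ‖q‖ ^ 2 = q.re ^ 2 + q.imI ^ 2 + q.imJ ^ 2 + q.imK ^ 2 := by
    intro q; rw [sq, ← Quaternion.normSq_eq_norm_mul_self, Quaternion.normSq_def']
  have h := hn (x - y)
  rw [dist_eq_norm x y, NNReal.coe_one, one_mul, Prod.dist_eq, Real.dist_eq, Real.dist_eq]
  simp only [Quaternion.re_sub, Quaternion.imI_sub, Quaternion.imJ_sub, Quaternion.imK_sub] at h
  refine max_le ?_ ?_
  all_goals
    apply abs_le_of_sq_le_sq _ (norm_nonneg _)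
    nlinarith [sq_nonneg (x.re - y.re), sq_nonneg (x.imI - y.imI), sq_nonneg (x.imJ - y.imJ), sq_nonneg (x.imK - y.imK)]

theorem affine_zero {N a b c : ℝ}
    (h : ∀ᵐ I ∂sphMeasure, N + a * I.imI + b * I.imJ + c * I.imK = 0) :
    N = 0 ∧ a = 0 ∧ b = 0 ∧ c = 0 := by
  have h0 := ae_sph h
  set S := {I : HQ | I ∈ USphere ∧ ¬ (N + a * I.imI + b * I.imJ + c * I.imK = 0)} with hS
  have h1 := lip_proj.hausdorffMeasure_image_le (d := 2) (by norm_num) S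
  rw [h0, mul_zero, hausdorffMeasure_prod_real, nonpos_iff_eq_zero] at h1
  set S' := (fun q : HQ => (q.imI, q.imJ)) '' S with hS'
  have h2 : Dense (S'ᶜ) := by
    apply Measure.dense_of_ae (μ := (volume : Measure (ℝ × ℝ)))
    exact measure_eq_zero_iff_ae_notMem.1 h1
  have key : ∀ p : ℝ × ℝ, p.1 ^ 2 + p.2 ^ 2 < 1 →
      N + a * p.1 + b * p.2 + c * Real.sqrt (1 - p.1 ^ 2 - p.2 ^ 2) = 0 := by
    intro p hp
    have hopen : IsOpen {p : ℝ × ℝ | p.1 ^ 2 + p.2 ^ 2 < 1} := isOpen_lt (by fun_prop) (by fun_prop)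
    have hp' : p ∈ closure ({p : ℝ × ℝ | p.1 ^ 2 + p.2 ^ 2 < 1} ∩ S'ᶜ) := by
      exact h2.open_subset_closure_inter hopen hp
    have hcl : IsClosed {p : ℝ × ℝ | N + a * p.1 + b * p.2 + c * Real.sqrt (1 - p.1 ^ 2 - p.2 ^ 2) = 0} :=
      isClosed_eq (by fun_prop) (by fun_prop)
    refine closure_minimal ?_ hcl hp'
    rintro ⟨x, y⟩ ⟨hxy, hn⟩
    by_contra hne
    apply hn
    simp only [Set.mem_ofPred_eq] at hxy
    refine ⟨⟨0, x, y, Real.sqrt (1 - x ^ 2 - y ^ 2)⟩, ⟨mem_USphere.2 ⟨rfl, ?_⟩, hne⟩, rfl⟩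
    simp only
    rw [Real.sq_sqrt (by linarith)]; ring
  have k0 := key (0, 0) (by norm_num)
  have k1 := key (3 / 5, 0) (by norm_num)
  have k2 := key (-3 / 5, 0) (by norm_num)
  have k3 := key (0, 3 / 5) (by norm_num)
  have k4 := key (0, -3 / 5) (by norm_num)
  have s : Real.sqrt (16 / 25) = 4 / 5 := by
    rw [show (16 / 25 : ℝ) = (4 / 5) ^ 2 by norm_num]; exact Real.sqrt_sq (by norm_num)
  norm_num [s] at k0 k1 k2 k3 k4
  have s2 : Real.sqrt 16 / Real.sqrt 25 = 4 / 5 := by rw [← Real.sqrt_div (by norm_num), s]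
  refine ⟨?_, ?_, ?_, ?_⟩ <;> linarith

end HFact

end

end

section
open MeasureTheory Filter Topology
open scoped ENNReal Classical Matrix
noncomputable section
namespace HFact

abbrev M2 := Matrix (Fin 2) (Fin 2) ℂ

theorem nsq (q : HQ) : ‖q‖ ^ 2 = q.re ^ 2 + q.imI ^ 2 + q.imJ ^ 2 + q.imK ^ 2 := by
  rw [sq, ← Quaternion.normSq_eq_norm_mul_self, Quaternion.normSq_def']

theorem cnsq (z : ℂ) : ‖z‖ ^ 2 = z.re ^ 2 + z.im ^ 2 := by
  rw [← Complex.normSq_eq_norm_sq, Complex.normSq_apply]; ring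

def rho : HQ →ₗ[ℝ] M2 where
  toFun q := !![⟨q.re, q.imI⟩, ⟨q.imJ, q.imK⟩; ⟨-q.imJ, q.imK⟩, ⟨q.re, -q.imI⟩]
  map_add' a b := by
    ext i j; fin_cases i <;> fin_cases j <;> apply Complex.ext <;> simp <;> ring
  map_smul' c a := by
    ext i j; fin_cases i <;> fin_cases j <;> apply Complex.ext <;> simp

@[simp] theorem rho00 (q : HQ) : rho q 0 0 = ⟨q.re, q.imI⟩ := rfl
@[simp] theorem rho01 (q : HQ) : rho q 0 1 = ⟨q.imJ, q.imK⟩ := rfl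
@[simp] theorem rho10 (q : HQ) : rho q 1 0 = ⟨-q.imJ, q.imK⟩ := rfl
@[simp] theorem rho11 (q : HQ) : rho q 1 1 = ⟨q.re, -q.imI⟩ := rfl

theorem m2ext {A B : M2} (h00 : A 0 0 = B 0 0) (h01 : A 0 1 = B 0 1) (h10 : A 1 0 = B 1 0) (h11 : A 1 1 = B 1 1) : A = B := by
  ext i j; fin_cases i <;> fin_cases j <;> assumption

theorem rho_mul (a b : HQ) : rho (a * b) = rho a * rho b := by
  apply m2ext <;> rw [Matrix.mul_apply, Fin.sum_univ_two] <;> apply Complex.ext <;> simp <;> ring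

theorem rho_one : rho 1 = 1 := by
  apply m2ext <;> apply Complex.ext <;> simp <;> rfl

theorem rho_star (a : HQ) : rho (star a) = (rho a)ᴴ := by
  apply m2ext <;> rw [Matrix.conjTranspose_apply] <;> apply Complex.ext <;> simp

theorem rho_star_adj (a : HQ) : rho (star a) = (rho a).adjugate := by
  rw [Matrix.adjugate_fin_two]
  apply m2ext <;> apply Complex.ext <;> simp

theorem rho_inj {a b : HQ} (h : rho a = rho b) : a = b := by
  have h0 := congrFun (congrFun h 0) 0
  have h1 := congrFun (congrFun h 0) 1
  rw [rho00, rho00, Complex.ext_iff] at h0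
  rw [rho01, rho01, Complex.ext_iff] at h1
  exact Quaternion.ext_iff.2 ⟨h0.1, h0.2, h1.1, h1.2⟩

def ent (i j : Fin 2) : HQ →L[ℝ] ℂ :=
  LinearMap.toContinuousLinearMap
    { toFun := fun q => rho q i j
      map_add' := fun a b => by simp
      map_smul' := fun c a => by simp }

@[simp] theorem ent_apply (i j : Fin 2) (q : HQ) : ent i j q = rho q i j := rfl

def fro (A : M2) : ℝ := ‖A 0 0‖ ^ 2 + ‖A 0 1‖ ^ 2 + ‖A 1 0‖ ^ 2 + ‖A 1 1‖ ^ 2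

theorem fro_nonneg (A : M2) : 0 ≤ fro A := by unfold fro; positivity

theorem fro_rho (q : HQ) : fro (rho q) = 2 * ‖q‖ ^ 2 := by
  simp only [fro, rho00, rho01, rho10, rho11, cnsq, nsq]; ring

theorem entry_le_fro (A : M2) (i j : Fin 2) : ‖A i j‖ ^ 2 ≤ fro A := by
  unfold fro
  fin_cases i <;> fin_cases j <;> simp <;> nlinarith [sq_nonneg ‖A 0 0‖, sq_nonneg ‖A 0 1‖, sq_nonneg ‖A 1 0‖, sq_nonneg ‖A 1 1‖]

theorem rho_entry_le (q : HQ) (i j : Fin 2) : ‖rho q i j‖ ^ 2 ≤ ‖q‖ ^ 2 := by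
  fin_cases i <;> fin_cases j <;> simp [cnsq, nsq] <;>
    nlinarith [sq_nonneg q.re, sq_nonneg q.imI, sq_nonneg q.imJ, sq_nonneg q.imK]

theorem fro_eq (A : M2) : (fro A : ℂ) = (A * Aᴴ).trace := by
  simp only [Matrix.trace, Matrix.diag, Fin.sum_univ_two, Matrix.mul_apply, Matrix.conjTranspose_apply, fro]
  have : ∀ z : ℂ, z * star z = ((‖z‖ ^ 2 : ℝ) : ℂ) := by
    intro z; rw [← starRingEnd_apply, Complex.mul_conj, Complex.normSq_eq_norm_sq]
  simp only [this]; push_cast; ring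

theorem fro_eq' (A : M2) : (fro A : ℂ) = (Aᴴ * A).trace := by
  rw [fro_eq, Matrix.trace_mul_comm]

theorem fro_mul_left {U : M2} (hU : Uᴴ * U = 1) (A : M2) : fro (U * A) = fro A := by
  have : (fro (U * A) : ℂ) = fro A := by
    rw [fro_eq', fro_eq', Matrix.conjTranspose_mul, Matrix.mul_assoc, ← Matrix.mul_assoc Uᴴ, hU, Matrix.one_mul]
  exact_mod_cast this

theorem fro_right {A B : M2} (h : A * Aᴴ = B * Bᴴ) (P : M2) : fro (P * A) = fro (P * B) := by
  have : (fro (P * A) : ℂ) = fro (P * B) := by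
    rw [fro_eq, fro_eq, Matrix.conjTranspose_mul, Matrix.conjTranspose_mul, Matrix.mul_assoc P, Matrix.mul_assoc P,
      ← Matrix.mul_assoc A, ← Matrix.mul_assoc B, h]
  exact_mod_cast this

theorem fro_adj (A : M2) : fro A.adjugate = fro A := by
  rw [Matrix.adjugate_fin_two]; simp [fro]; ring

theorem det_le_fro (A : M2) : ‖A.det‖ ≤ fro A / 2 := by
  rw [Matrix.det_fin_two]
  refine (norm_sub_le _ _).trans ?_
  rw [norm_mul, norm_mul]
  unfold fro
  nlinarith [sq_nonneg (‖A 0 0‖ - ‖A 1 1‖), sq_nonneg (‖A 0 1‖ - ‖A 1 0‖)]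

theorem det_rho (q : HQ) : (rho q).det = ((‖q‖ ^ 2 : ℝ) : ℂ) := by
  rw [Matrix.det_fin_two, nsq]
  apply Complex.ext
  · rw [Complex.ofReal_re]; simp; ring
  · rw [Complex.ofReal_im]; simp; ring

theorem unit_det {U : M2} (hU : Uᴴ * U = 1) : ‖U.det‖ = 1 := by
  have := congrArg Matrix.det hU
  rw [Matrix.det_mul, Matrix.det_conjTranspose, Matrix.det_one] at this
  have h := congrArg norm this
  rw [norm_mul, norm_star, norm_one] at h
  nlinarith [norm_nonneg U.det]

theorem unit_entry {U : M2} (hU : Uᴴ * U = 1) (i j : Fin 2) : ‖U i j‖ ≤ 1 :=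
  entry_norm_bound_of_unitary (Matrix.mem_unitaryGroup_iff'.2 hU) i j

theorem unit_adj {U : M2} (hU : Uᴴ * U = 1) : (U.adjugate)ᴴ * U.adjugate = 1 := by
  have h2 : U * Uᴴ = 1 := mul_eq_one_comm.1 hU
  rw [Matrix.adjugate_conjTranspose, ← Matrix.adjugate_mul_distrib, h2, Matrix.adjugate_one]

/-- the alpha/beta extraction -/
def al (C : M2) : HQ :=
  ⟨((C 0 0).re + (C 1 1).re) / 2, ((C 0 0).im - (C 1 1).im) / 2, ((C 0 1).re - (C 1 0).re) / 2, ((C 0 1).im + (C 1 0).im) / 2⟩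
def be (C : M2) : HQ :=
  ⟨((C 0 0).im + (C 1 1).im) / 2, -((C 0 0).re - (C 1 1).re) / 2, ((C 0 1).im - (C 1 0).im) / 2, -((C 0 1).re + (C 1 0).re) / 2⟩

def ev (I : HQ) (C : M2) : HQ := al C + I * be C

def V1 (C : M2) : ℝ := ((be C) * star (al C)).imI
def V2 (C : M2) : ℝ := ((be C) * star (al C)).imJ
def V3 (C : M2) : ℝ := ((be C) * star (al C)).imK

theorem norm_ev {I : HQ} (hI : I ∈ USphere) (C : M2) :
    ‖ev I C‖ ^ 2 = fro C / 2 - 2 * (V1 C * I.imI + V2 C * I.imJ + V3 C * I.imK) := by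
  obtain ⟨h0, h1⟩ := mem_USphere.1 hI
  have e : ‖ev I C‖ ^ 2 = ‖al C‖ ^ 2 + (I.imI ^ 2 + I.imJ ^ 2 + I.imK ^ 2) * ‖be C‖ ^ 2
    - 2 * (V1 C * I.imI + V2 C * I.imJ + V3 C * I.imK) := by
    unfold ev V1 V2 V3
    generalize al C = a
    generalize be C = b
    simp only [nsq]
    simp [h0]
    ring
  have f : fro C / 2 = ‖al C‖ ^ 2 + ‖be C‖ ^ 2 := by
    rw [nsq, nsq]; simp only [fro, cnsq, al, be]; ring
  rw [e, h1, f]; ring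

theorem ccstar_iff {C D : M2} : C * Cᴴ = D * Dᴴ ↔
    fro C = fro D ∧ V1 C = V1 D ∧ V2 C = V2 D ∧ V3 C = V3 D := by
  have e : ∀ C : M2, C * Cᴴ = !![(⟨fro C / 2 - 2 * V1 C, 0⟩ : ℂ), (⟨-2 * V3 C, 2 * V2 C⟩ : ℂ); ⟨-2 * V3 C, -2 * V2 C⟩, ⟨fro C / 2 + 2 * V1 C, 0⟩] := by
    intro C
    have v1 : V1 C = -(be C).re * (al C).imI + (be C).imI * (al C).re - (be C).imJ * (al C).imK + (be C).imK * (al C).imJ := by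
      unfold V1; generalize al C = a; generalize be C = b; simp; ring
    have v2 : V2 C = -(be C).re * (al C).imJ + (be C).imJ * (al C).re - (be C).imK * (al C).imI + (be C).imI * (al C).imK := by
      unfold V2; generalize al C = a; generalize be C = b; simp; ring
    have v3 : V3 C = -(be C).re * (al C).imK + (be C).imK * (al C).re - (be C).imI * (al C).imJ + (be C).imJ * (al C).imI := by
      unfold V3; generalize al C = a; generalize be C = b; simp; ring
    apply m2ext <;> rw [Matrix.mul_apply, Fin.sum_univ_two] <;> apply Complex.ext <;>
      simp [fro, v1, v2, v3, al, be, cnsq] <;> ring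
  constructor
  · intro h
    rw [e, e] at h
    have h00 := congrFun (congrFun h 0) 0
    have h01 := congrFun (congrFun h 0) 1
    have h11 := congrFun (congrFun h 1) 1
    simp [Complex.ext_iff] at h00 h01 h11
    exact ⟨by linarith, by linarith, by linarith, by linarith⟩
  · rintro ⟨h1, h2, h3, h4⟩
    rw [e, e, h1, h2, h3, h4]

end HFact

end

end

section
open MeasureTheory Filter Topology
open scoped ENNReal Classical Matrix
noncomputable section
set_option linter.unusedVariables false
namespace HFact

def extQ (a : ℕ → HQ) : ℤ → HQ := fun n => if 0 ≤ n then a n.toNat else 0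
theorem extQ_nat (c : ℕ → HQ) (n : ℕ) : extQ c n = c n := by simp [extQ]
theorem extQ_neg (c : ℕ → HQ) {n : ℤ} (h : n < 0) : extQ c n = 0 := by simp [extQ, not_le.2 h]

def cm (a : ℕ → HQ) (i j : Fin 2) : ℕ → ℂ := fun n => rho (a n) i j
theorem ext_cm (a : ℕ → HQ) (i j : Fin 2) (n : ℤ) : ext (cm a i j) n = rho (extQ a n) i j := by
  unfold ext extQ cm; split_ifs
  · rfl
  · rw [map_zero]; rfl

theorem cmem {a : ℕ → HQ} (h : MemH2 a) (i j : Fin 2) : CMemH2 (cm a i j) :=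
  Summable.of_nonneg_of_le (fun _ => by positivity) (fun n => rho_entry_le (a n) i j) h

def Bd (a : ℕ → HQ) (t : Tor) : M2 := fun i j => bd (cm a i j) t

def mcoef (F : Tor → M2) (n : ℤ) : M2 := fun i j => fourierCoeff (fun t => F t i j) n
def ML2 (F : Tor → M2) : Prop := ∀ i j, MemLp (fun t => F t i j) 2 muT
def MInt (F : Tor → M2) : Prop := ∀ i j, Integrable (fun t => F t i j) muT
def MBdd (F : Tor → M2) : Prop := ∃ C : ℝ, ∀ᵐ t ∂muT, ∀ i j, ‖F t i j‖ ≤ C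

theorem ML2_Bd (a : ℕ → HQ) : ML2 (Bd a) := fun i j => memLp_bd _

theorem mcoef_Bd {a : ℕ → HQ} (h : MemH2 a) (n : ℤ) : mcoef (Bd a) n = rho (extQ a n) := by
  ext i j; rw [← ext_cm, ← coeff_bd (cmem h i j)]; rfl

theorem ML2.mInt {F : Tor → M2} (h : ML2 F) : MInt F := fun i j => (h i j).integrable (by norm_num)

theorem mae {F G : Tor → M2} (h : ∀ i j, (fun t => F t i j) =ᵐ[muT] (fun t => G t i j)) : F =ᵐ[muT] G := by
  have : ∀ᵐ t ∂muT, ∀ i j, F t i j = G t i j := by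
    rw [ae_all_iff]; intro i; rw [ae_all_iff]; intro j; exact h i j
  filter_upwards [this] with t ht
  exact Matrix.ext ht

theorem mcoef_congr {F G : Tor → M2} (h : F =ᵐ[muT] G) (n : ℤ) : mcoef F n = mcoef G n := by
  ext i j
  refine congrFun (fourierCoeff_congr_ae ?_) n
  filter_upwards [h] with t ht; rw [ht]

theorem ML2.congr {F G : Tor → M2} (hF : ML2 F) (h : F =ᵐ[muT] G) : ML2 G := fun i j =>
  (hF i j).ae_eq (by filter_upwards [h] with t ht; rw [ht])

theorem memH2_of_cm {x : ℕ → HQ} (h : ∀ i j, CMemH2 (cm x i j)) : MemH2 x := by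
  have := (h 0 0).add (h 0 1)
  refine this.congr fun n => ?_
  simp only [cm, rho00, rho01, cnsq, nsq]; ring

theorem m4 {F : Tor → M2} (hF : ML2 F) {x : ℕ → HQ} (h : ∀ n, mcoef F n = rho (extQ x n)) :
    MemH2 x ∧ F =ᵐ[muT] Bd x := by
  have := fun i j => s1 (c := cm x i j) (hF i j) (fun n => by
    rw [ext_cm, ← h]; rfl)
  exact ⟨memH2_of_cm fun i j => (this i j).1, mae fun i j => (this i j).2⟩

theorem MInt_mul {F G : Tor → M2} (hF : ML2 F) (hG : ML2 G) : MInt (fun t => F t * G t) := by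
  intro i j
  simp only [Matrix.mul_apply, Fin.sum_univ_two]
  exact ((hF i 0).integrable_mul (hG 0 j)).add ((hF i 1).integrable_mul (hG 1 j))

theorem fc_add {f g : Tor → ℂ} (hf : Integrable f muT) (hg : Integrable g muT) (n : ℤ) :
    fourierCoeff (fun t => f t + g t) n = fourierCoeff f n + fourierCoeff g n := by
  unfold fourierCoeff
  simp only [smul_add]
  have key : ∀ h : Tor → ℂ, Integrable h muT → Integrable (fun t => fourier (-n) t • h t) muT := fun h hh => by
    refine hh.bdd_mul (c := 1) (map_continuous (fourier (-n))).aestronglyMeasurable (ae_of_all _ fun t => ?_)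
    simp [fourier_apply, Circle.norm_coe]
  exact integral_add (key f hf) (key g hg)

theorem mcoef_mul {F G : Tor → M2} (hF : ML2 F) (hG : ML2 G) (n : ℤ) (i j : Fin 2) :
    HasSum (fun k => (mcoef F k * mcoef G (n - k)) i j) (mcoef (fun t => F t * G t) n i j) := by
  have e : mcoef (fun t => F t * G t) n i j = fourierCoeff (fun t => F t i 0 * G t 0 j) n
      + fourierCoeff (fun t => F t i 1 * G t 1 j) n := by
    have := fc_add (f := fun t => F t i 0 * G t 0 j) (g := fun t => F t i 1 * G t 1 j)
      ((hF i 0).integrable_mul (hG 0 j)) ((hF i 1).integrable_mul (hG 1 j)) n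
    refine Eq.trans ?_ this
    simp only [mcoef, Matrix.mul_apply, Fin.sum_univ_two]
  rw [e]
  simp only [Matrix.mul_apply, Fin.sum_univ_two]
  exact (conv_hasSum (hF i 0) (hG 0 j) n).add (conv_hasSum (hF i 1) (hG 1 j) n)

theorem mcoef_star (F : Tor → M2) (n : ℤ) : mcoef (fun t => (F t)ᴴ) n = (mcoef F (-n))ᴴ := by
  ext i j
  rw [Matrix.conjTranspose_apply]
  exact coeff_star _ n

theorem ML2.star {F : Tor → M2} (h : ML2 F) : ML2 (fun t => (F t)ᴴ) := fun i j => (h j i).star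

theorem mcoef_sprod {a b : ℕ → HQ} (ha : MemH2 a) (hb : MemH2 b) (n : ℤ) :
    mcoef (fun t => Bd a t * Bd b t) n = rho (extQ (sProd a b) n) := by
  ext i j
  have h := mcoef_mul (ML2_Bd a) (ML2_Bd b) n i j
  simp only [mcoef_Bd ha, mcoef_Bd hb, ← rho_mul] at h
  refine h.unique ?_
  rcases lt_or_ge n 0 with hn | hn
  · rw [extQ_neg _ hn]
    have : ∀ k : ℤ, extQ a k * extQ b (n - k) = 0 := by
      intro k
      rcases lt_or_ge k 0 with hk | hk
      · rw [extQ_neg _ hk, zero_mul]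
      · rw [extQ_neg b (by omega : n - k < 0), mul_zero]
    simp only [this]
    simp only [map_zero]
    exact hasSum_zero
  · obtain ⟨m, rfl⟩ := Int.eq_ofNat_of_zero_le hn
    rw [extQ_nat]
    have := hasSum_sum_of_ne_finset_zero (L := SummationFilter.unconditional ℤ) (f := fun k : ℤ => rho (extQ a k * extQ b ((m:ℤ) - k)) i j)
      (s := (Finset.range (m+1)).map Nat.castEmbedding) (by
        intro k hk
        have : extQ a k * extQ b (m - k) = 0 := by
          rcases lt_or_ge k 0 with hk' | hk'
          · rw [extQ_neg _ hk', zero_mul]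
          · obtain ⟨l, rfl⟩ := Int.eq_ofNat_of_zero_le hk'
            have : ¬ l < m + 1 := by
              intro hl; apply hk; simp only [Finset.mem_map, Finset.mem_range]
              exact ⟨l, hl, rfl⟩
            rw [extQ_neg b (by omega : (m:ℤ) - l < 0), mul_zero]
        simp only [this, map_zero]; rfl)
    have e : ∑ k ∈ (Finset.range (m+1)).map Nat.castEmbedding, rho (extQ a k * extQ b ((m:ℤ) - k)) i j = rho (sProd a b m) i j := ?_
    · rw [← e]; exact this
    rw [Finset.sum_map, ← ent_apply, sProd, map_sum]
    refine Finset.sum_congr rfl fun k hk => ?_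
    have hk : k < m + 1 := Finset.mem_range.1 hk
    rw [ent_apply, Nat.castEmbedding_apply, extQ_nat, (by omega : (m:ℤ) - (k:ℤ) = ((m - k : ℕ) : ℤ)), extQ_nat]

/-- products -/
theorem ML2_mul_left {F G : Tor → M2} (hF : ML2 F) (hb : MBdd F) (hG : ML2 G) : ML2 (fun t => F t * G t) := by
  obtain ⟨C, hC⟩ := hb
  have key : ∀ i k j, MemLp (fun t => F t i k * G t k j) 2 muT := fun i k j => by
    refine ((hG k j).const_mul (C : ℂ)).of_le ((hF i k).1.mul (hG k j).1) ?_
    filter_upwards [hC] with t ht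
    rw [norm_mul, norm_mul]
    gcongr
    refine (ht i k).trans ?_
    rw [Complex.norm_real]; exact le_abs_self C
  intro i j
  simp only [Matrix.mul_apply, Fin.sum_univ_two]
  exact (key i 0 j).add (key i 1 j)

theorem ML2_mul_right {F G : Tor → M2} (hF : ML2 F) (hG : ML2 G) (hb : MBdd G)  : ML2 (fun t => F t * G t) := by
  obtain ⟨C, hC⟩ := hb
  have key : ∀ i k j, MemLp (fun t => F t i k * G t k j) 2 muT := fun i k j => by
    refine ((hF i k).const_mul (C : ℂ)).of_le ((hF i k).1.mul (hG k j).1) ?_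
    filter_upwards [hC] with t ht
    rw [norm_mul, norm_mul, mul_comm]
    gcongr
    refine (ht k j).trans ?_
    rw [Complex.norm_real]; exact le_abs_self C
  intro i j
  simp only [Matrix.mul_apply, Fin.sum_univ_two]
  exact (key i 0 j).add (key i 1 j)

theorem Bd_sProd_l {a b : ℕ → HQ} (ha : MemH2 a) (hb : MemH2 b) (h : MBdd (Bd a)) :
    MemH2 (sProd a b) ∧ (fun t => Bd a t * Bd b t) =ᵐ[muT] Bd (sProd a b) :=
  m4 (ML2_mul_left (ML2_Bd a) h (ML2_Bd b)) (mcoef_sprod ha hb)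

theorem Bd_sProd_r {a b : ℕ → HQ} (ha : MemH2 a) (hb : MemH2 b) (h : MBdd (Bd b)) :
    MemH2 (sProd a b) ∧ (fun t => Bd a t * Bd b t) =ᵐ[muT] Bd (sProd a b) :=
  m4 (ML2_mul_right (ML2_Bd a) (ML2_Bd b) h) (mcoef_sprod ha hb)

theorem Bd_inj {a b : ℕ → HQ} (ha : MemH2 a) (hb : MemH2 b) (h : Bd a =ᵐ[muT] Bd b) : a = b := by
  funext n
  apply rho_inj
  rw [← extQ_nat a, ← extQ_nat b, ← mcoef_Bd ha, ← mcoef_Bd hb, mcoef_congr h]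

theorem h2_hasSum {a : ℕ → HQ} (ha : MemH2 a) : HasSum (fun n => ‖a n‖ ^ 2) (h2normSq a) := ha.hasSum

theorem fro_int {F : Tor → M2} (h : ML2 F) : Integrable (fun t => fro (F t)) muT := by
  unfold fro
  have := fun i j => (h i j).integrable_norm_pow (by norm_num)
  exact (((this 0 0).add (this 0 1)).add (this 1 0)).add (this 1 1)

theorem norm_fro {F : Tor → M2} (h : ML2 F) : HasSum (fun n => fro (mcoef F n)) (∫ t, fro (F t) ∂muT) := by
  have i2 := fun i j => (h i j).integrable_norm_pow (by norm_num)
  have p := fun i j => parseval (h i j)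
  have := (((p 0 0).add (p 0 1)).add (p 1 0)).add (p 1 1)
  unfold fro
  have e : ∫ t, (‖F t 0 0‖ ^ 2 + ‖F t 0 1‖ ^ 2 + ‖F t 1 0‖ ^ 2 + ‖F t 1 1‖ ^ 2) ∂muT =
    ∫ t, ‖F t 0 0‖ ^ 2 ∂muT + ∫ t, ‖F t 0 1‖ ^ 2 ∂muT + ∫ t, ‖F t 1 0‖ ^ 2 ∂muT + ∫ t, ‖F t 1 1‖ ^ 2 ∂muT := by
    refine (integral_add (((i2 0 0).add (i2 0 1)).add (i2 1 0)) (i2 1 1)).trans ?_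
    congr 1
    refine (integral_add ((i2 0 0).add (i2 0 1)) (i2 1 0)).trans ?_
    congr 1
    exact integral_add (i2 0 0) (i2 0 1)
  rw [e]
  exact this

theorem h2_fro {a : ℕ → HQ} (ha : MemH2 a) : h2normSq a = (∫ t, fro (Bd a t) ∂muT) / 2 := by
  have h1 := norm_fro (ML2_Bd a)
  simp only [mcoef_Bd ha, fro_rho] at h1
  have h2 : HasSum (fun n : ℕ => 2 * ‖a n‖ ^ 2) (∫ t, fro (Bd a t) ∂muT) := by
    refine ((Nat.cast_injective (R := ℤ)).hasSum_iff (f := fun n : ℤ => 2 * ‖extQ a n‖ ^ 2) ?_).2 h1 |>.congr_fun ?_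
    · intro x hx
      rw [extQ_neg]
      · simp
      · by_contra hh
        exact hx ⟨x.toNat, by simp; omega⟩
    · intro n; simp [extQ_nat]
  have := h2.unique ((h2_hasSum ha).mul_left 2)
  linarith
end HFact

end

end

section
open MeasureTheory Filter Topology
open scoped ENNReal Classical Matrix
noncomputable section
set_option linter.unusedVariables false
namespace HFact

/-! sProd algebra -/
theorem mk_sProd (a b : ℕ → HQ) : PowerSeries.mk (sProd a b) = PowerSeries.mk a * PowerSeries.mk b := by
  refine PowerSeries.ext fun n => ?_
  rw [PowerSeries.coeff_mul, PowerSeries.coeff_mk, sProd, Finset.Nat.sum_antidiagonal_eq_sum_range_succ_mk]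
  simp

theorem mk_inj {a b : ℕ → HQ} (h : PowerSeries.mk a = PowerSeries.mk b) : a = b := by
  funext n
  rw [← PowerSeries.coeff_mk n a, h, PowerSeries.coeff_mk]

theorem sProd_assoc (a b c : ℕ → HQ) : sProd (sProd a b) c = sProd a (sProd b c) := by
  apply mk_inj; simp only [mk_sProd, mul_assoc]

theorem mk_sub' (a b : ℕ → HQ) : PowerSeries.mk (a - b) = PowerSeries.mk a - PowerSeries.mk b := by
  refine PowerSeries.ext fun n => ?_; simp
theorem mk_add' (a b : ℕ → HQ) : PowerSeries.mk (a + b) = PowerSeries.mk a + PowerSeries.mk b := by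
  refine PowerSeries.ext fun n => ?_; simp
theorem sProd_sub (a b c : ℕ → HQ) : sProd a (b - c) = sProd a b - sProd a c := by
  apply mk_inj; simp only [mk_sProd, mk_sub', mul_sub]
theorem sProd_add (a b c : ℕ → HQ) : sProd a (b + c) = sProd a b + sProd a c := by
  apply mk_inj; simp only [mk_sProd, mk_add', mul_add]
theorem sub_sProd (a b c : ℕ → HQ) : sProd (a - b) c = sProd a c - sProd b c := by
  apply mk_inj; simp only [mk_sProd, mk_sub', sub_mul]

def mono (k : ℕ) (c : HQ) : ℕ → HQ := fun n => if n = k then c else 0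
theorem constS_eq (c : HQ) : constS c = mono 0 c := rfl

theorem sProd_mono (a : ℕ → HQ) (k : ℕ) (c : HQ) (n : ℕ) :
    sProd a (mono k c) n = if k ≤ n then a (n - k) * c else 0 := by
  unfold sProd mono
  split_ifs with h
  · rw [Finset.sum_eq_single (n - k)]
    · rw [if_pos (by omega)]
    · intro b hb hne; rw [if_neg, mul_zero]; have := Finset.mem_range.1 hb; omega
    · intro hh; exfalso; apply hh; rw [Finset.mem_range]; omega
  · apply Finset.sum_eq_zero; intro b hb
    rw [if_neg, mul_zero]; have := Finset.mem_range.1 hb; omega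

theorem sProd_const (a : ℕ → HQ) (c : HQ) (n : ℕ) : sProd a (constS c) n = a n * c := by
  rw [constS_eq, sProd_mono]; simp

theorem const_sProd (a : ℕ → HQ) (c : HQ) (n : ℕ) : sProd (constS c) a n = c * a n := by
  unfold sProd constS
  rw [Finset.sum_eq_single 0]
  · simp
  · intro b hb hne; rw [if_neg hne, zero_mul]
  · intro hh; exfalso; apply hh; simp

theorem sProd_one (a : ℕ → HQ) : sProd a oneS = a := by
  funext n; rw [oneS, sProd_const, mul_one]
theorem one_sProd (a : ℕ → HQ) : sProd oneS a = a := by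
  funext n; rw [oneS, const_sProd, one_mul]

theorem sProd_zero_coeff (a b : ℕ → HQ) : sProd a b 0 = a 0 * b 0 := by simp [sProd]

theorem conjS_sProd (a b : ℕ → HQ) : conjS (sProd a b) = sProd (conjS b) (conjS a) := by
  funext n
  simp only [conjS, sProd, star_sum, star_mul]
  rw [← Finset.sum_range_reflect]
  refine Finset.sum_congr rfl fun k hk => ?_
  have := Finset.mem_range.1 hk
  congr 3 <;> omega

theorem conjS_conjS (a : ℕ → HQ) : conjS (conjS a) = a := by funext n; simp [conjS]
theorem conjS_const (c : HQ) : conjS (constS c) = constS (star c) := by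
  funext n; unfold conjS constS; split_ifs <;> simp
theorem conjS_sub (a b : ℕ → HQ) : conjS (a - b) = conjS a - conjS b := by funext n; simp [conjS]
theorem conjS_oneS : conjS oneS = oneS := by rw [oneS, conjS_const, star_one]
theorem conjS_mem {a : ℕ → HQ} (h : MemH2 a) : MemH2 (conjS a) := by simpa [MemH2, conjS] using h
theorem conjS_norm (a : ℕ → HQ) : h2normSq (conjS a) = h2normSq a := by simp [h2normSq, conjS]
theorem conjS_poly {p : ℕ → HQ} (h : IsPolyQ p) : IsPolyQ (conjS p) := by
  obtain ⟨N, hN⟩ := h; exact ⟨N, fun n hn => by simp [conjS, hN n hn]⟩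

theorem poly_mem {p : ℕ → HQ} (h : IsPolyQ p) : MemH2 p := by
  obtain ⟨N, hN⟩ := h
  refine summable_of_ne_finset_zero (s := Finset.range (N+1)) fun n hn => ?_
  rw [hN n (by simpa using hn)]; simp
theorem poly_mono (k : ℕ) (c : HQ) : IsPolyQ (mono k c) := ⟨k, fun n hn => by simp [mono]; omega⟩
theorem poly_const (c : HQ) : IsPolyQ (constS c) := poly_mono 0 c
theorem poly_add {p q : ℕ → HQ} (hp : IsPolyQ p) (hq : IsPolyQ q) : IsPolyQ (p + q) := by
  obtain ⟨N, hN⟩ := hp; obtain ⟨M, hM⟩ := hq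
  exact ⟨max N M, fun n hn => by simp [hN n (lt_of_le_of_lt (le_max_left _ _) hn), hM n (lt_of_le_of_lt (le_max_right _ _) hn)]⟩
theorem poly_mul {p q : ℕ → HQ} (hp : IsPolyQ p) (hq : IsPolyQ q) : IsPolyQ (sProd p q) := by
  obtain ⟨N, hN⟩ := hp; obtain ⟨M, hM⟩ := hq
  refine ⟨N + M, fun n hn => Finset.sum_eq_zero fun k hk => ?_⟩
  have := Finset.mem_range.1 hk
  rcases lt_or_ge N k with h | h
  · rw [hN k h, zero_mul]
  · rw [hM (n - k) (by omega), mul_zero]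
theorem mem_add {a b : ℕ → HQ} (ha : MemH2 a) (hb : MemH2 b) : MemH2 (a + b) := by
  refine Summable.of_nonneg_of_le (fun _ => by positivity) (fun n => ?_) ((ha.add hb).mul_left 2)
  have h := norm_add_le (a n) (b n)
  have h0 := norm_nonneg (a n + b n)
  simp only [Pi.add_apply]
  nlinarith [sq_nonneg (‖a n‖ - ‖b n‖)]
theorem mem_neg {a : ℕ → HQ} (ha : MemH2 a) : MemH2 (-a) := by simpa [MemH2] using ha
theorem mem_sub {a b : ℕ → HQ} (ha : MemH2 a) (hb : MemH2 b) : MemH2 (a - b) := by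
  rw [sub_eq_add_neg]; exact mem_add ha (mem_neg hb)

/-! Bd linear -/
theorem fc_cmul (f : Tor → ℂ) (z : ℂ) (n : ℤ) :
    fourierCoeff (fun t => f t * z) n = fourierCoeff f n * z := by
  unfold fourierCoeff
  simp only [smul_eq_mul, ← mul_assoc]
  exact integral_mul_const _ _

theorem mcoef_add {F G : Tor → M2} (hF : MInt F) (hG : MInt G) (n : ℤ) :
    mcoef (fun t => F t + G t) n = mcoef F n + mcoef G n := by
  ext i j; exact fc_add (hF i j) (hG i j) n
theorem mcoef_neg (F : Tor → M2) (n : ℤ) : mcoef (fun t => - F t) n = - mcoef F n := by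
  ext i j
  have := fc_cmul (fun t => F t i j) (-1) n
  simp only [mul_neg, mul_one] at this
  exact this

theorem ML2.add {F G : Tor → M2} (hF : ML2 F) (hG : ML2 G) : ML2 (fun t => F t + G t) := fun i j => (hF i j).add (hG i j)
theorem ML2.neg {F : Tor → M2} (hF : ML2 F) : ML2 (fun t => - F t) := fun i j => (hF i j).neg
theorem extQ_add (a b : ℕ → HQ) (n : ℤ) : extQ (a + b) n = extQ a n + extQ b n := by
  unfold extQ; split_ifs <;> simp
theorem extQ_neg' (a : ℕ → HQ) (n : ℤ) : extQ (-a) n = -extQ a n := by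
  unfold extQ; split_ifs <;> simp

theorem Bd_add {a b : ℕ → HQ} (ha : MemH2 a) (hb : MemH2 b) :
    (fun t => Bd a t + Bd b t) =ᵐ[muT] Bd (a + b) := by
  refine (m4 ((ML2_Bd a).add (ML2_Bd b)) fun n => ?_).2
  rw [mcoef_add (ML2_Bd a).mInt (ML2_Bd b).mInt, mcoef_Bd ha, mcoef_Bd hb, extQ_add, map_add]
theorem Bd_neg {a : ℕ → HQ} (ha : MemH2 a) :
    (fun t => - Bd a t) =ᵐ[muT] Bd (-a) := by
  refine (m4 (ML2_Bd a).neg fun n => ?_).2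
  rw [mcoef_neg, mcoef_Bd ha, extQ_neg', map_neg]
theorem Bd_sub {a b : ℕ → HQ} (ha : MemH2 a) (hb : MemH2 b) :
    (fun t => Bd a t - Bd b t) =ᵐ[muT] Bd (a - b) := by
  rw [sub_eq_add_neg]
  filter_upwards [Bd_add ha (mem_neg hb), Bd_neg hb] with t h1 h2
  rw [← h1, ← h2, sub_eq_add_neg]

theorem Bd_mono (k : ℕ) (c : HQ) : (fun t : Tor => (fourier (k:ℤ) t : ℂ) • rho c) =ᵐ[muT] Bd (mono k c) := by
  refine (m4 (fun i j => ?_) fun n => ?_).2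
  · have : MemLp (fun t : Tor => (fourier (k:ℤ) t : ℂ) * rho c i j) 2 muT := by
      refine MemLp.of_bound (C := ‖rho c i j‖) ?_ (ae_of_all _ fun t => ?_)
      · exact ((map_continuous (fourier (k:ℤ))).mul continuous_const).aestronglyMeasurable
      · simp [fourier_apply, Circle.norm_coe]
    exact this
  · ext i j
    have := fc_cmul (fun t => (fourier (k:ℤ) t : ℂ)) (rho c i j) n
    refine Eq.trans this ?_
    have h2 : fourierCoeff (fun t : Tor => (fourier (k:ℤ) t : ℂ)) n = (Pi.single (k:ℤ) 1 : ℤ → ℂ) n :=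
      congrFun (fourierCoeff_fourier (k:ℤ)) n
    rw [h2]
    by_cases h : n = k
    · subst h; rw [extQ_nat]; simp [mono]
    · rw [Pi.single_eq_of_ne h, zero_mul]
      have : extQ (mono k c) n = 0 := by
        unfold extQ mono; split_ifs with h1 h2
        · omega
        · rfl
        · rfl
      rw [this, map_zero]; rfl

theorem Bd_const (c : HQ) : Bd (constS c) =ᵐ[muT] (fun t => rho c) := by
  filter_upwards [Bd_mono 0 c] with t ht
  rw [constS_eq, ← ht]; simp
theorem Bd_one : Bd oneS =ᵐ[muT] (fun t => 1) := by
  filter_upwards [Bd_const 1] with t ht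
  rw [oneS, ht, rho_one]

theorem MBdd.congr {F G : Tor → M2} (h : MBdd F) (e : F =ᵐ[muT] G) : MBdd G := by
  obtain ⟨C, hC⟩ := h
  refine ⟨C, ?_⟩
  filter_upwards [hC, e] with t h1 h2; rw [← h2]; exact h1

theorem MBdd_mono (k : ℕ) (c : HQ) : MBdd (Bd (mono k c)) := by
  refine MBdd.congr ⟨‖c‖, ae_of_all _ fun t i j => ?_⟩ (Bd_mono k c)
  rw [Matrix.smul_apply]
  have : ‖rho c i j‖ ≤ ‖c‖ := by
    have := rho_entry_le c i j
    exact le_of_sq_le_sq this (norm_nonneg _)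
  simpa [fourier_apply, Circle.norm_coe] using this

theorem MBdd_poly {p : ℕ → HQ} (h : IsPolyQ p) : MBdd (Bd p) := by
  obtain ⟨N, hN⟩ := h
  have : ∀ N, ∀ p : ℕ → HQ, (∀ n, N ≤ n → p n = 0) → MBdd (Bd p) := by
    intro N
    induction N with
    | zero =>
      intro p hp
      have : p = mono 0 0 := by funext n; rw [hp n (by omega)]; simp [mono]
      rw [this]; exact MBdd_mono 0 0
    | succ N ih =>
      intro p hp
      set p' : ℕ → HQ := fun n => if n < N then p n else 0 with hp'
      have hz : ∀ n, N ≤ n → p' n = 0 := fun n hn => by simp [hp']; omega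
      have e : p = p' + mono N (p N) := by
        funext n
        simp only [hp', mono, Pi.add_apply]
        rcases lt_trichotomy n N with h | h | h
        · simp [h, h.ne]
        · simp [h]
        · simp [h.ne', hp n (by omega)]; 
      obtain ⟨C1, h1⟩ := ih p' hz
      obtain ⟨C2, h2⟩ := MBdd_mono N (p N)
      have hm : MemH2 p' := poly_mem ⟨N, fun n hn => hz n (by omega)⟩
      rw [e]
      refine MBdd.congr ⟨C1 + C2, ?_⟩ (Bd_add hm (poly_mem (poly_mono N (p N))))
      filter_upwards [h1, h2] with t a1 a2 i j
      rw [Matrix.add_apply]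
      exact (norm_add_le _ _).trans (add_le_add (a1 i j) (a2 i j))
  exact this (N+1) p fun n hn => hN n (by omega)

theorem Bd_conjS {a : ℕ → HQ} (ha : MemH2 a) : Bd (conjS a) =ᵐ[muT] fun t => (Bd a t).adjugate := by
  refine ((m4 (fun i j => ?_) fun n => ?_).2).symm
  · have : MemLp (fun t => (!![Bd a t 1 1, - Bd a t 0 1; - Bd a t 1 0, Bd a t 0 0] : M2) i j) 2 muT := by
      fin_cases i <;> fin_cases j
      · exact ML2_Bd a 1 1
      · exact (ML2_Bd a 0 1).neg
      · exact (ML2_Bd a 1 0).neg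
      · exact ML2_Bd a 0 0
    simpa only [Matrix.adjugate_fin_two] using this
  · have e : extQ (conjS a) n = star (extQ a n) := by unfold extQ conjS; split_ifs <;> simp
    rw [e, rho_star_adj, ← mcoef_Bd ha]
    have neg : ∀ i j, fourierCoeff (fun t => - Bd a t i j) n = - mcoef (Bd a) n i j := fun i j => by
      have := fc_cmul (fun t => Bd a t i j) (-1) n
      simp only [mul_neg, mul_one] at this
      exact this
    rw [Matrix.adjugate_fin_two (mcoef (Bd a) n)]
    have h2 : mcoef (fun t => (Bd a t).adjugate) n = mcoef (fun t => !![Bd a t 1 1, - Bd a t 0 1; - Bd a t 1 0, Bd a t 0 0]) n := by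
      simp only [Matrix.adjugate_fin_two]
    rw [h2]
    apply m2ext
    · rfl
    · exact neg 0 1
    · exact neg 1 0
    · rfl

/-! ip -/
def ip (a b : ℕ → HQ) (k : ℤ) : HQ := ∑' n : ℕ, star (a n) * extQ b (n + k)

theorem extQ_summable {b : ℕ → HQ} (hb : MemH2 b) : Summable (fun n : ℤ => ‖extQ b n‖ ^ 2) := by
  refine ((Nat.cast_injective (R := ℤ)).summable_iff (f := fun n : ℤ => ‖extQ b n‖ ^ 2) ?_).1 ?_
  · intro x hx
    rw [extQ_neg]
    · simp
    · by_contra hh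
      exact hx ⟨x.toNat, by simp; omega⟩
  · refine hb.congr fun n => ?_
    simp [extQ_nat]

theorem ip_hasSum {a b : ℕ → HQ} (ha : MemH2 a) (hb : MemH2 b) (k : ℤ) :
    HasSum (fun n : ℕ => star (a n) * extQ b (n + k)) (ip a b k) := by
  apply Summable.hasSum
  have h2 : Summable (fun n : ℕ => ‖extQ b (n + k)‖ ^ 2) :=
    (extQ_summable hb).comp_injective (i := fun n : ℕ => (n:ℤ) + k) (fun x y h => by simp at h; exact h)
  refine Summable.of_norm_bounded ((ha.add h2)) fun n => ?_
  rw [norm_mul, norm_star]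
  nlinarith [sq_nonneg (‖a n‖ - ‖extQ b (n+k)‖), sq_nonneg (‖a n‖), sq_nonneg (‖extQ b (n+k)‖)]

theorem mcoef_ip {a b : ℕ → HQ} (ha : MemH2 a) (hb : MemH2 b) (k : ℤ) :
    mcoef (fun t => (Bd a t)ᴴ * Bd b t) k = rho (ip a b k) := by
  ext i j
  have h := mcoef_mul (ML2_Bd a).star (ML2_Bd b) k i j
  have h' : HasSum (fun n : ℤ => rho (star (extQ a n) * extQ b (n + k)) i j) (mcoef (fun t => (Bd a t)ᴴ * Bd b t) k i j) := by
    rw [← (Equiv.neg ℤ).hasSum_iff] at h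
    refine h.congr_fun fun n => ?_
    simp only [Function.comp, Equiv.neg_apply]
    rw [mcoef_star, neg_neg, mcoef_Bd ha, mcoef_Bd hb, rho_mul, rho_star, (by ring : k - -n = n + k)]
  rw [← (Nat.cast_injective (R := ℤ)).hasSum_iff] at h'
  · refine h'.unique ?_
    have := (ent i j).hasSum (ip_hasSum ha hb k)
    refine this.congr_fun fun n => ?_
    simp only [Function.comp, ent_apply, extQ_nat]
  · intro x hx
    rw [extQ_neg]
    · simp only [star_zero, zero_mul, map_zero]; rfl
    · by_contra hh
      exact hx ⟨x.toNat, by simp; omega⟩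
end HFact

end

end

section
open MeasureTheory Filter Topology
open scoped ENNReal Classical Matrix
noncomputable section
set_option linter.unusedVariables false
namespace HFact

def UB (φ : ℕ → HQ) : Prop := MemH2 φ ∧ ∀ᵐ t ∂muT, (Bd φ t)ᴴ * Bd φ t = 1

theorem UB.bdd {φ : ℕ → HQ} (h : UB φ) : MBdd (Bd φ) := by
  refine ⟨1, ?_⟩
  filter_upwards [h.2] with t ht i j
  exact unit_entry ht i j

theorem UB.iso {φ x : ℕ → HQ} (h : UB φ) (hx : MemH2 x) : h2normSq (sProd φ x) = h2normSq x := by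
  obtain ⟨h1, h2⟩ := Bd_sProd_l h.1 hx h.bdd
  rw [h2_fro h1, h2_fro hx]
  congr 1
  refine integral_congr_ae ?_
  filter_upwards [h2, h.2] with t e u
  simp only [← e, fro_mul_left u]

theorem UB.norm {φ : ℕ → HQ} (h : UB φ) : h2normSq φ = 1 := by
  have h1 : MemH2 oneS := poly_mem (poly_const 1)
  have := h.iso h1
  rw [sProd_one] at this
  rw [this, h2normSq, tsum_eq_single 0]
  · simp [oneS, constS]
  · intro b hb; simp [oneS, constS, hb]

theorem UB.conj {φ : ℕ → HQ} (h : UB φ) : UB (conjS φ) := by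
  refine ⟨conjS_mem h.1, ?_⟩
  filter_upwards [h.2, Bd_conjS h.1] with t h1 h2
  rw [h2]; exact unit_adj h1

theorem summ_r {r : ℝ} (h0 : 0 ≤ r) (h1 : r < 1) : Summable (fun n : ℕ => (r ^ n) ^ 2) := by
  have : Summable (fun n : ℕ => (r ^ 2) ^ n) := summable_geometric_of_lt_one (by positivity) (by nlinarith)
  refine this.congr fun n => ?_
  rw [← pow_mul, ← pow_mul, mul_comm]

theorem ev_summable {a : ℕ → HQ} (ha : MemH2 a) {q : HQ} (hq : ‖q‖ < 1) : Summable (fun n => ‖q‖ ^ n * ‖a n‖) := by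
  refine Summable.of_nonneg_of_le (fun n => by positivity) (fun n => ?_) ((summ_r (norm_nonneg q) hq).add ha)
  nlinarith [sq_nonneg (‖q‖ ^ n - ‖a n‖), sq_nonneg (‖q‖ ^ n), sq_nonneg ‖a n‖]

theorem ev_hasSum {a : ℕ → HQ} (ha : MemH2 a) {q : HQ} (hq : ‖q‖ < 1) : HasSum (fun n => q ^ n * a n) (evalS a q) := by
  apply Summable.hasSum
  refine Summable.of_norm_bounded (ev_summable ha hq) fun n => ?_
  rw [norm_mul, norm_pow]

theorem ev_sProd {a b : ℕ → HQ} (ha : MemH2 a) (hb : MemH2 b) {q : HQ} (hq : ‖q‖ < 1) :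
    HasSum (fun m => q ^ m * (evalS a q * b m)) (evalS (sProd a b) q) := by
  set f : ℕ × ℕ → HQ := fun p => q ^ p.2 * (q ^ p.1 * a p.1 * b p.2) with hf
  have hs : Summable f := by
    refine Summable.of_norm_bounded ((ev_summable ha hq).mul_of_nonneg (ev_summable hb hq) (fun _ => by positivity) (fun _ => by positivity)) fun p => ?_
    simp only [hf, norm_mul, norm_pow]
    apply le_of_eq; ring
  have hT := hs.hasSum
  have h1 : HasSum (fun m => q ^ m * (evalS a q * b m)) (∑' p, f p) := by
    have h2 : HasSum (f ∘ Prod.swap) (∑' p, f p) := (Equiv.prodComm ℕ ℕ).hasSum_iff.2 hT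
    refine h2.prod_fiberwise fun m => ?_
    exact ((ev_hasSum ha hq).mul_right (b m)).mul_left (q ^ m)
  have h3 : HasSum (fun n => q ^ n * sProd a b n) (∑' p, f p) := by
    have h2 := (Finset.HasAntidiagonal.sigmaAntidiagonalEquivProd (A := ℕ)).hasSum_iff.2 hT
    refine (h2.sigma (g := fun n => ∑ p ∈ Finset.HasAntidiagonal.antidiagonal n, f p) fun n => ?_).congr_fun fun n => ?_
    · have := Finset.hasSum (Finset.HasAntidiagonal.antidiagonal n) f
      exact this
    · rw [sProd, Finset.mul_sum, Finset.Nat.sum_antidiagonal_eq_sum_range_succ_mk]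
      refine Finset.sum_congr rfl fun k hk => ?_
      have := Finset.mem_range.1 hk
      simp only [hf]
      rw [mul_assoc (q ^ k), ← mul_assoc (q ^ (n-k)), ← pow_add]
      congr 2; omega
  have e : evalS (sProd a b) q = ∑' p, f p := h3.tsum_eq
  rw [e]; exact h1

theorem UB.ball {φ : ℕ → HQ} (h : UB φ) {q : HQ} (hq : ‖q‖ < 1) : ‖evalS φ q‖ ≤ 1 := by
  set A := evalS φ q with hA
  by_cases h0 : A = 0
  · rw [h0]; simp
  have hpos : 0 < ‖A‖ := norm_pos_iff.2 h0
  have hr := summ_r (norm_nonneg q) hq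
  set S := ∑' n, (‖q‖ ^ n) ^ 2 with hS
  have hS1 : 1 ≤ S := by
    have := hr.le_tsum 0 (fun _ _ => by positivity)
    simpa using this
  set x : ℕ → HQ := fun m => star (q ^ m * A) with hx
  have hxn : ∀ m, ‖x m‖ ^ 2 = ‖A‖ ^ 2 * (‖q‖ ^ m) ^ 2 := fun m => by simp [hx, mul_pow]
  have hxs : HasSum (fun m => ‖x m‖ ^ 2) (‖A‖ ^ 2 * S) :=
    (hr.hasSum.mul_left (‖A‖ ^ 2)).congr_fun fun m => (hxn m)
  have hxm : MemH2 x := hxs.summable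
  have e1 := ev_sProd h.1 hxm hq
  have hn : ∀ m, q ^ m * (A * x m) = ((‖A‖ ^ 2 * (‖q‖ ^ m) ^ 2 : ℝ) : HQ) := fun m => by
    rw [← mul_assoc, hx]
    simp only
    rw [Quaternion.self_mul_star, Quaternion.normSq_eq_norm_mul_self, norm_mul, norm_pow]
    congr 1; ring
  have e2 : HasSum (fun m => q ^ m * (A * x m)) ((‖A‖ ^ 2 * S : ℝ) : HQ) := by
    simp only [hn]
    have := (algebraMapCLM ℝ HQ).hasSum (hr.hasSum.mul_left (‖A‖ ^ 2))
    exact this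
  have e3 : ‖evalS (sProd φ x) q‖ = ‖A‖ ^ 2 * S := by
    rw [e1.unique e2, Quaternion.norm_coe, Real.norm_of_nonneg (by positivity)]
  obtain ⟨hm, -⟩ := Bd_sProd_l h.1 hxm h.bdd
  have hN : HasSum (fun n => ‖sProd φ x n‖ ^ 2) (‖A‖ ^ 2 * S) := by
    have := h2_hasSum hm
    rw [h.iso hxm, show h2normSq x = _ from hxs.tsum_eq] at this
    exact this
  have e4 : ‖evalS (sProd φ x) q‖ ≤ ‖A‖ * S := by
    have hb : HasSum (fun n => (‖A‖ * (‖q‖ ^ n) ^ 2 + ‖A‖⁻¹ * ‖sProd φ x n‖ ^ 2) / 2) (‖A‖ * S) := by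
      have := ((hr.hasSum.mul_left ‖A‖).add (hN.mul_left ‖A‖⁻¹)).div_const 2
      have e : (‖A‖ * S + ‖A‖⁻¹ * (‖A‖ ^ 2 * S)) / 2 = ‖A‖ * S := by field_simp; ring
      rw [e] at this; exact this
    rw [← (ev_hasSum hm hq).tsum_eq]
    refine tsum_of_norm_bounded hb fun n => ?_
    rw [norm_mul, norm_pow]
    generalize ‖q‖ ^ n = u
    generalize ‖sProd φ x n‖ = v
    rw [le_div_iff₀ (by norm_num)]
    have : ‖A‖ * u ^ 2 + ‖A‖⁻¹ * v ^ 2 - u * v * 2 = ‖A‖⁻¹ * (‖A‖ * u - v) ^ 2 := by field_simp; ring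
    nlinarith [mul_nonneg (inv_nonneg.2 hpos.le) (sq_nonneg (‖A‖ * u - v))]
  rw [e3] at e4
  have : ‖A‖ * (‖A‖ * S) ≤ 1 * (‖A‖ * S) := by nlinarith
  exact le_of_mul_le_mul_right this (by positivity)

theorem ev_mul_le {g w : ℕ → HQ} (hg : MemH2 g) (hw : UB w) {q : HQ} (hq : ‖q‖ < 1) :
    ‖evalS (sProd g w) q‖ ≤ ‖evalS g q‖ := by
  have h := ev_sProd hg hw.1 hq
  set A := evalS g q with hA
  by_cases h0 : A = 0
  · rw [h0] at h
    simp only [zero_mul, mul_zero] at h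
    rw [h.unique hasSum_zero]; simp
  · set q' := A⁻¹ * q * A with hq'
    have hn : ‖q'‖ < 1 := by
      rw [hq', norm_mul, norm_mul, norm_inv]
      have : ‖A‖ ≠ 0 := norm_ne_zero_iff.2 h0
      field_simp; exact hq
    have e : ∀ m, q ^ m * (A * w m) = A * (q' ^ m * w m) := fun m => by
      have : q' ^ m = A⁻¹ * q ^ m * A := by
        induction m with
        | zero => simp [h0]
        | succ m ih => rw [pow_succ, ih, pow_succ, hq']; simp only [mul_assoc]; rw [← mul_assoc A A⁻¹, mul_inv_cancel₀ h0, one_mul]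
      rw [this]; simp only [← mul_assoc]; rw [mul_inv_cancel₀ h0, one_mul]
    simp only [e] at h
    rw [h.unique ((ev_hasSum hw.1 hn).mul_left A), norm_mul]
    exact mul_le_of_le_one_right (norm_nonneg _) (hw.ball hn)
end HFact

end

end

section
open MeasureTheory Filter Topology
open scoped ENNReal Classical Matrix
noncomputable section
set_option linter.unusedVariables false
namespace HFact

def evL (I : HQ) : M2 →ₗ[ℝ] HQ where
  toFun := ev I
  map_add' A B := by
    have h1 : al (A + B) = al A + al B := by
      apply Quaternion.ext_iff.2
      simp only [Quaternion.re_add, Quaternion.imI_add, Quaternion.imJ_add, Quaternion.imK_add]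
      simp [al]
      exact ⟨by ring, by ring, by ring, by ring⟩
    have h2 : be (A + B) = be A + be B := by
      apply Quaternion.ext_iff.2
      simp only [Quaternion.re_add, Quaternion.imI_add, Quaternion.imJ_add, Quaternion.imK_add]
      simp [be]
      exact ⟨by ring, by ring, by ring, by ring⟩
    unfold ev; rw [h1, h2, mul_add]; abel
  map_smul' c A := by
    have h1 : al (c • A) = c • al A := by
      apply Quaternion.ext_iff.2
      simp only [Quaternion.re_smul, Quaternion.imI_smul, Quaternion.imJ_smul, Quaternion.imK_smul]
      simp [al]
      exact ⟨by ring, by ring, by ring, by ring⟩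
    have h2 : be (c • A) = c • be A := by
      apply Quaternion.ext_iff.2
      simp only [Quaternion.re_smul, Quaternion.imI_smul, Quaternion.imJ_smul, Quaternion.imK_smul]
      simp [be]
      exact ⟨by ring, by ring, by ring, by ring⟩
    unfold ev; rw [h1, h2]; simp

def evC (I : HQ) : M2 →L[ℝ] HQ := LinearMap.toContinuousLinearMap (evL I)
theorem evC_apply (I : HQ) (A : M2) : evC I A = ev I A := rfl

def toQ (I : HQ) (z : ℂ) : HQ := (z.re : HQ) + z.im • I

theorem ev_smul (I : HQ) (z : ℂ) (a : HQ) : ev I (z • rho a) = toQ I z * a := by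
  have h1 : al (z • rho a) = z.re • a := by
    apply Quaternion.ext_iff.2
    simp only [Quaternion.re_smul, Quaternion.imI_smul, Quaternion.imJ_smul, Quaternion.imK_smul]
    simp only [al, Matrix.smul_apply, smul_eq_mul, rho00, rho01, rho10, rho11, Complex.mul_re, Complex.mul_im]
    refine ⟨by ring, by ring, by ring, by ring⟩
  have h2 : be (z • rho a) = z.im • a := by
    apply Quaternion.ext_iff.2
    simp only [Quaternion.re_smul, Quaternion.imI_smul, Quaternion.imJ_smul, Quaternion.imK_smul]
    simp only [be, Matrix.smul_apply, smul_eq_mul, rho00, rho01, rho10, rho11, Complex.mul_re, Complex.mul_im]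
    refine ⟨by ring, by ring, by ring, by ring⟩
  unfold ev toQ
  rw [h1, h2, add_mul]
  simp [Quaternion.coe_mul_eq_smul]

theorem toQ_mul {I : HQ} (hI : I ∈ USphere) (z w : ℂ) : toQ I (z * w) = toQ I z * toQ I w := by
  have h : I * I = -1 := by rw [← sq]; exact hI
  have h' : (z.im * w.im) • (-1 : HQ) = -((z.im * w.im : ℝ) : HQ) := by
    rw [smul_neg, ← Quaternion.coe_mul_eq_smul, mul_one]
  unfold toQ
  rw [add_mul, mul_add, mul_add, smul_mul_smul_comm, h, h']
  simp only [Complex.mul_re, Complex.mul_im, Quaternion.coe_mul_eq_smul, Quaternion.mul_coe_eq_smul]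
  apply Quaternion.ext_iff.2
  simp
  refine ⟨by ring, by ring, by ring, by ring⟩

theorem toQ_pow {I : HQ} (hI : I ∈ USphere) (z : ℂ) (n : ℕ) : toQ I (z ^ n) = toQ I z ^ n := by
  induction n with
  | zero => simp [toQ]
  | succ n ih => rw [pow_succ, pow_succ, toQ_mul hI, ih]

theorem norm_toQ {I : HQ} (hI : I ∈ USphere) (z : ℂ) : ‖toQ I z‖ ^ 2 = ‖z‖ ^ 2 := by
  obtain ⟨h0, h1⟩ := mem_USphere.1 hI
  rw [nsq, cnsq]
  simp [toQ, h0]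
  linear_combination z.im ^ 2 * h1

theorem ceval_hasSum {c : ℕ → ℂ} (hc : CMemH2 c) {z : ℂ} (hz : ‖z‖ < 1) : HasSum (fun n => z ^ n * c n) (cEval c z) := by
  apply Summable.hasSum
  refine Summable.of_norm_bounded ((summ_r (norm_nonneg z) hz).add hc) fun n => ?_
  rw [norm_mul, norm_pow]
  nlinarith [sq_nonneg (‖z‖ ^ n - ‖c n‖), sq_nonneg (‖z‖ ^ n), sq_nonneg ‖c n‖]

def CE (a : ℕ → HQ) (z : ℂ) : M2 := fun i j => cEval (cm a i j) z

theorem evalS_eq {a : ℕ → HQ} (ha : MemH2 a) {I : HQ} (hI : I ∈ USphere) {z : ℂ} (hz : ‖z‖ < 1) :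
    evalS a (toQ I z) = ev I (CE a z) := by
  have h : HasSum (fun n => z ^ n • rho (a n)) (CE a z) := by
    apply Pi.hasSum.2; intro i; apply Pi.hasSum.2; intro j
    exact ceval_hasSum (cmem ha i j) hz
  have := (evC I).hasSum h
  simp only [Function.comp_def, evC_apply, ev_smul, toQ_pow hI] at this
  exact this.tsum_eq

theorem bdval_eq {a : ℕ → HQ} (ha : MemH2 a) : ∀ᵐ t : ℝ ∂volI, ∀ I ∈ USphere, bdval a (ptOn I t) = ev I (Bd a (t : Tor)) := by
  have : ∀ᵐ t : ℝ ∂volI, ∀ i j, Tendsto (fun r : ℝ => cEval (cm a i j) (r * Complex.exp (t * Complex.I))) (𝓝[<] (1:ℝ)) (𝓝 (bd (cm a i j) (t : Tor))) := by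
    rw [ae_all_iff]; intro i; rw [ae_all_iff]; intro j; exact fatou (cmem ha i j)
  filter_upwards [this] with t ht I hI
  have h1 : Tendsto (fun r : ℝ => CE a (r * Complex.exp (t * Complex.I))) (𝓝[<] (1:ℝ)) (𝓝 (Bd a (t : Tor))) := by
    apply tendsto_pi_nhds.2; intro i; apply tendsto_pi_nhds.2; intro j
    exact ht i j
  have h2 := ((evC I).continuous.tendsto _).comp h1
  have h3 : Tendsto (fun r : ℝ => evalS a ((r : HQ) * ptOn I t)) (𝓝[<] (1:ℝ)) (𝓝 (ev I (Bd a (t : Tor)))) := by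
    refine h2.congr' ?_
    have : ∀ᶠ r : ℝ in 𝓝[<] (1:ℝ), r ∈ Set.Ioo (0:ℝ) 1 := Ioo_mem_nhdsLT (by norm_num)
    filter_upwards [this] with r hr
    have e : (r : HQ) * ptOn I t = toQ I (r * Complex.exp (t * Complex.I)) := by
      unfold ptOn toQ
      rw [Complex.re_ofReal_mul, Complex.im_ofReal_mul, Complex.exp_ofReal_mul_I_re, Complex.exp_ofReal_mul_I_im, mul_add]
      simp [Quaternion.coe_mul_eq_smul, mul_smul, smul_comm r (Real.sin t) I]
    rw [e, evalS_eq ha hI, Function.comp, evC_apply]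
    rw [norm_mul, Complex.norm_exp_ofReal_mul_I, mul_one, Complex.norm_real, Real.norm_of_nonneg hr.1.le]
    exact hr.2
  have hex : ∃ L, Tendsto (fun r : ℝ => evalS a ((r : HQ) * ptOn I t)) (𝓝[<] (1 : ℝ)) (𝓝 L) := ⟨_, h3⟩
  rw [bdval, dif_pos hex]
  exact tendsto_nhds_unique hex.choose_spec h3

theorem mk_pt (q : HQ) (hq : ‖q‖ = 1) : ∃ I ∈ USphere, q = ptOn I (Real.arccos q.re) := by
  have h := nsq q
  rw [hq] at h
  set s := Real.sqrt (q.imI ^ 2 + q.imJ ^ 2 + q.imK ^ 2) with hs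
  have hss : s ^ 2 = q.imI ^ 2 + q.imJ ^ 2 + q.imK ^ 2 := Real.sq_sqrt (by positivity)
  have h1 : -1 ≤ q.re ∧ q.re ≤ 1 := abs_le.1 ((sq_le_one_iff_abs_le_one _).1 (by nlinarith [sq_nonneg q.imI, sq_nonneg q.imJ, sq_nonneg q.imK]))
  have hsin : Real.sin (Real.arccos q.re) = s := by
    rw [Real.sin_arccos, hs]; congr 1; linarith
  unfold ptOn
  rw [Real.cos_arccos h1.1 h1.2, hsin]
  by_cases h0 : s = 0
  · refine ⟨qI, mem_USphere.2 (by simp [qI]), ?_⟩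
    rw [h0] at hss
    have a1 : q.imI = 0 := by nlinarith [sq_nonneg q.imI, sq_nonneg q.imJ, sq_nonneg q.imK]
    have a2 : q.imJ = 0 := by nlinarith [sq_nonneg q.imI, sq_nonneg q.imJ, sq_nonneg q.imK]
    have a3 : q.imK = 0 := by nlinarith [sq_nonneg q.imI, sq_nonneg q.imJ, sq_nonneg q.imK]
    rw [h0, zero_smul, add_zero]
    apply Quaternion.ext_iff.2
    simp [a1, a2, a3]
  · refine ⟨s⁻¹ • q.im, mem_USphere.2 ⟨by simp, ?_⟩, ?_⟩
    · simp only [Quaternion.imI_smul, Quaternion.imJ_smul, Quaternion.imK_smul, Quaternion.imI_im, Quaternion.imJ_im, Quaternion.imK_im, smul_eq_mul]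
      field_simp; linarith
    · rw [smul_inv_smul₀ h0, Quaternion.re_add_im]

theorem meas_ptOn : Measurable (fun p : ℝ × HQ => ptOn p.2 p.1) := by
  have : Continuous (fun p : ℝ × HQ => ptOn p.2 p.1) := by
    unfold ptOn
    have h : Continuous (fun x : ℝ => (x : HQ)) := Quaternion.continuous_coe
    fun_prop
  exact this.measurable

theorem ptOn_re {I : HQ} (hI : I ∈ USphere) (t : ℝ) : (ptOn I t).re = Real.cos t := by
  obtain ⟨h0, h1⟩ := mem_USphere.1 hI
  simp [ptOn, h0]
theorem ptOn_norm {I : HQ} (hI : I ∈ USphere) (t : ℝ) : ‖ptOn I t‖ = 1 := by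
  have h : ptOn I t = toQ I (Complex.exp (t * Complex.I)) := by
    unfold ptOn toQ
    rw [Complex.exp_ofReal_mul_I_re, Complex.exp_ofReal_mul_I_im]
  have h2 := norm_toQ hI (Complex.exp (t * Complex.I))
  rw [← h, Complex.norm_exp_ofReal_mul_I] at h2
  nlinarith [norm_nonneg (ptOn I t)]

theorem ae_mem_sph : ∀ᵐ I ∂sphMeasure, I ∈ USphere := by
  unfold sphMeasure
  refine Measure.ae_smul_measure ?_ _
  apply ae_restrict_mem
  have : IsClosed {q : HQ | q ^ 2 = -1} := isClosed_eq (by fun_prop) continuous_const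
  exact this.measurableSet

theorem ae_sigma {Q : HQ → Prop} (h : ∀ᵐ t : ℝ ∂volI, ∀ I ∈ USphere, Q (ptOn I t)) : ∀ᵐ q ∂SigmaBd, Q q := by
  unfold SigmaBd
  refine Measure.ae_smul_measure ?_ _
  have h' := (ae_restrict_iff' measurableSet_Ioc).1 h
  set N0 : Set ℝ := {t | ¬ (t ≠ 0 ∧ (t ∈ Set.Ioc 0 (2 * Real.pi) → ∀ I ∈ USphere, Q (ptOn I t)))} with hN0
  have hN0' : volume N0 = 0 := by
    have h0 : ∀ᵐ t : ℝ, t ≠ 0 := by simp [ae_iff]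
    exact ae_iff.1 (h0.and h')
  set N := toMeasurable volume N0 with hN
  have hNm : MeasurableSet N := measurableSet_toMeasurable _ _
  have hNn : volume N = 0 := by rw [hN, measure_toMeasurable, hN0']
  have hsub : N0 ⊆ N := subset_toMeasurable _ _
  have a1 : ∀ᵐ t : ℝ, t ∉ N := measure_eq_zero_iff_ae_notMem.1 hNn
  have a2 : ∀ᵐ t : ℝ, 2 * Real.pi - t ∉ N :=
    (Measure.measurePreserving_sub_left (volume : Measure ℝ) (2 * Real.pi)).quasiMeasurePreserving.ae a1
  have a3 : ∀ᵐ t ∂(volume.restrict (Set.Ico 0 (2 * Real.pi))), Real.arccos (Real.cos t) ∉ N := by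
    rw [ae_restrict_iff' measurableSet_Ico]
    filter_upwards [a1, a2] with t h1 h2 ht
    rcases le_or_gt t Real.pi with hp | hp
    · rw [Real.arccos_cos ht.1 hp]; exact h1
    · rw [← Real.cos_two_pi_sub, Real.arccos_cos (by linarith [ht.2]) (by linarith)]; exact h2
  have hm : MeasurableSet {q : HQ | Real.arccos q.re ∉ N ∧ ‖q‖ = 1} := by
    refine MeasurableSet.inter ?_ ?_
    · have : Measurable (fun q : HQ => Real.arccos q.re) := (Real.continuous_arccos.comp Quaternion.continuous_re).measurable
      exact this hNm.compl
    · exact measurableSet_eq_fun measurable_norm measurable_const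
  have key : ∀ᵐ q ∂(Measure.map (fun p : ℝ × HQ => ptOn p.2 p.1)
      ((volume.restrict (Set.Ico 0 (2 * Real.pi))).prod sphMeasure)), Real.arccos q.re ∉ N ∧ ‖q‖ = 1 := by
    refine (ae_map_iff meas_ptOn.aemeasurable hm).2 ?_
    have b1 := (Measure.quasiMeasurePreserving_fst (μ := volume.restrict (Set.Ico 0 (2 * Real.pi))) (ν := sphMeasure)).ae a3
    have b2 := (Measure.quasiMeasurePreserving_snd (μ := volume.restrict (Set.Ico 0 (2 * Real.pi))) (ν := sphMeasure)).ae ae_mem_sph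
    filter_upwards [b1, b2] with p h1 h2
    rw [ptOn_re h2]
    exact ⟨h1, ptOn_norm h2 _⟩
  filter_upwards [key] with q hq
  obtain ⟨I, hI, e⟩ := mk_pt q hq.2
  have hn : Real.arccos q.re ∉ N0 := fun hh => hq.1 (hsub hh)
  simp only [hN0, Set.mem_ofPred_eq, not_not] at hn
  rw [e]
  refine hn.2 ⟨lt_of_le_of_ne (Real.arccos_nonneg _) (Ne.symm hn.1), ?_⟩ I hI
  linarith [Real.arccos_le_pi q.re, Real.pi_pos]

theorem sigma_ae {Q : HQ → Prop} (h : ∀ᵐ q ∂SigmaBd, Q q) : ∀ᵐ t : ℝ ∂volI, ∀ᵐ I ∂sphMeasure, Q (ptOn I t) := by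
  unfold SigmaBd at h
  rw [Measure.ae_ennreal_smul_measure_iff (ENNReal.inv_ne_zero.2 ENNReal.ofReal_ne_top)] at h
  have h2 := Measure.ae_ae_of_ae_prod (ae_of_ae_map meas_ptOn.aemeasurable h)
  rw [Measure.restrict_congr_set Ico_ae_eq_Ioc] at h2
  exact h2

theorem meas_Bd (a : ℕ → HQ) (i j : Fin 2) : Measurable (fun t => Bd a t i j) := (meas_bd _).measurable

theorem br_mp {g h : ℕ → HQ} (hg : MemH2 g) (hh : MemH2 h) (H : ∀ᵐ q ∂SigmaBd, ‖bdval g q‖ = ‖bdval h q‖) :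
    ∀ᵐ t ∂muT, Bd g t * (Bd g t)ᴴ = Bd h t * (Bd h t)ᴴ := by
  refine ae_tor_of_real ?_ ?_
  · have e : {t | Bd g t * (Bd g t)ᴴ = Bd h t * (Bd h t)ᴴ} = ⋂ i, ⋂ j, {t | (Bd g t * (Bd g t)ᴴ) i j = (Bd h t * (Bd h t)ᴴ) i j} := by
      apply Set.ext; intro t; simp only [Set.mem_ofPred_eq, Set.mem_iInter]
      exact ⟨fun h i j => by rw [h], fun h => Matrix.ext h⟩
    rw [e]
    refine MeasurableSet.iInter fun i => MeasurableSet.iInter fun j => ?_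
    simp only [Matrix.mul_apply, Matrix.conjTranspose_apply, Fin.sum_univ_two]
    have m : ∀ (a : ℕ → HQ) (i j : Fin 2), Measurable (fun t => star (Bd a t i j)) := fun a i j =>
      continuous_star.measurable.comp (meas_Bd a i j)
    exact measurableSet_eq_fun (((meas_Bd g i 0).mul (m g j 0)).add ((meas_Bd g i 1).mul (m g j 1)))
     (((meas_Bd h i 0).mul (m h j 0)).add ((meas_Bd h i 1).mul (m h j 1)))
  · filter_upwards [sigma_ae H, bdval_eq hg, bdval_eq hh] with t h1 h2 h3
    rw [ccstar_iff]
    have := affine_zero (N := fro (Bd g t) / 2 - fro (Bd h t) / 2) (a := -2 * (V1 (Bd g t) - V1 (Bd h t)))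
      (b := -2 * (V2 (Bd g t) - V2 (Bd h t))) (c := -2 * (V3 (Bd g t) - V3 (Bd h t))) (by
        filter_upwards [h1, ae_mem_sph] with I e hI
        rw [h2 I hI, h3 I hI] at e
        have e1 := norm_ev hI (Bd g t)
        have e2 := norm_ev hI (Bd h t)
        rw [e] at e1
        linarith)
    exact ⟨by linarith [this.1], by linarith [this.2.1], by linarith [this.2.2.1], by linarith [this.2.2.2]⟩

theorem br_mpr {g h : ℕ → HQ} (hg : MemH2 g) (hh : MemH2 h) (H : ∀ᵐ t ∂muT, Bd g t * (Bd g t)ᴴ = Bd h t * (Bd h t)ᴴ) :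
    ∀ᵐ q ∂SigmaBd, ‖bdval g q‖ = ‖bdval h q‖ := by
  apply ae_sigma
  filter_upwards [ae_real_of_tor H, bdval_eq hg, bdval_eq hh] with t h1 h2 h3 I hI
  obtain ⟨a1, a2, a3, a4⟩ := ccstar_iff.1 h1
  rw [h2 I hI, h3 I hI]
  have e1 := norm_ev hI (Bd g t)
  have e2 := norm_ev hI (Bd h t)
  rw [a1, a2, a3, a4, ← e2] at e1
  exact (sq_eq_sq₀ (norm_nonneg _) (norm_nonneg _)).1 e1

theorem mem_one : MemH2 oneS := poly_mem (poly_const 1)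

theorem bdval_one : ∀ᵐ q ∂SigmaBd, ‖bdval oneS q‖ = 1 := by
  apply ae_sigma
  filter_upwards [ae_real_of_tor Bd_one, bdval_eq mem_one] with t h1 h2 I hI
  rw [h2 I hI, h1]
  have := ev_smul I 1 1
  rw [one_smul, rho_one] at this
  rw [this]; simp [toQ]

theorem inner_iff {φ : ℕ → HQ} : IsInnerQ φ ↔ UB φ := by
  constructor
  · rintro ⟨h1, -, h3⟩
    refine ⟨h1, ?_⟩
    have : ∀ᵐ q ∂SigmaBd, ‖bdval φ q‖ = ‖bdval oneS q‖ := by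
      filter_upwards [h3, bdval_one] with q a b; rw [a, b]
    filter_upwards [br_mp h1 mem_one this, Bd_one] with t a b
    rw [b] at a
    simp only [Matrix.conjTranspose_one, mul_one] at a
    exact mul_eq_one_comm.1 a
  · intro h
    refine ⟨h.1, fun q hq => h.ball hq, ?_⟩
    have : ∀ᵐ q ∂SigmaBd, ‖bdval φ q‖ = ‖bdval oneS q‖ := by
      apply br_mpr h.1 mem_one
      filter_upwards [h.2, Bd_one] with t a b
      rw [b]
      simp only [Matrix.conjTranspose_one, mul_one]
      exact mul_eq_one_comm.1 a
    filter_upwards [this, bdval_one] with q a b; rw [a, b]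
end HFact

end

end

section
open MeasureTheory Filter Topology
open scoped ENNReal Classical Matrix
noncomputable section
set_option linter.unusedVariables false
namespace HFact

abbrev LL := lp (fun _ : ℕ => HQ) 2

theorem mem_lp {a : ℕ → HQ} : Memℓp a 2 ↔ MemH2 a := by
  rw [memℓp_gen_iff (by norm_num)]
  simp [MemH2]
def toL (a : ℕ → HQ) (h : MemH2 a) : LL := ⟨a, mem_lp.2 h⟩
theorem LL_mem (x : LL) : MemH2 (x : ℕ → HQ) := mem_lp.1 x.2
theorem LL_norm (x : LL) : ‖x‖ ^ 2 = h2normSq (x : ℕ → HQ) := by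
  have := lp.norm_rpow_eq_tsum (p := 2) (by norm_num) x
  simpa [h2normSq] using this
theorem ip0 (a b : ℕ → HQ) : ip a b 0 = ∑' n, star (a n) * b n := by
  unfold ip
  simp only [add_zero, extQ_nat]
theorem re_tsum {f : ℕ → HQ} (h : Summable f) : (∑' n, f n).re = ∑' n, (f n).re := by
  have hc : Continuous (fun q : HQ => q.re) := Quaternion.continuous_re
  exact ((h.hasSum.map (⟨⟨fun q : HQ => q.re, rfl⟩, fun a b => rfl⟩ : HQ →+ ℝ) hc).tsum_eq).symm
theorem LL_inner (x y : LL) : inner ℝ x y = (ip x y 0).re := by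
  rw [lp.inner_eq_tsum, ip0, re_tsum]
  · congr 1; funext n
    rw [Quaternion.inner_def]; simp
  · have := (ip_hasSum (LL_mem x) (LL_mem y) 0).summable
    refine this.congr fun n => ?_
    rw [add_zero, extQ_nat]

theorem norm_nonneg' (a : ℕ → HQ) : 0 ≤ h2normSq a := tsum_nonneg fun n => by positivity
theorem coef_le {a : ℕ → HQ} (h : MemH2 a) (n : ℕ) : ‖a n‖ ^ 2 ≤ h2normSq a :=
  h.le_tsum n (fun m _ => by positivity)
theorem norm_eq_zero' {a : ℕ → HQ} (h : MemH2 a) (h0 : h2normSq a = 0) : a = 0 := by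
  funext n
  have := coef_le h n
  rw [h0] at this
  have h2 : ‖a n‖ = 0 := by nlinarith [norm_nonneg (a n)]
  simpa using h2

theorem ip_bound {a b : ℕ → HQ} (ha : MemH2 a) (hb : MemH2 b) (k : ℤ) : ‖ip a b k‖ ^ 2 ≤ h2normSq a * h2normSq b := by
  have inj : Function.Injective (fun n : ℕ => (n : ℤ) + k) := fun m n h => by simpa using h
  have s2 : Summable (fun n : ℕ => ‖extQ b (n + k)‖ ^ 2) := (extQ_summable hb).comp_injective inj
  have e2 : ∑' n : ℕ, ‖extQ b (n + k)‖ ^ 2 ≤ h2normSq b := by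
    have h1 : ∑' n : ℤ, ‖extQ b n‖ ^ 2 = h2normSq b := by
      have := (Nat.cast_injective (R := ℤ)).tsum_eq (f := fun n : ℤ => ‖extQ b n‖ ^ 2) ?_
      · rw [← this]; unfold h2normSq; simp only [extQ_nat]
      · intro n hn
        by_contra hc
        apply hn
        simp only
        rw [extQ_neg]; simp
        by_contra hh
        exact hc ⟨n.toNat, by simp; omega⟩
    rw [← h1]
    exact tsum_comp_le_tsum_of_inj (extQ_summable hb) (fun n => by positivity) inj
  have key := Real.inner_le_Lp_mul_Lq_tsum_of_nonneg (p := 2) (q := 2) (by constructor <;> norm_num)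
    (f := fun n : ℕ => ‖a n‖) (g := fun n : ℕ => ‖extQ b (n + k)‖) (fun n => norm_nonneg _) (fun n => norm_nonneg _)
    (by simpa [MemH2] using ha) (by simpa using s2)
  have k1 : Summable (fun n : ℕ => ‖a n‖ * ‖extQ b (n + k)‖) := by
    have := (ip_hasSum ha hb k).summable.norm
    simpa using this
  have k3 : ‖ip a b k‖ ≤ ∑' n : ℕ, ‖a n‖ * ‖extQ b (n + k)‖ := by
    unfold ip
    refine (norm_tsum_le_tsum_norm ?_).trans (le_of_eq ?_)
    · simpa using k1
    · simp
  have k4 := k3.trans key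
  simp only [Real.rpow_two] at k4
  have p1 : 0 ≤ ∑' n, ‖a n‖ ^ 2 := tsum_nonneg fun n => by positivity
  have p2 : 0 ≤ ∑' n : ℕ, ‖extQ b (n + k)‖ ^ 2 := tsum_nonneg fun n => by positivity
  rw [← Real.sqrt_eq_rpow, ← Real.sqrt_eq_rpow] at k4
  calc ‖ip a b k‖ ^ 2 ≤ (√(∑' n, ‖a n‖ ^ 2) * √(∑' n : ℕ, ‖extQ b (n + k)‖ ^ 2)) ^ 2 := by gcongr
    _ = (∑' n, ‖a n‖ ^ 2) * ∑' n : ℕ, ‖extQ b (n + k)‖ ^ 2 := by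
      rw [mul_pow, Real.sq_sqrt p1, Real.sq_sqrt p2]
    _ ≤ _ := by unfold h2normSq; exact mul_le_mul_of_nonneg_left e2 p1

theorem extQ_sub (a b : ℕ → HQ) (n : ℤ) : extQ (a - b) n = extQ a n - extQ b n := by
  unfold extQ; split_ifs <;> simp
theorem ip_sub {a b c : ℕ → HQ} (ha : MemH2 a) (hb : MemH2 b) (hc : MemH2 c) (k : ℤ) : ip a (b - c) k = ip a b k - ip a c k := by
  refine ((ip_hasSum ha (mem_sub hb hc) k).congr_fun fun n => ?_).unique ((ip_hasSum ha hb k).sub (ip_hasSum ha hc k))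
  rw [extQ_sub, mul_sub]

theorem extQ_mono (x : ℕ → HQ) (j : ℕ) (c : HQ) (m : ℤ) : extQ (sProd x (mono j c)) m = extQ x (m - j) * c := by
  by_cases h : 0 ≤ m
  · lift m to ℕ using h
    rw [extQ_nat, sProd_mono]
    split_ifs with h1
    · rw [← Nat.cast_sub h1, extQ_nat]
    · rw [extQ_neg _ (by omega), zero_mul]
  · rw [extQ_neg _ (by omega), extQ_neg _ (by omega), zero_mul]

theorem mem_mul_poly {x p : ℕ → HQ} (hx : MemH2 x) (hp : IsPolyQ p) : MemH2 (sProd x p) :=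
  (Bd_sProd_r hx (poly_mem hp) (MBdd_poly hp)).1
theorem mem_poly_mul {x p : ℕ → HQ} (hx : MemH2 x) (hp : IsPolyQ p) : MemH2 (sProd p x) :=
  (Bd_sProd_l (poly_mem hp) hx (MBdd_poly hp)).1

theorem ip_mono {w x : ℕ → HQ} (hw : MemH2 w) (hx : MemH2 x) (j : ℕ) (c : HQ) (k : ℤ) :
    ip w (sProd x (mono j c)) k = ip w x (k - j) * c := by
  refine ((ip_hasSum hw (mem_mul_poly hx (poly_mono j c)) k).congr_fun fun n => ?_).unique ((ip_hasSum hw hx (k - j)).mul_right c)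
  rw [extQ_mono, ← mul_assoc, add_sub_assoc]

theorem norm_mul_const (x : ℕ → HQ) (c : HQ) : h2normSq (sProd x (constS c)) = h2normSq x * ‖c‖ ^ 2 := by
  unfold h2normSq
  rw [← tsum_mul_right]
  congr 1; funext n; rw [sProd_const, norm_mul, mul_pow]

theorem sProd_smul (f p : ℕ → HQ) (c : ℝ) : sProd f (c • p) = c • sProd f p := by
  funext n; simp [sProd, Finset.smul_sum]

def NN (f : ℕ → HQ) (hf : MemH2 f) : Submodule ℝ LL where
  carrier := {x | ∃ p, IsPolyQ p ∧ p 0 = 0 ∧ (x : ℕ → HQ) = sProd f p}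
  add_mem' := by
    rintro x y ⟨p, hp, hp0, ex⟩ ⟨q, hq, hq0, ey⟩
    refine ⟨p + q, poly_add hp hq, by simp [hp0, hq0], ?_⟩
    rw [sProd_add, ← ex, ← ey]; rfl
  zero_mem' := ⟨0, ⟨0, fun _ _ => rfl⟩, rfl, by funext n; simp [sProd]⟩
  smul_mem' := by
    rintro c x ⟨p, ⟨N, hN⟩, hp0, ex⟩
    refine ⟨c • p, ⟨N, fun n hn => by simp [hN n hn]⟩, by simp [hp0], ?_⟩
    rw [sProd_smul, ← ex]; rfl

theorem poly_sub {p q : ℕ → HQ} (hp : IsPolyQ p) (hq : IsPolyQ q) : IsPolyQ (p - q) := by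
  obtain ⟨N, hN⟩ := hp; obtain ⟨M, hM⟩ := hq
  exact ⟨max N M, fun n hn => by simp [hN n (lt_of_le_of_lt (le_max_left _ _) hn), hM n (lt_of_le_of_lt (le_max_right _ _) hn)]⟩

theorem norm_sub_comm' (a b : ℕ → HQ) : h2normSq (a - b) = h2normSq (b - a) := by
  unfold h2normSq; congr 1; funext n; simp [norm_sub_rev]

theorem exists_w {f : ℕ → HQ} (hf : MemH2 f) (hne : f ≠ 0) : ∃ w, MemH2 w ∧ w ≠ 0 ∧
    (∀ ε > 0, ∃ p, IsPolyQ p ∧ h2normSq (sProd f p - w) < ε) ∧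
    (∀ p, IsPolyQ p → p 0 = 0 → ip w (sProd f p) 0 = 0) := by
  set N := NN f hf
  set K := N.topologicalClosure
  have : CompleteSpace K := N.isClosed_topologicalClosure.completeSpace_coe
  set F := toL f hf with hF
  set x := K.starProjection F with hx
  have hxK : x ∈ K := K.starProjection_apply_mem F
  have hort : F - x ∈ Kᗮ := K.sub_starProjection_mem_orthogonal F
  have happ : ∀ ε > 0, ∃ p, IsPolyQ p ∧ p 0 = 0 ∧ h2normSq (sProd f p - x) < ε := by
    intro ε hε
    have : x ∈ closure (N : Set LL) := by
      rw [← Submodule.topologicalClosure_coe]; exact hxK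
    obtain ⟨y, ⟨p, hp, hp0, ey⟩, hd⟩ := Metric.mem_closure_iff.1 this (√ε) (Real.sqrt_pos.2 hε)
    refine ⟨p, hp, hp0, ?_⟩
    rw [← ey, norm_sub_comm']
    have h1 := LL_norm (x - y)
    rw [lp.coeFn_sub] at h1
    rw [← h1, ← Real.sq_sqrt hε.le]
    rw [dist_eq_norm] at hd
    gcongr
  have hw : ((F - x : LL) : ℕ → HQ) = f - x := by rw [lp.coeFn_sub]; rfl
  refine ⟨f - x, hw ▸ LL_mem _, ?_, ?_, ?_⟩
  · intro h0
    have hfx : (x : ℕ → HQ) = f := (sub_eq_zero.1 h0).symm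
    obtain ⟨m, hm, hmin⟩ : ∃ m, f m ≠ 0 ∧ ∀ k < m, f k = 0 := by
      have hex : ∃ m, f m ≠ 0 := by
        by_contra hc; push Not at hc; exact hne (funext hc)
      exact ⟨Nat.find hex, Nat.find_spec hex, fun k hk => not_not.1 (Nat.find_min hex hk)⟩
    obtain ⟨p, hp, hp0, hlt⟩ := happ (‖f m‖ ^ 2) (by positivity)
    rw [hfx] at hlt
    have := coef_le (mem_sub (mem_mul_poly hf hp) hf) m
    have hz : sProd f p m = 0 := by
      refine Finset.sum_eq_zero fun k hk => ?_
      rcases lt_or_eq_of_le (Nat.lt_succ_iff.1 (Finset.mem_range.1 hk)) with h | h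
      · rw [hmin k h, zero_mul]
      · rw [h, Nat.sub_self, hp0, mul_zero]
    rw [Pi.sub_apply, hz, zero_sub, norm_neg] at this
    linarith
  · intro ε hε
    obtain ⟨p, hp, hp0, hlt⟩ := happ ε hε
    refine ⟨oneS - p, poly_sub (poly_const 1) hp, ?_⟩
    rw [sProd_sub, sProd_one, show f - sProd f p - (f - (x : ℕ → HQ)) = x - sProd f p by abel, norm_sub_comm']
    exact hlt
  · have h1 : ∀ p, IsPolyQ p → p 0 = 0 → (ip (f - x) (sProd f p) 0).re = 0 := by
      intro p hp hp0
      have hy : toL (sProd f p) (mem_mul_poly hf hp) ∈ K := N.le_topologicalClosure ⟨p, hp, hp0, rfl⟩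
      have := (Submodule.mem_orthogonal' _ _).1 hort _ hy
      rw [LL_inner, hw] at this
      exact this
    intro p hp hp0
    have hmw : MemH2 (f - x) := hw ▸ LL_mem _
    set c := ip (f - x) (sProd f p) 0 with hc
    have := h1 (sProd p (mono 0 (star c))) (poly_mul hp (poly_mono _ _)) (by rw [sProd_zero_coeff, hp0, zero_mul])
    rw [← sProd_assoc, ip_mono hmw (mem_mul_poly hf hp)] at this
    simp only [Nat.cast_zero, sub_zero, ← hc] at this
    rw [Quaternion.self_mul_star, Quaternion.re_coe] at this
    exact Quaternion.normSq_eq_zero.1 this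

end HFact

end

end

section
open MeasureTheory Filter Topology
open scoped ENNReal Classical Matrix
noncomputable section
set_option linter.unusedVariables false
namespace HFact

def RC (g : ℕ → HQ) : Prop := MemH2 g ∧ ∀ ε > 0, ∃ p, IsPolyQ p ∧ h2normSq (sProd g p - oneS) < ε

theorem l1_munique {F G : Tor → M2} (hF : MInt F) (hG : MInt G) (h : ∀ n, mcoef F n = mcoef G n) : F =ᵐ[muT] G := by
  refine mae fun i j => ?_
  have hI : Integrable (fun t => F t i j - G t i j) muT := (hF i j).sub (hG i j)
  have := l1_unique hI (fun n => by
    have e := fc_add (hF i j) (hG i j).neg n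
    have e2 := fc_cmul (fun t => G t i j) (-1) n
    simp only [mul_neg, mul_one] at e2
    have e3 : fourierCoeff (fun t => F t i j - G t i j) n = fourierCoeff (fun t => F t i j) n + fourierCoeff (fun t => -(G t i j)) n := by
      rw [← fc_add (hF i j) (g := fun t => -(G t i j)) (hG i j).neg n]
      simp only [sub_eq_add_neg]
    rw [e3, e2]
    have h1 : fourierCoeff (fun t => F t i j) n = fourierCoeff (fun t => G t i j) n := congrFun (congrFun (h n) i) j
    rw [h1]; simp)
  filter_upwards [this] with t ht
  exact sub_eq_zero.1 ht

theorem gram {φ : ℕ → HQ} (h : MemH2 φ) (h1 : h2normSq φ = 1) (hn : ∀ k : ℤ, k < 0 → ip φ φ k = 0) : UB φ := by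
  refine ⟨h, ?_⟩
  have hs : ∀ k, mcoef (fun t => (Bd φ t)ᴴ * Bd φ t) k = (mcoef (fun t => (Bd φ t)ᴴ * Bd φ t) (-k))ᴴ := by
    intro k
    rw [← mcoef_star]
    simp only [Matrix.conjTranspose_mul, Matrix.conjTranspose_conjTranspose]
  have key : (fun t => (Bd φ t)ᴴ * Bd φ t) =ᵐ[muT] Bd oneS := by
    refine l1_munique (MInt_mul (ML2_Bd φ).star (ML2_Bd φ)) (ML2_Bd _).mInt fun n => ?_
    rw [mcoef_Bd mem_one]
    rcases lt_trichotomy n 0 with hlt | h0 | hgt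
    · rw [mcoef_ip h h, hn n hlt, extQ_neg _ hlt]
    · subst h0
      rw [mcoef_ip h h, ip0]
      congr 1
      have : (∑' n, star (φ n) * φ n) = ((h2normSq φ : ℝ) : HQ) := by
        have hh := (h2_hasSum h).map (algebraMap ℝ HQ) (continuous_algebraMap ℝ HQ)
        have h2 := hh.tsum_eq
        rw [← Quaternion.algebraMap_def] at *
        rw [← h2]
        congr 1; funext n
        simp [Quaternion.star_mul_self, Quaternion.normSq_eq_norm_mul_self, sq]
      rw [this, h1]
      simp [extQ, oneS, constS]
    · rw [hs, mcoef_ip h h, hn (-n) (by omega), map_zero]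
      lift n to ℕ using hgt.le
      rw [extQ_nat]
      have : n ≠ 0 := by omega
      simp [oneS, constS, this]
  filter_upwards [key, Bd_one] with t h1 h2
  rw [h1, h2]

theorem UB.mem {φ x : ℕ → HQ} (h : UB φ) (hx : MemH2 x) : MemH2 (sProd φ x) := (Bd_sProd_l h.1 hx h.bdd).1

theorem MBdd.star {F : Tor → M2} (h : MBdd F) : MBdd (fun t => (F t)ᴴ) := by
  obtain ⟨C, hC⟩ := h
  refine ⟨C, ?_⟩
  filter_upwards [hC] with t ht i j
  simpa using ht j i

theorem fact_of_ip {φ f : ℕ → HQ} (h : UB φ) (hf : MemH2 f) (hn : ∀ k : ℤ, k < 0 → ip φ f k = 0) :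
    ∃ g, MemH2 g ∧ f = sProd φ g := by
  obtain ⟨h1, h2⟩ := m4 (ML2_mul_left (ML2_Bd φ).star h.bdd.star (ML2_Bd f)) (x := fun n : ℕ => ip φ f n) (fun n => by
    rw [mcoef_ip h.1 hf]
    congr 1
    by_cases hlt : n < 0
    · rw [hn n hlt, extQ_neg _ hlt]
    · lift n to ℕ using (by omega)
      rw [extQ_nat])
  refine ⟨_, h1, ?_⟩
  refine Bd_inj hf (h.mem h1) ?_
  filter_upwards [h2, h.2, (Bd_sProd_l h.1 h1 h.bdd).2] with t e1 e2 e3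
  rw [← e3, ← e1, ← Matrix.mul_assoc, mul_eq_one_comm.1 e2, Matrix.one_mul]

theorem ip_self {φ x : ℕ → HQ} (h : UB φ) (hx : MemH2 x) (k : ℤ) : ip φ (sProd φ x) k = extQ x k := by
  apply rho_inj
  rw [← mcoef_ip h.1 (h.mem hx), ← mcoef_Bd hx]
  apply mcoef_congr
  filter_upwards [h.2, (Bd_sProd_l h.1 hx h.bdd).2] with t e2 e3
  rw [← e3, ← Matrix.mul_assoc, e2, Matrix.one_mul]

theorem UB.cancel {φ x y : ℕ → HQ} (h : UB φ) (hx : MemH2 x) (hy : MemH2 y) (e : sProd φ x = sProd φ y) : x = y := by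
  have h1 := h.iso (mem_sub hx hy)
  rw [sProd_sub, e, sub_self] at h1
  have h2 : h2normSq (x - y) = 0 := by rw [← h1]; simp [h2normSq]
  exact sub_eq_zero.1 (norm_eq_zero' (mem_sub hx hy) h2)

theorem small_zero {z : HQ} {C : ℝ} (hC : 0 < C) (h : ∀ ε > 0, ‖z‖ ^ 2 ≤ C * ε) : z = 0 := by
  by_contra hz
  have hp : 0 < ‖z‖ ^ 2 := by have := norm_pos_iff.2 hz; positivity
  have := h (‖z‖ ^ 2 / (2 * C)) (by positivity)
  have e : C * (‖z‖ ^ 2 / (2 * C)) = ‖z‖ ^ 2 / 2 := by field_simp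
  linarith

theorem beurling {f : ℕ → HQ} (hf : MemH2 f) (hne : f ≠ 0) : ∃ φ g, UB φ ∧ RC g ∧ f = sProd φ g := by
  obtain ⟨w, hw, hw0, happ, hort⟩ := exists_w hf hne
  have hpos : 0 < h2normSq w := lt_of_le_of_ne (norm_nonneg' w) (fun h => hw0 (norm_eq_zero' hw h.symm))
  have hip : ∀ p, IsPolyQ p → ∀ j : ℕ, 0 < j → ip w (sProd f p) (-(j : ℤ)) = 0 := by
    intro p hp j hj
    have := hort (sProd p (mono j 1)) (poly_mul hp (poly_mono _ _)) (by
      rw [sProd_zero_coeff]; simp [mono]; omega)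
    rw [← sProd_assoc, ip_mono hw (mem_mul_poly hf hp)] at this
    simpa using this
  have hipw : ∀ j : ℕ, 0 < j → ip w w (-(j : ℤ)) = 0 := by
    intro j hj
    refine small_zero hpos fun ε hε => ?_
    obtain ⟨p, hp, hlt⟩ := happ ε hε
    have h1 := ip_bound hw (mem_sub (mem_mul_poly hf hp) hw) (-(j : ℤ))
    rw [ip_sub hw (mem_mul_poly hf hp) hw, hip p hp j hj, zero_sub, norm_neg] at h1
    exact h1.trans (mul_le_mul_of_nonneg_left hlt.le hpos.le)
  set r : ℝ := (√(h2normSq w))⁻¹ with hr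
  have hrp : 0 < r := by have := Real.sqrt_pos.2 hpos; positivity
  have hr2 : h2normSq w * r ^ 2 = 1 := by
    rw [hr, inv_pow, Real.sq_sqrt hpos.le]; field_simp
  have hrn : ‖(r : HQ)‖ = r := by rw [Quaternion.norm_coe, Real.norm_of_nonneg hrp.le]
  set φ := sProd w (constS (r : HQ)) with hφ
  have hφm : MemH2 φ := mem_mul_poly hw (poly_const _)
  -- ip φ x k = r * ip w x k
  have hipφ : ∀ x, MemH2 x → ∀ k, ip φ x k = (r : HQ) * ip w x k := by
    intro x hx k
    refine ((ip_hasSum hφm hx k).congr_fun fun n => ?_).unique ((ip_hasSum hw hx k).mul_left (r : HQ))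
    rw [hφ, sProd_const, star_mul, Quaternion.star_coe, mul_assoc]
  have hU : UB φ := by
    refine gram hφm ?_ ?_
    · rw [hφ, norm_mul_const, hrn, hr2]
    · intro k hk
      obtain ⟨j, rfl⟩ : ∃ j : ℕ, k = -(j : ℤ) := ⟨(-k).toNat, by omega⟩
      rw [hipφ φ hφm, hφ, constS_eq, ip_mono hw hw]
      have := hipw j (by omega)
      simp [this]
  obtain ⟨g, hg, e⟩ := fact_of_ip hU hf (fun k hk => by
    obtain ⟨j, rfl⟩ : ∃ j : ℕ, k = -(j : ℤ) := ⟨(-k).toNat, by omega⟩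
    rw [hipφ f hf]
    have := hip oneS (poly_const 1) j (by omega)
    rw [sProd_one] at this
    rw [this, mul_zero])
  refine ⟨φ, g, hU, ⟨hg, fun ε hε => ?_⟩, e⟩
  obtain ⟨p, hp, hlt⟩ := happ (ε / r ^ 2) (by positivity)
  refine ⟨sProd p (constS (r : HQ)), poly_mul hp (poly_const _), ?_⟩
  rw [← hU.iso (mem_sub (mem_mul_poly hg (poly_mul hp (poly_const _))) mem_one), sProd_sub, sProd_one, ← sProd_assoc,
    ← e, hφ, ← sProd_assoc, ← sub_sProd, norm_mul_const, hrn]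
  exact (lt_div_iff₀ (by positivity)).1 hlt

theorem const_of {u : ℕ → HQ} (hu : MemH2 u) (h1 : h2normSq u ≤ 1) (h0 : 1 ≤ ‖u 0‖) : u = constS (u 0) ∧ ‖u 0‖ = 1 := by
  have hle : ‖u 0‖ = 1 := by
    have := coef_le hu 0
    nlinarith [norm_nonneg (u 0)]
  refine ⟨?_, hle⟩
  funext n
  unfold constS
  split_ifs with hn
  · rw [hn]
  · have := hu.sum_le_tsum {0, n} (fun i _ => by positivity)
    rw [Finset.sum_pair (Ne.symm hn), hle] at this
    have h2 : ‖u n‖ = 0 := by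
      have : (1:ℝ) ^ 2 + ‖u n‖ ^ 2 ≤ 1 := this.trans h1
      nlinarith [norm_nonneg (u n)]
    simpa using h2

theorem uniq_ip {f φ g φ₁ g₁ : ℕ → HQ} (hφ : UB φ) (hφ₁ : UB φ₁) (hg : RC g) (hg₁ : MemH2 g₁)
    (e : f = sProd φ g) (e₁ : f = sProd φ₁ g₁) : ∃ u, MemH2 u ∧ φ = sProd φ₁ u := by
  refine fact_of_ip hφ₁ hφ.1 fun k hk => ?_
  refine small_zero one_pos fun ε hε => ?_
  obtain ⟨p, hp, hlt⟩ := hg.2 ε hε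
  have hf : MemH2 f := e ▸ hφ.mem hg.1
  have h1 : ip φ₁ (sProd f p) k = 0 := by
    rw [e₁, sProd_assoc, ip_self hφ₁ (mem_mul_poly hg₁ hp), extQ_neg _ hk]
  have h2 := ip_bound hφ₁.1 (mem_sub (mem_mul_poly hf hp) hφ.1) k
  rw [ip_sub hφ₁.1 (mem_mul_poly hf hp) hφ.1, h1, zero_sub, norm_neg, hφ₁.norm] at h2
  have h3 : sProd f p - φ = sProd φ (sProd g p - oneS) := by
    rw [sProd_sub, sProd_one, e, sProd_assoc]
  rw [h3, hφ.iso (mem_sub (mem_mul_poly hg.1 hp) mem_one)] at h2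
  exact h2.trans (mul_le_mul_of_nonneg_left hlt.le zero_le_one)

theorem uniq {f φ g φ₁ g₁ : ℕ → HQ} (hφ : UB φ) (hφ₁ : UB φ₁) (hg : RC g) (hg₁ : RC g₁)
    (e : f = sProd φ g) (e₁ : f = sProd φ₁ g₁) : ∃ l : HQ, ‖l‖ = 1 ∧ φ₁ = sProd φ (constS l) ∧ g₁ = sProd (constS (star l)) g := by
  obtain ⟨u, hu, eu⟩ := uniq_ip hφ hφ₁ hg hg₁.1 e e₁
  obtain ⟨v, hv, ev⟩ := uniq_ip hφ₁ hφ hg₁ hg.1 e₁ e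
  have hun : h2normSq u = 1 := by rw [← hφ₁.iso hu, ← eu, hφ.norm]
  have hvn : h2normSq v = 1 := by rw [← hφ.iso hv, ← ev, hφ₁.norm]
  have h1 : oneS 0 = v 0 * u 0 := by
    rw [← sProd_zero_coeff]
    have h2 : sProd φ (sProd v u) = φ := by rw [← sProd_assoc, ← ev, ← eu]
    -- coefficients: use ip with φ
    have hm : MemH2 (sProd v u) := by
      have hvU : UB v := by
        refine ⟨hv, ?_⟩
        filter_upwards [hφ.2, hφ₁.2, (Bd_sProd_l hφ.1 hv hφ.bdd).2] with t a b c
        rw [ev, ← c, Matrix.conjTranspose_mul, Matrix.mul_assoc, ← Matrix.mul_assoc (Bd φ t)ᴴ, a, Matrix.one_mul] at b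
        exact b
      exact hvU.mem hu
    rw [hφ.cancel hm mem_one (by rw [h2, sProd_one])]
  have hn : ‖v 0‖ * ‖u 0‖ = 1 := by rw [← norm_mul, ← h1]; simp [oneS, constS]
  have hu1 : ‖u 0‖ ≤ 1 := by have := coef_le hu 0; nlinarith [norm_nonneg (u 0)]
  have hv1 : 1 ≤ ‖v 0‖ := by nlinarith [norm_nonneg (u 0), norm_nonneg (v 0)]
  obtain ⟨ec, hc⟩ := const_of hv hvn.le hv1
  refine ⟨v 0, hc, ec ▸ ev, ?_⟩
  have h3 : sProd (constS (v 0)) g₁ = g := by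
    refine hφ.cancel (mem_poly_mul hg₁.1 (poly_const _)) hg.1 ?_
    rw [← sProd_assoc, ← ec, ← ev, ← e₁, e]
  rw [← h3]
  funext n
  rw [const_sProd, const_sProd, ← mul_assoc, Quaternion.star_mul_self, Quaternion.normSq_eq_norm_mul_self, hc]
  simp

theorem norm_const_mul (x : ℕ → HQ) (c : HQ) : h2normSq (sProd (constS c) x) = ‖c‖ ^ 2 * h2normSq x := by
  unfold h2normSq
  rw [← tsum_mul_left]
  congr 1; funext n; rw [const_sProd, norm_mul, mul_pow]

theorem const_mul_const (c d : HQ) : sProd (constS c) (constS d) = constS (c * d) := by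
  funext n; rw [sProd_const]; unfold constS; split_ifs <;> simp

theorem RC_const {g : ℕ → HQ} (h : RC g) {c : HQ} (hc : ‖c‖ = 1) : RC (sProd (constS c) g) := by
  refine ⟨mem_poly_mul h.1 (poly_const _), fun ε hε => ?_⟩
  obtain ⟨p, hp, hlt⟩ := h.2 ε hε
  refine ⟨sProd p (constS (star c)), poly_mul hp (poly_const _), ?_⟩
  have e : sProd (sProd (constS c) g) (sProd p (constS (star c))) - oneS =
      sProd (constS c) (sProd (sProd g p - oneS) (constS (star c))) := by
    rw [sub_sProd, one_sProd, sProd_sub, const_mul_const, Quaternion.self_mul_star, Quaternion.normSq_eq_norm_mul_self, hc]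
    simp only [sProd_assoc]
    congr 1
    simp [oneS]
  rw [e, norm_const_mul, norm_mul_const, norm_star, hc]
  simpa using hlt

theorem det0 {a : ℕ → HQ} (ha : MemH2 a) : ‖a 0‖ ^ 2 ≤ ∫ t, ‖(Bd a t).det‖ ∂muT := by
  have h1 := mcoef_sprod ha (conjS_mem ha) 0
  have h2 : mcoef (fun t => Bd a t * Bd (conjS a) t) 0 = mcoef (fun t => (Bd a t).det • (1 : M2)) 0 := by
    apply mcoef_congr
    filter_upwards [Bd_conjS ha] with t ht
    rw [ht, Matrix.mul_adjugate]
  rw [h2] at h1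
  have h3 := congrFun (congrFun h1 0) 0
  have h4 : rho (extQ (sProd a (conjS a)) 0) 0 0 = ((‖a 0‖ ^ 2 : ℝ) : ℂ) := by
    have := extQ_nat (sProd a (conjS a)) 0
    rw [Nat.cast_zero] at this
    rw [this, sProd_zero_coeff]
    simp only [conjS]
    rw [Quaternion.self_mul_star, Quaternion.normSq_eq_norm_mul_self, rho00]
    apply Complex.ext <;> simp [sq]
  rw [h4] at h3
  unfold mcoef fourierCoeff at h3
  simp at h3
  have h5 : ‖a 0‖ ^ 2 = ‖∫ t, (Bd a t).det ∂muT‖ := by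
    rw [h3]; simp
  rw [h5]; exact norm_integral_le_integral_norm _

theorem norm_tri {a b : ℕ → HQ} (ha : MemH2 a) (hb : MemH2 b) : √(h2normSq a) ≤ √(h2normSq (a - b)) + √(h2normSq b) := by
  have h : ∀ x : LL, √(h2normSq (x : ℕ → HQ)) = ‖x‖ := fun x => by rw [← LL_norm, Real.sqrt_sq (norm_nonneg _)]
  have e1 := h (toL a ha)
  have e2 := h (toL b hb)
  have e3 := h (toL a ha - toL b hb)
  rw [lp.coeFn_sub] at e3
  change √(h2normSq a) = _ at e1
  change √(h2normSq b) = _ at e2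
  change √(h2normSq (a - b)) = _ at e3
  rw [e1, e2, e3]
  have := norm_add_le (toL a ha - toL b hb) (toL b hb)
  simpa using this

theorem one_norm : h2normSq oneS = 1 := by
  unfold h2normSq
  rw [tsum_eq_single 0]
  · simp [oneS, constS]
  · intro n hn; simp [oneS, constS, hn]

theorem RC.ne {g : ℕ → HQ} (h : RC g) : g ≠ 0 := by
  rintro rfl
  obtain ⟨p, hp, hlt⟩ := h.2 1 one_pos
  have e : sProd 0 p - oneS = -oneS := by funext n; simp [sProd]
  rw [e] at hlt
  have : h2normSq (-oneS) = h2normSq oneS := by simp [h2normSq]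
  rw [this, one_norm] at hlt
  exact lt_irrefl _ hlt

theorem conj_ne {g : ℕ → HQ} (h : g ≠ 0) : conjS g ≠ 0 := by
  intro h0; apply h; rw [← conjS_conjS g, h0]; funext n; simp [conjS]

theorem LR {g : ℕ → HQ} (hg : RC g) : RC (conjS g) := by
  obtain ⟨φ, g₂, hφ, hg₂, e⟩ := beurling (conjS_mem hg.1) (conj_ne hg.ne)
  have hdet : ∀ᵐ t ∂muT, ‖(Bd g₂ t).det‖ = ‖(Bd g t).det‖ := by
    filter_upwards [Bd_conjS hg.1, hφ.2, (Bd_sProd_l hφ.1 hg₂.1 hφ.bdd).2] with t h1 h2 h3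
    have h4 : (Bd g t).adjugate.det = (Bd g t).det := by
      rw [Matrix.det_adjugate]; simp
    rw [← h4, ← h1, e, ← h3, Matrix.det_mul, norm_mul, unit_det h2, one_mul]
  have h0 : ‖g 0‖ = ‖φ 0‖ * ‖g₂ 0‖ := by
    rw [← norm_mul, ← sProd_zero_coeff, ← e, conjS, norm_star]
  have key : 1 ≤ ‖φ 0‖ := by
    by_contra hc
    push Not at hc
    set s := ‖φ 0‖ with hs
    have hs0 : 0 ≤ s := norm_nonneg _
    set δ := (1 - s) / 4 with hδ
    have hδ0 : 0 < δ := by rw [hδ]; linarith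
    obtain ⟨p, hp, hlt⟩ := hg.2 (δ ^ 2) (by positivity)
    have m1 := mem_mul_poly hg.1 hp
    have m2 := mem_mul_poly hg₂.1 hp
    have a1 : ‖g 0 * p 0 - 1‖ ≤ δ := by
      have := coef_le (mem_sub m1 mem_one) 0
      rw [Pi.sub_apply, sProd_zero_coeff] at this
      have e1 : oneS 0 = 1 := by simp [oneS, constS]
      rw [e1] at this
      exact le_of_lt (lt_of_pow_lt_pow_left₀ 2 hδ0.le (this.trans_lt hlt))
    have a2 : √(h2normSq (sProd g p)) ≤ 1 + δ := by
      have := norm_tri m1 mem_one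
      rw [one_norm, Real.sqrt_one] at this
      have h5 : √(h2normSq (sProd g p - oneS)) ≤ δ := by
        rw [← Real.sqrt_sq hδ0.le]; exact Real.sqrt_le_sqrt hlt.le
      linarith
    have a3 : ‖g₂ 0‖ * ‖p 0‖ ≤ 1 + δ := by
      refine le_trans ?_ a2
      apply Real.le_sqrt_of_sq_le
      have b1 := det0 m2
      rw [sProd_zero_coeff, norm_mul] at b1
      refine b1.trans ?_
      rw [h2_fro m1, ← integral_div]
      refine integral_mono_of_nonneg (ae_of_all _ fun t => norm_nonneg _) ((fro_int (ML2_Bd _)).div_const 2) ?_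
      filter_upwards [hdet, (Bd_sProd_r hg.1 (poly_mem hp) (MBdd_poly hp)).2, (Bd_sProd_r hg₂.1 (poly_mem hp) (MBdd_poly hp)).2] with t c1 c2 c3
      rw [← c2, ← c3]
      rw [Matrix.det_mul, norm_mul, c1, ← norm_mul, ← Matrix.det_mul]
      exact det_le_fro _
    have a4 : 1 - δ ≤ ‖g 0‖ * ‖p 0‖ := by
      rw [← norm_mul]
      have := norm_sub_norm_le (1 : HQ) (g 0 * p 0)
      rw [norm_one, norm_sub_rev] at this
      linarith
    rw [h0] at a4
    have a5 : s * ‖g₂ 0‖ * ‖p 0‖ ≤ s * (1 + δ) := by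
      rw [mul_assoc]; exact mul_le_mul_of_nonneg_left a3 hs0
    nlinarith
  obtain ⟨ec, hc⟩ := const_of hφ.1 hφ.norm.le key
  rw [e, ec]
  exact RC_const hg₂ hc

end HFact

end

end

section
open MeasureTheory Filter Topology
open scoped ENNReal Classical Matrix
noncomputable section
set_option linter.unusedVariables false
namespace HFact

theorem toL_dist {a b : ℕ → HQ} (ha : MemH2 a) (hb : MemH2 b) : dist (toL a ha) (toL b hb) = √(h2normSq (a - b)) := by
  have h : ∀ x : LL, √(h2normSq (x : ℕ → HQ)) = ‖x‖ := fun x => by rw [← LL_norm, Real.sqrt_sq (norm_nonneg _)]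
  have e3 := h (toL a ha - toL b hb)
  rw [lp.coeFn_sub] at e3
  rw [dist_eq_norm, ← e3]; rfl

theorem m2_tendsto {A : ℕ → M2} {B : M2} (h : Tendsto (fun n => fro (A n - B)) atTop (𝓝 0)) : Tendsto A atTop (𝓝 B) := by
  refine tendsto_pi_nhds.2 fun i => tendsto_pi_nhds.2 fun j => ?_
  rw [tendsto_iff_norm_sub_tendsto_zero]
  have h1 : Tendsto (fun n => √(fro (A n - B))) atTop (𝓝 0) := by
    have := (Real.continuous_sqrt.tendsto 0).comp h
    simpa [Function.comp_def] using this
  refine squeeze_zero (fun n => norm_nonneg _) (fun n => ?_) h1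
  apply Real.le_sqrt_of_sq_le
  exact entry_le_fro (A n - B) i j

theorem limit_alg {P : ℕ → M2} {G H W : M2} (h1 : Tendsto (fun n => P n * G) atTop (𝓝 1))
    (h2 : Tendsto (fun n => P n * H) atTop (𝓝 W)) (e : G * Gᴴ = H * Hᴴ) : Wᴴ * W = 1 ∧ H = G * W := by
  have hd : G.det ≠ 0 := by
    intro h0
    have hc : Continuous (fun A : M2 => A.det) := Continuous.matrix_det continuous_id
    have := (hc.tendsto 1).comp h1
    have e2 : ((fun A : M2 => A.det) ∘ fun n => P n * G) = fun n => 0 := by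
      funext n; simp [Matrix.det_mul, h0]
    rw [e2] at this
    have := tendsto_nhds_unique this tendsto_const_nhds
    simp at this
  have hu : IsUnit G.det := isUnit_iff_ne_zero.2 hd
  have h3 : Tendsto (fun n => P n * H) atTop (𝓝 (1 * (G⁻¹ * H))) := by
    have := h1.mul_const (G⁻¹ * H)
    refine this.congr fun n => ?_
    rw [Matrix.mul_assoc, ← Matrix.mul_assoc G, Matrix.mul_nonsing_inv _ hu, Matrix.one_mul]
  have hW : W = G⁻¹ * H := by rw [tendsto_nhds_unique h2 h3, Matrix.one_mul]
  constructor
  · apply mul_eq_one_comm.1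
    rw [hW, Matrix.conjTranspose_mul, Matrix.mul_assoc, ← Matrix.mul_assoc H, ← e, Matrix.mul_assoc, ← Matrix.conjTranspose_mul,
      Matrix.nonsing_inv_mul _ hu, Matrix.conjTranspose_one, Matrix.mul_one, Matrix.nonsing_inv_mul _ hu]
  · rw [hW, ← Matrix.mul_assoc, Matrix.mul_nonsing_inv _ hu, Matrix.one_mul]

theorem fact_right {g h : ℕ → HQ} (hg : RC g) (hh : MemH2 h)
    (e : ∀ᵐ t ∂muT, Bd g t * (Bd g t)ᴴ = Bd h t * (Bd h t)ᴴ) : ∃ w, UB w ∧ h = sProd g w := by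
  have hex : ∀ n : ℕ, ∃ p, IsPolyQ p ∧ h2normSq (sProd p g - oneS) < 1 / ((n : ℝ) + 1) := by
    intro n
    obtain ⟨q, hq, hlt⟩ := (LR hg).2 (1 / ((n : ℝ) + 1)) (by positivity)
    refine ⟨conjS q, conjS_poly hq, ?_⟩
    rw [← conjS_norm, conjS_sub, conjS_sProd, conjS_conjS, conjS_oneS]
    exact hlt
  choose p hp hlt using hex
  have mg := fun n => mem_poly_mul hg.1 (hp n)
  have mh := fun n => mem_poly_mul hh (hp n)
  have bg := fun n => (Bd_sProd_l (poly_mem (hp n)) hg.1 (MBdd_poly (hp n))).2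
  have bh := fun n => (Bd_sProd_l (poly_mem (hp n)) hh (MBdd_poly (hp n))).2
  have t1 : Tendsto (fun n => h2normSq (sProd (p n) g - oneS)) atTop (𝓝 0) :=
    squeeze_zero (fun n => norm_nonneg' _) (fun n => (hlt n).le) tendsto_one_div_add_atTop_nhds_zero_nat
  have tg : Tendsto (fun n => toL _ (mg n)) atTop (𝓝 (toL oneS mem_one)) := by
    rw [tendsto_iff_dist_tendsto_zero]
    simp only [toL_dist]
    have := (Real.continuous_sqrt.tendsto 0).comp t1
    simpa [Function.comp_def] using this
  have hcg := tg.cauchySeq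
  have hdist : ∀ m n, dist (toL _ (mh m)) (toL _ (mh n)) = dist (toL _ (mg m)) (toL _ (mg n)) := by
    intro m n
    rw [toL_dist, toL_dist, h2_fro (mem_sub (mh m) (mh n)), h2_fro (mem_sub (mg m) (mg n))]
    congr 2
    apply integral_congr_ae
    filter_upwards [Bd_sub (mh m) (mh n), Bd_sub (mg m) (mg n), bg m, bg n, bh m, bh n, e] with t a1 a2 a3 a4 a5 a6 a7
    rw [← a1, ← a2, ← a3, ← a4, ← a5, ← a6, ← Matrix.sub_mul, ← Matrix.sub_mul]
    exact (fro_right a7 _).symm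
  have hch : CauchySeq (fun n => toL _ (mh n)) := by
    rw [Metric.cauchySeq_iff] at hcg ⊢
    simpa only [hdist] using hcg
  obtain ⟨W, hW⟩ := cauchySeq_tendsto_of_complete hch
  set w : ℕ → HQ := (W : ℕ → HQ) with hw
  have mw : MemH2 w := LL_mem W
  have hWt : W = toL w mw := rfl
  have t2 : Tendsto (fun n => h2normSq (sProd (p n) h - w)) atTop (𝓝 0) := by
    rw [hWt, tendsto_iff_dist_tendsto_zero] at hW
    simp only [toL_dist] at hW
    have := hW.pow 2
    simp only [Real.sq_sqrt (norm_nonneg' _)] at this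
    simpa using this
  -- common function
  set D : ℕ → Tor → ℝ := fun n t => fro (Bd (sProd (p n) g - oneS) t) + fro (Bd (sProd (p n) h - w) t) with hD
  have i1 : ∀ n, Integrable (fun t => fro (Bd (sProd (p n) g - oneS) t)) muT := fun n => fro_int (ML2_Bd _)
  have i2 : ∀ n, Integrable (fun t => fro (Bd (sProd (p n) h - w) t)) muT := fun n => fro_int (ML2_Bd _)
  have iD : ∀ n, Integrable (D n) muT := fun n => (i1 n).add (i2 n)
  have D0 : ∀ n t, 0 ≤ D n t := fun n t => add_nonneg (fro_nonneg _) (fro_nonneg _)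
  have eD : ∀ n, ∫ t, D n t ∂muT = 2 * h2normSq (sProd (p n) g - oneS) + 2 * h2normSq (sProd (p n) h - w) := by
    intro n
    rw [h2_fro (mem_sub (mg n) mem_one), h2_fro (mem_sub (mh n) mw)]
    refine (integral_add (i1 n) (i2 n)).trans ?_
    ring
  have tD : Tendsto (fun n => ∫ t, D n t ∂muT) atTop (𝓝 0) := by
    simp only [eD]
    have := (t1.const_mul 2).add (t2.const_mul 2)
    simpa using this
  have tm : TendstoInMeasure muT D atTop (fun _ => 0) := by
    refine tendstoInMeasure_of_tendsto_eLpNorm (p := 1) one_ne_zero (fun n => (iD n).1) aestronglyMeasurable_const ?_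
    have e1 : ∀ n, eLpNorm (D n - fun _ => 0) 1 muT = ENNReal.ofReal (∫ t, D n t ∂muT) := by
      intro n
      have : (D n - fun _ => (0:ℝ)) = D n := by funext t; simp
      rw [this, eLpNorm_one_eq_lintegral_enorm, ofReal_integral_eq_lintegral_ofReal (iD n) (ae_of_all _ (D0 n))]
      congr 1; funext t
      rw [Real.enorm_eq_ofReal (D0 n t)]
    simp only [e1]
    have := ENNReal.tendsto_ofReal tD
    simpa using this
  obtain ⟨ns, hns, hae⟩ := tm.exists_seq_tendsto_ae
  have final : ∀ᵐ t ∂muT, (Bd w t)ᴴ * Bd w t = 1 ∧ Bd h t = Bd g t * Bd w t := by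
    have s1 := ae_all_iff.2 fun n => Bd_sub (mg n) mem_one
    have s2 := ae_all_iff.2 fun n => Bd_sub (mh n) mw
    filter_upwards [s1, s2, ae_all_iff.2 bg, ae_all_iff.2 bh, e, hae, Bd_one] with t c1 c2 c3 c4 c5 c6 c7
    refine limit_alg (P := fun k => Bd (p (ns k)) t) (m2_tendsto ?_) (m2_tendsto ?_) c5
    · refine squeeze_zero (fun n => fro_nonneg _) (fun k => ?_) c6
      rw [c3 (ns k), ← c7, c1 (ns k)]
      exact le_add_of_nonneg_right (fro_nonneg _)
    · refine squeeze_zero (fun n => fro_nonneg _) (fun k => ?_) c6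
      rw [c4 (ns k), c2 (ns k)]
      exact le_add_of_nonneg_left (fro_nonneg _)
  have hU : UB w := ⟨mw, final.mono fun t ht => ht.1⟩
  refine ⟨w, hU, ?_⟩
  obtain ⟨m, b⟩ := Bd_sProd_r hg.1 mw hU.bdd
  refine Bd_inj hh m ?_
  filter_upwards [final, b] with t a1 a2
  rw [a1.2, a2]

theorem RC.outer {g : ℕ → HQ} (hg : RC g) : IsOuterQ g := by
  refine ⟨hg.1, fun h hh H q hq => ?_⟩
  obtain ⟨w, hw, rfl⟩ := fact_right hg hh (br_mp hg.1 hh H)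
  exact ev_mul_le hg.1 hw hq

theorem eval_zero (a : ℕ → HQ) : evalS a 0 = a 0 := by
  unfold evalS
  rw [tsum_eq_single 0]
  · simp
  · intro n hn; simp [hn]

theorem RC.ne0 {g : ℕ → HQ} (h : RC g) : g 0 ≠ 0 := by
  intro h0
  obtain ⟨p, hp, hlt⟩ := h.2 1 one_pos
  have := coef_le (mem_sub (mem_mul_poly h.1 hp) mem_one) 0
  rw [Pi.sub_apply, sProd_zero_coeff, h0] at this
  simp [oneS, constS] at this
  simp only [oneS] at hlt
  linarith

theorem outer_RC {g : ℕ → HQ} (hg : IsOuterQ g) (hne : g ≠ 0) : RC g := by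
  obtain ⟨φ, h', hφ, hh', e⟩ := beurling (conjS_mem hg.1) (conj_ne hne)
  have eg : g = sProd (conjS h') (conjS φ) := by rw [← conjS_sProd, ← e, conjS_conjS]
  have mh := conjS_mem hh'.1
  have hψ := hφ.conj
  have hm : ∀ᵐ t ∂muT, Bd g t * (Bd g t)ᴴ = Bd (conjS h') t * (Bd (conjS h') t)ᴴ := by
    filter_upwards [(Bd_sProd_r mh hψ.1 hψ.bdd).2, hψ.2] with t a1 a2
    rw [eg, ← a1, Matrix.conjTranspose_mul, Matrix.mul_assoc, ← Matrix.mul_assoc (Bd (conjS φ) t), mul_eq_one_comm.1 a2, Matrix.one_mul]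
  have h0 := hg.2 _ mh (br_mpr hg.1 mh hm) 0 (by simp [QBall])
  rw [eval_zero, eval_zero, eg, sProd_zero_coeff, norm_mul] at h0
  simp only [conjS, norm_star] at h0
  have hp : 0 < ‖h' 0‖ := norm_pos_iff.2 hh'.ne0
  have h1 : 1 ≤ ‖φ 0‖ := by
    by_contra hc; push Not at hc; nlinarith
  obtain ⟨ec, hc⟩ := const_of hφ.1 hφ.norm.le h1
  rw [← conjS_conjS g]
  apply LR
  rw [e, ec]
  exact RC_const hh' hc

theorem main (f : ℕ → HQ) (hf : MemH2 f) (hne : f ≠ 0) :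
    (∃ φ g : ℕ → HQ, IsInnerQ φ ∧ IsOuterQ g ∧ f = sProd φ g) ∧
    (∀ φ g φ₁ g₁ : ℕ → HQ,
      IsInnerQ φ → IsOuterQ g → IsInnerQ φ₁ → IsOuterQ g₁ →
      f = sProd φ g → f = sProd φ₁ g₁ →
      ∃ l : HQ, ‖l‖ = 1 ∧
        φ₁ = sProd φ (constS l) ∧ g₁ = sProd (constS (star l)) g) := by
  constructor
  · obtain ⟨φ, g, hφ, hg, e⟩ := beurling hf hne
    exact ⟨φ, g, inner_iff.2 hφ, hg.outer, e⟩
  · intro φ g φ₁ g₁ h1 h2 h3 h4 e e₁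
    have z : ∀ x : ℕ → HQ, sProd x 0 = 0 := fun x => by funext n; simp [sProd]
    have n1 : g ≠ 0 := by rintro rfl; exact hne (by rw [e, z])
    have n2 : g₁ ≠ 0 := by rintro rfl; exact hne (by rw [e₁, z])
    exact uniq (inner_iff.1 h1) (inner_iff.1 h3) (outer_RC h2 n1) (outer_RC h4 n2) e e₁

end HFact

end

end

/-- **Inner–outer factorization.** Every `f ∈ H²(𝔹)`, `f ≢ 0`, factors as `f = φ * g`
with `φ` inner, `g` outer; the factorization is unique up to a unimodular constant. -/
theorem inner_outer_factorization (f : ℕ → Quaternion ℝ) (hf : MemH2 f) (hne : f ≠ 0) :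
    (∃ φ g : ℕ → Quaternion ℝ, IsInnerQ φ ∧ IsOuterQ g ∧ f = sProd φ g) ∧
    (∀ φ g φ₁ g₁ : ℕ → Quaternion ℝ,
      IsInnerQ φ → IsOuterQ g → IsInnerQ φ₁ → IsOuterQ g₁ →
      f = sProd φ g → f = sProd φ₁ g₁ →
      ∃ l : Quaternion ℝ, ‖l‖ = 1 ∧
        φ₁ = sProd φ (constS l) ∧ g₁ = sProd (constS (star l)) g) := by
  exact HFact.main f hf hne
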